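/- Let a, b, c, g, h : ℝ → ℝ be given coefficient functions, let d0, g0, h0 be real constants, and let μ, α, β, γ : ℝ → ℝ be differentiable functions satisfying the Riccati system α'(t) + b(t) + 2c(t)α(t) + 4a(t)α(t)² = 0, β'(t) + (c(t) + 4a(t)α(t))β(t) = 0, γ'(t) - a(t)β(t)² = 0, μ'(t) - 4a(t)α(t)μ(t) = 0, with μ(t) > 0 for all t. Suppose the coefficients d, g, h are given by d(t) = d0·a(t)·β(t)², g(t) = g0·a(t)·β(t)², h(t) = h0·a(t)·β(t)²·μ(t). Let u, v : ℝ × ℝ → ℂ be functions of (ξ, τ), twice continuously differentiable in ξ and continuously differentiable in τ, satisfying the constant-coefficient system i·u_τ + u_ξξ + i·d0·u - g0·u - h0·(|u|² + |v|²)·u = 0 and i·v_τ - v_ξξ + i·d0·v + g0·v + h0·(|u|² + |v|²)·v = 0. Then the functions ψ(x,t) = μ(t)^(-1/2)·exp(i·α(t)·x²)·u(β(t)·x, γ(t)) and φ(x,t) = μ(t)^(-1/2)·exp(-i·α(t)·x²)·v(β(t)·x, γ(t)) satisfy the coupled NLS system with variable coefficients: i ψ_t = -a(t) ψ_xx + b(t)x²ψ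 - i c(t) x ψ_x - i d(t) ψ + g(t) ψ + h(t)(|ψ|²+|φ|²)ψ and i φ_t = a(t) φ_xx - b(t)x²φ - i c(t) x φ_x - i d(t) φ - g(t) φ - h(t)(|ψ|²+|φ|²)φ. -/

import Mathlib

/-- Partial derivative in the first (space) variable. -/
noncomputable def pderivX (f : ℝ → ℝ → ℂ) (x t : ℝ) : ℂ :=
  deriv (fun x' => f x' t) x

/-- Second partial derivative in the first (space) variable. -/
noncomputable def pderivXX (f : ℝ → ℝ → ℂ) (x t : ℝ) : ℂ :=
  iteratedDeriv 2 (fun x' => f x' t) x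

/-- Partial derivative in the second (time) variable. -/
noncomputable def pderivT (f : ℝ → ℝ → ℂ) (x t : ℝ) : ℂ :=
  deriv (fun t' => f x t') t

/-- The coupled NLS system with variable coefficients. -/
def CNLS (a b c d g h : ℝ → ℝ) (ψ φ : ℝ → ℝ → ℂ) : Prop :=
  ∀ x t : ℝ,
    (Complex.I * pderivT ψ x t =
      -(a t : ℂ) * pderivXX ψ x t + (b t : ℂ) * (x : ℂ) ^ 2 * ψ x t
        - Complex.I * (c t : ℂ) * (x : ℂ) * pderivX ψ x t
        - Complex.I * (d t : ℂ) * ψ x t + (g t : ℂ) * ψ x t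
        + (h t : ℂ) * ((‖ψ x t‖ ^ 2 + ‖φ x t‖ ^ 2 : ℝ) : ℂ) * ψ x t)
    ∧ (Complex.I * pderivT φ x t =
      (a t : ℂ) * pderivXX φ x t - (b t : ℂ) * (x : ℂ) ^ 2 * φ x t
        - Complex.I * (c t : ℂ) * (x : ℂ) * pderivX φ x t
        - Complex.I * (d t : ℂ) * φ x t - (g t : ℂ) * φ x t
        - (h t : ℂ) * ((‖ψ x t‖ ^ 2 + ‖φ x t‖ ^ 2 : ℝ) : ℂ) * φ x t)

open Set Filter Topology MeasureTheory Asymptotics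

/-! ### Touching lemmas -/

theorem touch_lower_aux {f : ℝ → ℝ} {a b C : ℝ} (hab : a ≤ b) (hf : ContinuousOn f (Icc a b))
    (h : ∀ x ∈ Ico a b, ∃ (n : ℝ → ℝ) (D : ℝ), HasDerivAt n D x ∧
      (∀ᶠ z in 𝓝 x, n z - n x ≤ f z - f x) ∧ |D| ≤ C) : -(C * (b - a)) ≤ f b - f a := by
  have key := image_le_of_liminf_slope_right_le_deriv_boundary (f := fun x => - f x) (a := a) (b := b)
    hf.neg (B := fun x => - f a + C * (x - a)) (B' := fun _ => C) (by simp)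
    (by fun_prop) (fun x _ => by
      have : HasDerivAt (fun x => - f a + C * (x - a)) C x := by
        simpa using (((hasDerivAt_id x).sub_const a).const_mul C).const_add (-f a)
      exact this.hasDerivWithinAt) ?_ (right_mem_Icc.2 hab)
  · linarith
  · intro x hx r hr
    obtain ⟨n, D, hn, ht, hD⟩ := h x hx
    have h1 : Tendsto (slope n x) (𝓝[>] x) (𝓝 D) :=
      (hasDerivAt_iff_tendsto_slope.1 hn).mono_left (nhdsWithin_mono _ (fun z hz => ne_of_gt hz))
    have h2 : ∀ᶠ z in 𝓝[>] x, -r < slope n x z :=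
      h1.eventually (lt_mem_nhds (by have := (abs_le.1 hD).1; linarith))
    refine Eventually.frequently ?_
    filter_upwards [h2, ht.filter_mono nhdsWithin_le_nhds, self_mem_nhdsWithin] with z hz1 hz2 hz3
    have hz3 : 0 < z - x := sub_pos.2 hz3
    rw [slope_def_field] at hz1 ⊢
    rw [lt_div_iff₀ hz3] at hz1
    rw [div_lt_iff₀ hz3]
    linarith

theorem touch_lower {f : ℝ → ℝ} {a b C : ℝ} (hab : a ≤ b) (hf : ContinuousOn f (Icc a b))
    (h : ∀ x ∈ Ioo a b, ∃ (n : ℝ → ℝ) (D : ℝ), HasDerivAt n D x ∧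
      (∀ᶠ z in 𝓝 x, n z - n x ≤ f z - f x) ∧ |D| ≤ C) : -(C * (b - a)) ≤ f b - f a := by
  rcases hab.eq_or_lt with rfl | hab'
  · simp
  have h1 : ∀ᶠ a' in 𝓝[>] a, -(C * (b - a')) ≤ f b - f a' := by
    filter_upwards [Ioo_mem_nhdsGT hab'] with a' ha'
    exact touch_lower_aux ha'.2.le (hf.mono (Icc_subset_Icc ha'.1.le le_rfl))
      (fun x hx => h x ⟨ha'.1.trans_le hx.1, hx.2⟩)
  have h2 : Tendsto (fun a' => -(C * (b - a'))) (𝓝[>] a) (𝓝 (-(C * (b - a)))) :=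
    (Continuous.tendsto (by fun_prop) a).mono_left nhdsWithin_le_nhds
  have h3 : Tendsto (fun a' => f b - f a') (𝓝[>] a) (𝓝 (f b - f a)) := by
    refine Tendsto.const_sub _ ?_
    have := (hf a (left_mem_Icc.2 hab)).mono_left (nhdsWithin_mono a (Ioc_subset_Icc_self))
    rwa [nhdsWithin_Ioc_eq_nhdsGT hab'] at this
  exact le_of_tendsto_of_tendsto h2 h3 h1

theorem touch_bound {f : ℝ → ℝ} {a b C : ℝ} (hab : a ≤ b) (hf : ContinuousOn f (Icc a b))
    (h : ∀ x ∈ Ioo a b, ∃ (n : ℝ → ℝ) (D : ℝ), HasDerivAt n D x ∧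
      (∀ᶠ z in 𝓝 x, n z - n x ≤ f z - f x) ∧ |D| ≤ C) : |f b - f a| ≤ C * (b - a) := by
  rw [abs_le]
  refine ⟨touch_lower hab hf h, ?_⟩
  have key := touch_lower (f := fun x => f (a + b - x)) (a := a) (b := b) (C := C) hab ?_ ?_
  · simp only [add_sub_cancel_right, add_sub_cancel_left] at key; linarith
  · refine hf.comp (by fun_prop) ?_
    intro x hx
    simp only [mem_Icc] at *
    constructor <;> linarith
  · intro x hx
    obtain ⟨n, D, hn, ht, hD⟩ := h (a + b - x) (by
      simp only [mem_Ioo] at *; constructor <;> linarith)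
    refine ⟨fun z => n (a + b - z), -D, ?_, ?_, by simpa using hD⟩
    · exact hn.comp_const_sub (a + b) x
    · have : Tendsto (fun z => a + b - z) (𝓝 x) (𝓝 (a + b - x)) :=
        Continuous.tendsto (by fun_prop) x
      exact this.eventually ht

theorem touch_gronwall {f : ℝ → ℝ} {a b C δ : ℝ} (hab : a ≤ b) (hδ : 0 < δ)
    (hf : ContinuousOn f (Icc a b)) (hf0 : ∀ x, 0 ≤ f x)
    (h : ∀ x ∈ Ioo a b, ∃ (n : ℝ → ℝ) (D : ℝ), HasDerivAt n D x ∧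
      (∀ᶠ z in 𝓝 x, n z - n x ≤ f z - f x) ∧ |D| ≤ C * (δ + f x)) :
    δ + f b ≤ Real.exp (C * (b - a)) * (δ + f a) ∧
    δ + f a ≤ Real.exp (C * (b - a)) * (δ + f b) := by
  have hpos : ∀ x, 0 < δ + f x := fun x => by have := hf0 x; linarith
  have key := touch_bound (f := fun x => Real.log (δ + f x)) (a := a) (b := b) (C := C) hab
    (ContinuousOn.log (by fun_prop) (fun x _ => (hpos x).ne')) ?_
  · rw [abs_le] at key
    constructor
    · rw [← Real.log_le_log_iff (hpos _) (mul_pos (Real.exp_pos _) (hpos _)),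
        Real.log_mul (Real.exp_pos _).ne' (hpos _).ne', Real.log_exp]
      linarith [key.2]
    · rw [← Real.log_le_log_iff (hpos _) (mul_pos (Real.exp_pos _) (hpos _)),
        Real.log_mul (Real.exp_pos _).ne' (hpos _).ne', Real.log_exp]
      linarith [key.1]
  · intro x hx
    obtain ⟨n, D, hn, ht, hD⟩ := h x hx
    have hn' : HasDerivAt (fun z => δ + f x + (n z - n x)) D x :=
      (hn.sub_const (n x)).const_add _
    refine ⟨fun z => Real.log (δ + f x + (n z - n x)), D / (δ + f x), ?_, ?_, ?_⟩
    · have := hn'.log (by simpa using (hpos x).ne')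
      simpa using this
    · have : ∀ᶠ z in 𝓝 x, 0 < δ + f x + (n z - n x) :=
        hn'.continuousAt.eventually (lt_mem_nhds (by simpa using hpos x))
      filter_upwards [this, ht] with z hz1 hz2
      simp only [sub_self, add_zero]
      exact sub_le_sub_right (Real.log_le_log hz1 (by linarith)) _
    · rw [abs_div, abs_of_pos (hpos x), div_le_iff₀ (hpos x)]
      exact hD

/-! ### Integral lemmas -/

theorem fatou_interval {p q M : ℝ} (hpq : p ≤ q) {f : ℝ → ℝ} {g : ℕ → ℝ → ℝ}
    (hf : ContinuousOn f (Icc p q)) (hg : ∀ n, ContinuousOn (g n) (Icc p q))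
    (hf0 : ∀ x ∈ Icc p q, 0 ≤ f x) (hg0 : ∀ n, ∀ x ∈ Icc p q, 0 ≤ g n x)
    (hfg : ∀ x ∈ Icc p q, ∀ ε > 0, ∀ᶠ n in atTop, f x ≤ g n x + ε)
    (hM : ∀ n, ∫ x in p..q, g n x ≤ M) : ∫ x in p..q, f x ≤ M := by
  rw [intervalIntegral.integral_of_le hpq, ← integral_Icc_eq_integral_Ioc]
  have hM' : ∀ n, ∫ x in Icc p q, g n x ≤ M := fun n => by
    rw [integral_Icc_eq_integral_Ioc, ← intervalIntegral.integral_of_le hpq]; exact hM n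
  have hM0 : 0 ≤ M := (setIntegral_nonneg measurableSet_Icc (hg0 0)).trans (hM' 0)
  have hI : ∀ n, ∫⁻ x in Icc p q, ENNReal.ofReal (g n x) ≤ ENNReal.ofReal M := fun n => by
    rw [← ofReal_integral_eq_lintegral_ofReal (hg n).integrableOn_Icc
      ((ae_restrict_iff' measurableSet_Icc).2 (ae_of_all _ (hg0 n)))]
    exact ENNReal.ofReal_le_ofReal (hM' n)
  have h1 : ∫⁻ x in Icc p q, ENNReal.ofReal (f x) ≤ ENNReal.ofReal M := by
    calc ∫⁻ x in Icc p q, ENNReal.ofReal (f x)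
        ≤ ∫⁻ x in Icc p q, liminf (fun n => ENNReal.ofReal (g n x)) atTop := by
          refine setLIntegral_mono' measurableSet_Icc ?_
          intro x hx
          refine ENNReal.le_of_forall_pos_le_add ?_
          intro ε hε _
          rw [← tsub_le_iff_right]
          refine le_liminf_of_le (by isBoundedDefault) ?_
          filter_upwards [hfg x hx ε (by exact_mod_cast hε)] with n hn
          rw [tsub_le_iff_right]
          calc ENNReal.ofReal (f x) ≤ ENNReal.ofReal (g n x + ε) := ENNReal.ofReal_le_ofReal hn
            _ ≤ _ := by
              refine ENNReal.ofReal_add_le.trans ?_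
              simp
      _ ≤ liminf (fun n => ∫⁻ x in Icc p q, ENNReal.ofReal (g n x)) atTop := by
          refine lintegral_liminf_le' (fun n => ?_)
          exact ((hg n).aestronglyMeasurable measurableSet_Icc).aemeasurable.ennreal_ofReal
      _ ≤ ENNReal.ofReal M := by
          refine liminf_le_of_le (by isBoundedDefault) ?_
          intro b hb
          obtain ⟨n, hn⟩ := hb.exists
          exact hn.trans (hI n)
  rw [← ofReal_integral_eq_lintegral_ofReal hf.integrableOn_Icc
      ((ae_restrict_iff' measurableSet_Icc).2 (ae_of_all _ hf0))] at h1
  exact (ENNReal.ofReal_le_ofReal_iff hM0).1 h1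

theorem L2_add_aux {E : Type*} [NormedAddCommGroup E] {p q C D : ℝ} (hpq : p ≤ q)
    {f g : ℝ → E} (hf : ContinuousOn f (Icc p q)) (hg : ContinuousOn g (Icc p q))
    (hC : 0 < C) (hD : 0 < D)
    (h1 : ∫ x in p..q, ‖f x‖ ^ 2 ≤ C ^ 2) (h2 : ∫ x in p..q, ‖g x‖ ^ 2 ≤ D ^ 2) :
    ∫ x in p..q, ‖f x + g x‖ ^ 2 ≤ (C + D) ^ 2 := by
  rw [← uIcc_of_le hpq] at hf hg
  have i1 : IntervalIntegrable (fun x => ‖f x‖ ^ 2) volume p q :=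
    (hf.norm.pow 2).intervalIntegrable
  have i2 : IntervalIntegrable (fun x => ‖g x‖ ^ 2) volume p q :=
    (hg.norm.pow 2).intervalIntegrable
  calc ∫ x in p..q, ‖f x + g x‖ ^ 2
      ≤ ∫ x in p..q, ((1 + D / C) * ‖f x‖ ^ 2 + (1 + C / D) * ‖g x‖ ^ 2) := by
        refine intervalIntegral.integral_mono_on hpq ((hf.add hg).norm.pow 2).intervalIntegrable
          ((i1.const_mul _).add (i2.const_mul _)) ?_
        intro x _
        have h := norm_add_le (f x) (g x)
        have h' : ‖f x + g x‖ ^ 2 ≤ (‖f x‖ + ‖g x‖) ^ 2 := by gcongr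
        refine h'.trans ?_
        have : (1 + D / C) * ‖f x‖ ^ 2 + (1 + C / D) * ‖g x‖ ^ 2 - (‖f x‖ + ‖g x‖) ^ 2
          = (D * ‖f x‖ - C * ‖g x‖) ^ 2 / (C * D) := by field_simp; ring
        have : 0 ≤ (D * ‖f x‖ - C * ‖g x‖) ^ 2 / (C * D) := by positivity
        linarith
    _ = (1 + D / C) * (∫ x in p..q, ‖f x‖ ^ 2) + (1 + C / D) * ∫ x in p..q, ‖g x‖ ^ 2 := by
        rw [intervalIntegral.integral_add (i1.const_mul _) (i2.const_mul _), intervalIntegral.integral_const_mul,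
          intervalIntegral.integral_const_mul]
    _ ≤ (1 + D / C) * C ^ 2 + (1 + C / D) * D ^ 2 := by gcongr
    _ = (C + D) ^ 2 := by field_simp; ring

theorem L2_add {E : Type*} [NormedAddCommGroup E] {p q C D : ℝ} (hpq : p ≤ q)
    {f g : ℝ → E} (hf : ContinuousOn f (Icc p q)) (hg : ContinuousOn g (Icc p q))
    (hC : 0 ≤ C) (hD : 0 ≤ D)
    (h1 : ∫ x in p..q, ‖f x‖ ^ 2 ≤ C ^ 2) (h2 : ∫ x in p..q, ‖g x‖ ^ 2 ≤ D ^ 2) :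
    ∫ x in p..q, ‖f x + g x‖ ^ 2 ≤ (C + D) ^ 2 := by
  have h : ∀ᶠ ε : ℝ in 𝓝[>] 0, ∫ x in p..q, ‖f x + g x‖ ^ 2 ≤ ((C + ε) + (D + ε)) ^ 2 := by
    filter_upwards [self_mem_nhdsWithin] with ε hε
    have hε : 0 < ε := hε
    exact L2_add_aux hpq hf hg (by linarith) (by linarith)
      (h1.trans (by gcongr; linarith)) (h2.trans (by gcongr; linarith))
  have h' : Tendsto (fun ε : ℝ => ((C + ε) + (D + ε)) ^ 2) (𝓝[>] 0) (𝓝 ((C + 0 + (D + 0)) ^ 2)) :=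
    (Continuous.tendsto (by fun_prop) 0).mono_left nhdsWithin_le_nhds
  simpa using ge_of_tendsto h' h


def L1D {E : Type*} [NormedAddCommGroup E] [NormedSpace ℝ E] (p q : ℝ) (w wt : ℝ → ℝ → E)
    (t : ℝ) : Prop :=
  (fun σ => ∫ ξ in p..q, ‖w ξ σ - w ξ t - (σ - t) • wt ξ t‖) =o[𝓝 t] (fun σ => σ - t)

theorem L1D_of_L2 {E : Type*} [NormedAddCommGroup E] [NormedSpace ℝ E] {p q t C : ℝ}
    {w wt : ℝ → ℝ → E} (hpq : p ≤ q)
    (hw : ∀ σ, ContinuousOn (fun ξ => w ξ σ) (Icc p q))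
    (hwt : ContinuousOn (fun ξ => wt ξ t) (Icc p q))
    (hd : ∀ ξ ∈ Icc p q, HasDerivAt (fun σ => w ξ σ) (wt ξ t) t)
    (hL : ∀ᶠ σ in 𝓝 t, ∫ ξ in p..q, ‖w ξ σ - w ξ t‖ ^ 2 ≤ C * (σ - t) ^ 2) :
    L1D p q w wt t := by
  have huI : uIcc p q = Icc p q := uIcc_of_le hpq
  set Q : ℝ → ℝ → E := fun σ ξ => (σ - t)⁻¹ • (w ξ σ - w ξ t) - wt ξ t with hQ
  have hQc : ∀ σ, ContinuousOn (Q σ) (Icc p q) := fun σ =>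
    (((hw σ).sub (hw t)).const_smul _).sub hwt
  set M := ∫ ξ in p..q, ‖wt ξ t‖ ^ 2 with hM
  have hIntg : ∀ {f : ℝ → ℝ}, ContinuousOn f (Icc p q) → IntervalIntegrable f volume p q :=
    fun {f} hf => ContinuousOn.intervalIntegrable (by rwa [huI])
  have hQ2 : ∀ᶠ σ in 𝓝[≠] t, ∫ ξ in p..q, ‖Q σ ξ‖ ^ 2 ≤ 2 * C + 2 * M := by
    filter_upwards [hL.filter_mono nhdsWithin_le_nhds, self_mem_nhdsWithin] with σ h1 h2
    have h2 : σ - t ≠ 0 := sub_ne_zero.2 h2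
    have i1 : IntervalIntegrable (fun ξ => ‖w ξ σ - w ξ t‖ ^ 2) volume p q :=
      hIntg (((hw σ).sub (hw t)).norm.pow 2)
    have i2 : IntervalIntegrable (fun ξ => ‖wt ξ t‖ ^ 2) volume p q := hIntg (hwt.norm.pow 2)
    calc ∫ ξ in p..q, ‖Q σ ξ‖ ^ 2
        ≤ ∫ ξ in p..q, (2 * ((σ - t) ^ 2)⁻¹ * ‖w ξ σ - w ξ t‖ ^ 2 + 2 * ‖wt ξ t‖ ^ 2) := by
          refine intervalIntegral.integral_mono_on hpq (hIntg ((hQc σ).norm.pow 2))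
            ((i1.const_mul _).add (i2.const_mul _)) ?_
          intro ξ _
          have h := norm_sub_le ((σ - t)⁻¹ • (w ξ σ - w ξ t)) (wt ξ t)
          have h' : ‖Q σ ξ‖ ^ 2 ≤ (‖(σ - t)⁻¹ • (w ξ σ - w ξ t)‖ + ‖wt ξ t‖) ^ 2 := by
            gcongr
          refine (h'.trans (add_sq_le)).trans (le_of_eq ?_)
          rw [norm_smul, mul_pow, norm_inv, inv_pow, Real.norm_eq_abs, sq_abs]
          ring
      _ = 2 * ((σ - t) ^ 2)⁻¹ * (∫ ξ in p..q, ‖w ξ σ - w ξ t‖ ^ 2) + 2 * M := by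
          rw [intervalIntegral.integral_add (i1.const_mul _) (i2.const_mul _), intervalIntegral.integral_const_mul,
            intervalIntegral.integral_const_mul]
      _ ≤ 2 * ((σ - t) ^ 2)⁻¹ * (C * (σ - t) ^ 2) + 2 * M := by gcongr
      _ = 2 * C + 2 * M := by field_simp
  have hQ0 : ∀ ξ ∈ Icc p q, Tendsto (fun σ => Q σ ξ) (𝓝[≠] t) (𝓝 0) := by
    intro ξ hξ
    have := (hasDerivAt_iff_tendsto_slope.1 (hd ξ hξ)).sub_const (wt ξ t)
    simpa [slope, hQ] using this
  have hmain : Tendsto (fun σ => ∫ ξ in p..q, ‖Q σ ξ‖) (𝓝[≠] t) (𝓝 0) := by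
    rw [Metric.tendsto_nhds]
    intro ε hε
    obtain ⟨δ, hδ, hδ2⟩ : ∃ δ > 0, δ * (2 * C + 2 * M) ≤ ε / 2 := by
      refine ⟨ε / 2 / (|2 * C + 2 * M| + 1), by positivity, ?_⟩
      rw [div_mul_eq_mul_div, div_le_iff₀ (by positivity)]
      have := le_abs_self (2 * C + 2 * M)
      exact mul_le_mul_of_nonneg_left (by linarith) (by positivity)
    have hmin : Tendsto (fun σ => ∫ ξ in p..q, min ‖Q σ ξ‖ (1 / δ)) (𝓝[≠] t)
        (𝓝 (∫ ξ in p..q, (0 : ℝ))) := by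
      refine intervalIntegral.tendsto_integral_filter_of_dominated_convergence (fun _ => 1 / δ) ?_ ?_ ?_ ?_
      · refine Eventually.of_forall fun σ => ?_
        have hc : ContinuousOn (fun ξ => min ‖Q σ ξ‖ (1 / δ)) (Icc p q) :=
          (hQc σ).norm.inf continuousOn_const
        rw [uIoc_of_le hpq]
        exact (hc.mono Ioc_subset_Icc_self).aestronglyMeasurable measurableSet_Ioc
      · refine Eventually.of_forall fun σ => ae_of_all _ fun ξ _ => ?_
        rw [Real.norm_eq_abs, abs_of_nonneg (by positivity)]
        exact min_le_right _ _
      · exact intervalIntegrable_const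
      · refine ae_of_all _ fun ξ hξ => ?_
        have hξ' : ξ ∈ Icc p q := by
          rw [uIoc_of_le hpq] at hξ; exact Ioc_subset_Icc_self hξ
        have h := ((hQ0 ξ hξ').norm).min (tendsto_const_nhds (x := 1 / δ))
        rw [norm_zero, min_eq_left (by positivity)] at h
        exact h
    rw [intervalIntegral.integral_zero] at hmin
    filter_upwards [hQ2, hmin.eventually (gt_mem_nhds (half_pos hε))] with σ h1 h2
    have h3 : ∫ ξ in p..q, ‖Q σ ξ‖
        ≤ ∫ ξ in p..q, (min ‖Q σ ξ‖ (1 / δ) + δ * ‖Q σ ξ‖ ^ 2) := by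
      refine intervalIntegral.integral_mono_on hpq (hIntg (hQc σ).norm) (hIntg ?_) ?_
      · exact ((hQc σ).norm.inf continuousOn_const).add (((hQc σ).norm.pow 2).const_mul δ)
      · intro ξ _
        rcases le_total ‖Q σ ξ‖ (1 / δ) with h | h
        · rw [min_eq_left h]
          have : 0 ≤ δ * ‖Q σ ξ‖ ^ 2 := by positivity
          linarith
        · rw [min_eq_right h]
          have h5 : 1 ≤ δ * ‖Q σ ξ‖ := by
            rw [div_le_iff₀ hδ] at h; linarith
          have h6 : 0 ≤ 1 / δ := by positivity
          nlinarith [norm_nonneg (Q σ ξ)]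
    have j2 : IntervalIntegrable (fun ξ => ‖Q σ ξ‖ ^ 2) volume p q := hIntg ((hQc σ).norm.pow 2)
    have j1 : IntervalIntegrable (fun ξ => min ‖Q σ ξ‖ (1 / δ)) volume p q :=
      hIntg ((hQc σ).norm.inf continuousOn_const)
    rw [intervalIntegral.integral_add j1 (j2.const_mul δ),
      intervalIntegral.integral_const_mul] at h3
    have h4 : δ * ∫ ξ in p..q, ‖Q σ ξ‖ ^ 2 ≤ ε / 2 := (by gcongr : _ ≤ δ * (2 * C + 2 * M)).trans hδ2
    have h5 : 0 ≤ ∫ ξ in p..q, ‖Q σ ξ‖ := intervalIntegral.integral_nonneg hpq (fun _ _ => norm_nonneg _)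
    rw [Real.dist_eq, sub_zero, abs_of_nonneg h5]
    linarith
  unfold L1D
  rw [isLittleO_iff]
  intro c hc
  have h1 : ∀ᶠ σ in 𝓝[≠] t, ∫ ξ in p..q, ‖Q σ ξ‖ < c := hmain.eventually (gt_mem_nhds hc)
  rw [eventually_nhdsWithin_iff] at h1
  filter_upwards [h1] with σ h
  by_cases hσ : σ = t
  · subst hσ; simp
  have hne : σ - t ≠ 0 := sub_ne_zero.2 hσ
  have h2 : ∀ ξ, ‖w ξ σ - w ξ t - (σ - t) • wt ξ t‖ = |σ - t| * ‖Q σ ξ‖ := by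
    intro ξ
    rw [← Real.norm_eq_abs, ← norm_smul, hQ]
    simp only [smul_sub, smul_smul, mul_inv_cancel₀ hne, one_smul]
  simp_rw [h2]
  rw [intervalIntegral.integral_const_mul, norm_mul, Real.norm_eq_abs, abs_abs, Real.norm_eq_abs,
    Real.norm_eq_abs, mul_comm]
  have h5 : 0 ≤ ∫ ξ in p..q, ‖Q σ ξ‖ := intervalIntegral.integral_nonneg hpq (fun _ _ => norm_nonneg _)
  rw [abs_of_nonneg h5]
  exact mul_le_mul_of_nonneg_right (h hσ).le (abs_nonneg _)

open Set Filter Topology MeasureTheory Asymptotics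

theorem ii_of_contOn {E : Type*} [NormedAddCommGroup E] {p q : ℝ} (hpq : p ≤ q) {f : ℝ → E}
    (hf : ContinuousOn f (Icc p q)) : IntervalIntegrable f volume p q :=
  ContinuousOn.intervalIntegrable (by rwa [uIcc_of_le hpq])

theorem L1D.pair {E F : Type*} [NormedAddCommGroup E] [NormedSpace ℝ E]
    [NormedAddCommGroup F] [NormedSpace ℝ F] {p q t M : ℝ}
    {w wt : ℝ → ℝ → E} (h : L1D p q w wt t) (hpq : p ≤ q)
    (hw : ∀ σ, ContinuousOn (fun ξ => w ξ σ) (Icc p q))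
    (hwt : ContinuousOn (fun ξ => wt ξ t) (Icc p q))
    (L : ℝ → (E →L[ℝ] F)) (hM : ∀ ξ ∈ Icc p q, ‖L ξ‖ ≤ M)
    (h1 : ∀ σ, ContinuousOn (fun ξ => L ξ (w ξ σ)) (Icc p q))
    (h2 : ContinuousOn (fun ξ => L ξ (wt ξ t)) (Icc p q)) :
    HasDerivAt (fun σ => ∫ ξ in p..q, L ξ (w ξ σ)) (∫ ξ in p..q, L ξ (wt ξ t)) t := by
  rw [hasDerivAt_iff_isLittleO]
  refine IsBigO.trans_isLittleO ?_ h
  refine IsBigO.of_bound M (Eventually.of_forall fun σ => ?_)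
  have e1 : (∫ ξ in p..q, L ξ (w ξ σ)) - (∫ ξ in p..q, L ξ (w ξ t))
      - (σ - t) • ∫ ξ in p..q, L ξ (wt ξ t)
      = ∫ ξ in p..q, L ξ (w ξ σ - w ξ t - (σ - t) • wt ξ t) := by
    simp only [map_sub, map_smul]
    rw [intervalIntegral.integral_sub, intervalIntegral.integral_sub,
      intervalIntegral.integral_smul]
    · exact ii_of_contOn hpq (h1 σ)
    · exact ii_of_contOn hpq (h1 t)
    · exact (ii_of_contOn hpq (h1 σ)).sub (ii_of_contOn hpq (h1 t))
    · exact (ii_of_contOn hpq h2).smul (σ - t)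
  rw [e1]
  have hc : ContinuousOn (fun ξ => ‖w ξ σ - w ξ t - (σ - t) • wt ξ t‖) (Icc p q) :=
    (((hw σ).sub (hw t)).sub (hwt.const_smul _)).norm
  have h0 : 0 ≤ ∫ ξ in p..q, ‖w ξ σ - w ξ t - (σ - t) • wt ξ t‖ :=
    intervalIntegral.integral_nonneg hpq (fun _ _ => norm_nonneg _)
  rw [Real.norm_of_nonneg h0, ← intervalIntegral.integral_const_mul]
  refine intervalIntegral.norm_integral_le_of_norm_le hpq (ae_of_all _ fun ξ hξ => ?_)
    ((ii_of_contOn hpq hc).const_mul _)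
  exact (L ξ).le_of_opNorm_le (hM ξ (Ioc_subset_Icc_self hξ)) _

section Inner
variable {E : Type*} [NormedAddCommGroup E] [InnerProductSpace ℂ E]

/-- real inner product as a real-linear functional -/
noncomputable def rinL (x : E) : E →L[ℝ] ℝ :=
  Complex.reCLM.comp ((innerSL ℂ x).restrictScalars ℝ)

theorem rinL_apply (x y : E) : rinL x y = (inner ℂ x y : ℂ).re := by
  simp [rinL]

theorem rinL_le (x : E) : ‖rinL x‖ ≤ ‖x‖ := by
  refine ContinuousLinearMap.opNorm_le_bound _ (norm_nonneg _) fun y => ?_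
  rw [rinL_apply]
  exact (Complex.abs_re_le_norm _).trans (norm_inner_le_norm x y)

theorem abs_rin_le (x y : E) : |(inner ℂ x y : ℂ).re| ≤ ‖x‖ * ‖y‖ :=
  (Complex.abs_re_le_norm _).trans (norm_inner_le_norm x y)

theorem rin_smul_self (ι : ℂ) (x : E) : (inner ℂ x (ι • x) : ℂ).re = ι.re * ‖x‖ ^ 2 := by
  rw [inner_smul_right, inner_self_eq_norm_sq_to_K]
  have : ((RCLike.ofReal ‖x‖ : ℂ) ^ 2) = ((‖x‖ ^ 2 : ℝ) : ℂ) := by push_cast; rfl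
  rw [this, Complex.re_mul_ofReal]

theorem rin_convex (x y : E) : 2 * (inner ℂ x y : ℂ).re - 2 * (inner ℂ x x : ℂ).re
    ≤ ‖y‖ ^ 2 - ‖x‖ ^ 2 := by
  have h := norm_sub_sq (𝕜 := ℂ) y x
  have h2 : (inner ℂ x x : ℂ).re = ‖x‖ ^ 2 := by
    have := rin_smul_self 1 x
    simpa using this
  have h3 : (inner ℂ y x : ℂ).re = (inner ℂ x y : ℂ).re := by
    rw [← inner_conj_symm]; exact Complex.conj_re _
  have h4 : RCLike.re (inner ℂ y x : ℂ) = (inner ℂ y x : ℂ).re := rfl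
  rw [h4] at h
  have := sq_nonneg ‖y - x‖
  rw [h2]
  linarith

theorem contOn_rin {s : Set ℝ} {f g : ℝ → E} (hf : ContinuousOn f s) (hg : ContinuousOn g s) :
    ContinuousOn (fun ξ => (inner ℂ (f ξ) (g ξ) : ℂ).re) s :=
  Complex.continuous_re.comp_continuousOn (hf.inner hg)

theorem rin_parts {p q : ℝ} (hpq : p ≤ q) {ι : ℂ} (hι : ι.re = 0) {y yx yxx : ℝ → E}
    (hy : ∀ ξ, HasDerivAt y (yx ξ) ξ) (hyx : ∀ ξ, HasDerivAt yx (yxx ξ) ξ)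
    (hc : ContinuousOn yxx (Icc p q)) :
    ∫ ξ in p..q, (inner ℂ (y ξ) (ι • yxx ξ) : ℂ).re
      = (inner ℂ (y q) (ι • yx q) : ℂ).re - (inner ℂ (y p) (ι • yx p) : ℂ).re := by
  refine intervalIntegral.integral_eq_sub_of_hasDerivAt
    (f := fun ξ => (inner ℂ (y ξ) (ι • yx ξ) : ℂ).re) ?_ ?_
  · intro ξ _
    have h := (hy ξ).inner ℂ ((hyx ξ).const_smul ι)
    have h2 := Complex.reCLM.hasFDerivAt.comp_hasDerivAt ξ h
    refine HasDerivAt.congr_deriv h2 ?_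
    have h3 := rin_smul_self ι (yx ξ)
    rw [hι, zero_mul] at h3
    change ((inner ℂ (y ξ) (ι • yxx ξ) : ℂ) + inner ℂ (yx ξ) (ι • yx ξ)).re = _
    rw [Complex.add_re, h3, add_zero]
  · refine ii_of_contOn hpq (contOn_rin ?_ (hc.const_smul ι))
    exact fun ξ _ => (hy ξ).continuousAt.continuousWithinAt

theorem energy_ineq {p q a b C δ : ℝ} (hpq : p ≤ q) (hab : a ≤ b) (hδ : 0 < δ)
    {ι : ℂ} (hι : ι.re = 0) {y yx yxx yt F : ℝ → ℝ → E}
    (hy : ∀ ξ t, HasDerivAt (fun ξ => y ξ t) (yx ξ t) ξ)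
    (hyx : ∀ ξ t, HasDerivAt (fun ξ => yx ξ t) (yxx ξ t) ξ)
    (hc : ∀ t, Continuous (fun ξ => yxx ξ t))
    (hct : ∀ t, Continuous (fun ξ => yt ξ t))
    (heq : ∀ ξ t, yt ξ t = ι • yxx ξ t + F ξ t)
    (hL : ∀ t ∈ Ioo a b, L1D p q y yt t)
    (hQ : ContinuousOn (fun t => ∫ ξ in p..q, ‖y ξ t‖ ^ 2) (Icc a b))
    (hbd : ∀ t ∈ Ioo a b, 2 * (‖ι‖ * ‖y q t‖ * ‖yx q t‖ + ‖ι‖ * ‖y p t‖ * ‖yx p t‖)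
      + 2 * |∫ ξ in p..q, (inner ℂ (y ξ t) (F ξ t) : ℂ).re|
        ≤ C * (δ + ∫ ξ in p..q, ‖y ξ t‖ ^ 2)) :
    (δ + ∫ ξ in p..q, ‖y ξ b‖ ^ 2) ≤ Real.exp (C * (b - a)) * (δ + ∫ ξ in p..q, ‖y ξ a‖ ^ 2) ∧
    (δ + ∫ ξ in p..q, ‖y ξ a‖ ^ 2)
      ≤ Real.exp (C * (b - a)) * (δ + ∫ ξ in p..q, ‖y ξ b‖ ^ 2) := by
  have yc : ∀ t, Continuous (fun ξ => y ξ t) := fun t =>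
    continuous_iff_continuousAt.2 fun ξ => (hy ξ t).continuousAt
  refine touch_gronwall (f := fun t => ∫ ξ in p..q, ‖y ξ t‖ ^ 2) hab hδ hQ
    (fun t => intervalIntegral.integral_nonneg hpq (fun _ _ => by positivity)) ?_
  intro x hx
  obtain ⟨M, hM⟩ := isCompact_Icc.exists_bound_of_continuousOn (yc x).continuousOn (s := Icc p q)
  have hD := (hL x hx).pair hpq (fun σ => (yc σ).continuousOn) (hct x).continuousOn
    (fun ξ => rinL (y ξ x)) (M := M) (fun ξ hξ => (rinL_le _).trans (hM ξ hξ))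
    (fun σ => by
      simp only [rinL_apply]; exact contOn_rin (yc x).continuousOn (yc σ).continuousOn)
    (by simp only [rinL_apply]; exact contOn_rin (yc x).continuousOn (hct x).continuousOn)
  simp only [rinL_apply] at hD
  refine ⟨_, _, hD.const_mul 2, Eventually.of_forall fun z => ?_, ?_⟩
  · have i1 : ∀ z, IntervalIntegrable (fun ξ => (inner ℂ (y ξ x) (y ξ z) : ℂ).re) volume p q :=
      fun z => ii_of_contOn hpq (contOn_rin (yc x).continuousOn (yc z).continuousOn)
    have i2 : ∀ z, IntervalIntegrable (fun ξ => ‖y ξ z‖ ^ 2) volume p q := fun z =>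
      ((yc z).norm.pow 2).intervalIntegrable _ _
    rw [← intervalIntegral.integral_const_mul, ← intervalIntegral.integral_const_mul,
      ← intervalIntegral.integral_sub ((i1 z).const_mul _) ((i1 x).const_mul _),
      ← intervalIntegral.integral_sub (i2 z) (i2 x)]
    exact intervalIntegral.integral_mono_on hpq (((i1 z).const_mul _).sub ((i1 x).const_mul _))
      ((i2 z).sub (i2 x)) (fun ξ _ => rin_convex _ _)
  · refine le_trans ?_ (hbd x hx)
    have hF : Continuous (fun ξ => F ξ x) := by
      have : (fun ξ => F ξ x) = fun ξ => yt ξ x - ι • yxx ξ x := by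
        funext ξ; rw [heq]; simp
      rw [this]
      exact (hct x).sub ((hc x).const_smul ι)
    have e : ∫ ξ in p..q, (inner ℂ (y ξ x) (yt ξ x) : ℂ).re
        = ((inner ℂ (y q x) (ι • yx q x) : ℂ).re - (inner ℂ (y p x) (ι • yx p x) : ℂ).re)
          + ∫ ξ in p..q, (inner ℂ (y ξ x) (F ξ x) : ℂ).re := by
      rw [← rin_parts hpq hι (fun ξ => hy ξ x) (fun ξ => hyx ξ x) (hc x).continuousOn,
        ← intervalIntegral.integral_add]
      · congr 1; funext ξ; rw [heq, inner_add_right, Complex.add_re]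
      · exact ii_of_contOn hpq
          (contOn_rin (yc x).continuousOn ((hc x).const_smul ι).continuousOn)
      · exact ii_of_contOn hpq (contOn_rin (yc x).continuousOn hF.continuousOn)
    rw [e, abs_mul, abs_two]
    have h1 := abs_rin_le (y q x) (ι • yx q x)
    have h2 := abs_rin_le (y p x) (ι • yx p x)
    rw [norm_smul] at h1 h2
    have h3 := abs_add_le ((inner ℂ (y q x) (ι • yx q x) : ℂ).re
      - (inner ℂ (y p x) (ι • yx p x) : ℂ).re) (∫ ξ in p..q, (inner ℂ (y ξ x) (F ξ x) : ℂ).re)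
    have h4 := abs_sub ((inner ℂ (y q x) (ι • yx q x) : ℂ).re)
      ((inner ℂ (y p x) (ι • yx p x) : ℂ).re)
    nlinarith
end Inner

open Set Filter Topology MeasureTheory Asymptotics

/-- differentiation under the integral sign for jointly continuous derivative -/
theorem deriv_under {E : Type*} [NormedAddCommGroup E] [NormedSpace ℝ E] {p q t : ℝ}
    {f f' : ℝ → ℝ → E} (hf : ∀ σ, Continuous (fun ξ => f ξ σ))
    (hf' : Continuous (fun z : ℝ × ℝ => f' z.1 z.2))
    (hd : ∀ ξ σ, HasDerivAt (fun σ => f ξ σ) (f' ξ σ) σ) :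
    HasDerivAt (fun σ => ∫ ξ in p..q, f ξ σ) (∫ ξ in p..q, f' ξ t) t := by
  obtain ⟨C, hC⟩ := (isCompact_uIcc (a := p) (b := q)).prod (isCompact_Icc (a := t - 1) (b := t + 1))
    |>.exists_bound_of_continuousOn hf'.continuousOn
  refine (intervalIntegral.hasDerivAt_integral_of_dominated_loc_of_deriv_le
    (F := fun σ ξ => f ξ σ) (F' := fun σ ξ => f' ξ σ) (bound := fun _ => C)
    (s := Icc (t-1) (t+1)) (Icc_mem_nhds (by linarith) (by linarith))
    (Eventually.of_forall fun σ => (hf σ).aestronglyMeasurable)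
    ((hf t).intervalIntegrable _ _) ?_ ?_ (by simp) ?_).2
  · exact (hf'.comp (by fun_prop : Continuous fun ξ : ℝ => (ξ, t))).aestronglyMeasurable
  · exact ae_of_all _ fun ξ hξ σ hσ => hC (ξ, σ) ⟨uIoc_subset_uIcc hξ, hσ⟩
  · exact ae_of_all _ fun ξ _ σ _ => hd ξ σ

/-- product rule -/
theorem L1D.prodRule {E : Type*} [NormedAddCommGroup E] [NormedSpace ℂ E] {p q t : ℝ}
    {w wt : ℝ → ℝ → E} (h : L1D p q w wt t) (hpq : p ≤ q)
    (hw : ∀ σ, Continuous (fun ξ => w ξ σ)) (hwt : Continuous (fun ξ => wt ξ t))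
    {k k' : ℝ → ℝ → ℂ} (hk : Continuous (fun z : ℝ × ℝ => k z.1 z.2))
    (hk' : Continuous (fun z : ℝ × ℝ => k' z.1 z.2))
    (hd : ∀ ξ σ, HasDerivAt (fun σ => k ξ σ) (k' ξ σ) σ) :
    HasDerivAt (fun σ => ∫ ξ in p..q, k ξ σ • w ξ σ)
      (∫ ξ in p..q, (k' ξ t • w ξ t + k ξ t • wt ξ t)) t := by
  have hks : ∀ σ, Continuous fun ξ => k ξ σ := fun σ =>
    hk.comp (by fun_prop : Continuous fun ξ : ℝ => (ξ, σ))
  obtain ⟨M, hM⟩ := (isCompact_Icc (a := p) (b := q)).prod (isCompact_Icc (a := t - 1) (b := t + 1))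
    |>.exists_bound_of_continuousOn hk.continuousOn
  have hA := deriv_under (p := p) (q := q) (t := t)
    (f := fun ξ σ => k ξ σ • (w ξ t + ((σ - t : ℝ) : ℂ) • wt ξ t))
    (f' := fun ξ σ => k ξ σ • wt ξ t + k' ξ σ • (w ξ t + ((σ - t : ℝ) : ℂ) • wt ξ t))
    (fun σ => (hks σ).smul ((hw t).add (hwt.const_smul _)))
    (by
      have a1 : Continuous fun z : ℝ × ℝ => w z.1 t := (hw t).comp continuous_fst
      have a2 : Continuous fun z : ℝ × ℝ => wt z.1 t := hwt.comp continuous_fst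
      fun_prop)
    (fun ξ σ => by
      have h1 : HasDerivAt (fun σ : ℝ => w ξ t + ((σ - t : ℝ) : ℂ) • wt ξ t) (wt ξ t) σ := by
        have := (((hasDerivAt_id σ).sub_const t).ofReal_comp.smul_const (wt ξ t)).const_add (w ξ t)
        simpa using this
      exact (hd ξ σ).smul h1)
  have hR : HasDerivAt (fun σ => ∫ ξ in p..q, k ξ σ • (w ξ σ - w ξ t - (σ - t) • wt ξ t)) 0 t := by
    rw [hasDerivAt_iff_isLittleO]
    simp only [sub_self, zero_smul, smul_zero, intervalIntegral.integral_zero, sub_zero]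
    refine IsBigO.trans_isLittleO ?_ h
    refine IsBigO.of_bound M ?_
    filter_upwards [Icc_mem_nhds (show t - 1 < t by linarith) (show t < t + 1 by linarith)] with σ hσ
    have hc : Continuous (fun ξ => ‖w ξ σ - w ξ t - (σ - t) • wt ξ t‖) :=
      (((hw σ).sub (hw t)).sub (hwt.const_smul _)).norm
    have h0 : 0 ≤ ∫ ξ in p..q, ‖w ξ σ - w ξ t - (σ - t) • wt ξ t‖ :=
      intervalIntegral.integral_nonneg hpq (fun _ _ => norm_nonneg _)
    rw [Real.norm_of_nonneg h0, ← intervalIntegral.integral_const_mul]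
    refine intervalIntegral.norm_integral_le_of_norm_le hpq (ae_of_all _ fun ξ hξ => ?_)
      ((hc.intervalIntegrable _ _).const_mul _)
    rw [norm_smul]
    exact mul_le_mul_of_nonneg_right (hM (ξ, σ) ⟨Ioc_subset_Icc_self hξ, hσ⟩) (norm_nonneg _)
  have := hA.add hR
  simp only [sub_self, Complex.ofReal_zero, zero_smul, add_zero] at this
  convert this using 1
  · funext σ
    simp only [Pi.add_apply]
    rw [← intervalIntegral.integral_add]
    · congr 1; funext ξ
      rw [← smul_add]; congr 1
      have : ((σ - t : ℝ) : ℂ) • wt ξ t = (σ - t) • wt ξ t := by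
        rw [Complex.coe_smul]
      rw [this]; abel
    · exact ((hks σ).smul ((hw t).add (hwt.const_smul _))).intervalIntegrable _ _
    · exact ((hks σ).smul (((hw σ).sub (hw t)).sub (hwt.const_smul _))).intervalIntegrable _ _
  · congr 1; funext ξ; rw [add_comm]

/-- (unnormalised) heat/Schrödinger kernel -/
noncomputable def kap (z : ℂ) (x : ℝ) : ℂ := z ^ (-(1/2) : ℂ) * Complex.exp (-(x:ℂ)^2 / (4 * z))

theorem kap_deriv_z {z : ℂ} (hz : z ∈ Complex.slitPlane) (x : ℝ) :
    HasDerivAt (fun z => kap z x) (kap z x * ((x:ℂ)^2/(4*z^2) - 1/(2*z))) z := by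
  have h0 : z ≠ 0 := Complex.slitPlane_ne_zero hz
  have h1 := (hasDerivAt_id z).cpow_const (c := -(1/2 : ℂ)) hz
  have h2 : HasDerivAt (fun z : ℂ => Complex.exp (-(x:ℂ)^2 / (4 * z)))
      (Complex.exp (-(x:ℂ)^2 / (4 * z)) * ((x:ℂ)^2/(4*z^2))) z := by
    apply HasDerivAt.cexp
    have := ((hasDerivAt_id z).const_mul 4).inv (by simpa using h0) |>.const_mul (-(x:ℂ)^2)
    refine (this.congr_of_eventuallyEq (Eventually.of_forall fun y => ?_)).congr_deriv ?_
    · simp [div_eq_mul_inv]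
    · simp; try field_simp
      try ring
  have := h1.mul h2
  refine (this.congr_of_eventuallyEq (Eventually.of_forall fun y => rfl)).congr_deriv ?_
  simp only [kap, id]
  rw [Complex.cpow_sub _ _ h0, Complex.cpow_one]
  field_simp
  ring

theorem kap_deriv_x {z : ℂ} (hz : z ≠ 0) (x : ℝ) :
    HasDerivAt (fun x => kap z x) (kap z x * (-(x:ℂ)/(2*z))) x := by
  have h2 : HasDerivAt (fun x : ℝ => Complex.exp (-(x:ℂ)^2 / (4 * z)))
      (Complex.exp (-(x:ℂ)^2 / (4 * z)) * (-(x:ℂ)/(2*z))) x := by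
    apply HasDerivAt.cexp
    have := (((hasDerivAt_id x).ofReal_comp.pow 2).neg).div_const (4*z)
    refine (this.congr_of_eventuallyEq (Eventually.of_forall fun y => ?_)).congr_deriv ?_
    · simp [div_eq_mul_inv]
    · simp; try field_simp
      try ring
  have := h2.const_mul (z ^ (-(1/2) : ℂ))
  refine (this.congr_of_eventuallyEq (Eventually.of_forall fun y => rfl)).congr_deriv ?_
  simp only [kap]; ring

theorem kap_deriv_xx {z : ℂ} (hz : z ≠ 0) (x : ℝ) :
    HasDerivAt (fun x : ℝ => kap z x * (-(x:ℂ)/(2*z))) (kap z x * ((x:ℂ)^2/(4*z^2) - 1/(2*z))) x := by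
  have h3 : HasDerivAt (fun x : ℝ => (-(x:ℂ)/(2*z))) (-1/(2*z)) x := by
    simpa using ((hasDerivAt_id x).ofReal_comp.neg).div_const (2*z)
  have := (kap_deriv_x hz x).mul h3
  refine (this.congr_of_eventuallyEq (Eventually.of_forall fun y => rfl)).congr_deriv ?_
  field_simp; ring

theorem kap_norm_le {z : ℂ} (hz : z ≠ 0) (hre : 0 ≤ z.re) (x : ℝ) :
    ‖kap z x‖ ≤ ‖z‖ ^ (-(1/2) : ℝ) := by
  have h1 : ‖z ^ (-(1/2) : ℂ)‖ = ‖z‖ ^ (-(1/2) : ℝ) := by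
    have : (-(1/2) : ℂ) = ((-(1/2) : ℝ) : ℂ) := by push_cast; rfl
    rw [this, Complex.norm_cpow_of_ne_zero hz]
    simp
  rw [kap, norm_mul, h1, Complex.norm_exp]
  refine mul_le_of_le_one_right (by positivity) ?_
  rw [Real.exp_le_one_iff]
  have : -(x:ℂ)^2 / (4*z) = ((-(x^2/4) : ℝ) : ℂ) * z⁻¹ := by push_cast; field_simp
  rw [this, Complex.re_ofReal_mul, Complex.inv_re]
  have : 0 ≤ z.re / Complex.normSq z := div_nonneg hre (Complex.normSq_nonneg _)
  nlinarith [sq_nonneg x]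

theorem kap_cont : ContinuousOn (fun z : ℂ × ℝ => kap z.1 z.2) {z | z.1 ∈ Complex.slitPlane} := by
  intro z hz
  have h0 : (4:ℂ) * z.1 ≠ 0 := mul_ne_zero (by norm_num) (Complex.slitPlane_ne_zero hz)
  apply ContinuousAt.continuousWithinAt
  unfold kap
  apply ContinuousAt.mul
  · exact continuousAt_fst.cpow continuousAt_const hz
  · have : ContinuousAt (fun z : ℂ × ℝ => 4 * z.1) z := by fun_prop
    have h3 : ContinuousAt (fun z : ℂ × ℝ => -(z.2:ℂ)^2) z := by fun_prop
    exact (h3.div this h0).cexp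

open Set Filter Topology MeasureTheory Asymptotics

/-- inhomogeneous linear Schrödinger equation, separate regularity -/
structure LinSol {E : Type*} [NormedAddCommGroup E] [NormedSpace ℂ E] (ι : ℂ)
    (y yx yxx yt F : ℝ → ℝ → E) : Prop where
  hι : ι = Complex.I ∨ ι = -Complex.I
  hy : ∀ ξ t, HasDerivAt (fun ξ => y ξ t) (yx ξ t) ξ
  hyx : ∀ ξ t, HasDerivAt (fun ξ => yx ξ t) (yxx ξ t) ξ
  cxx : ∀ t, Continuous fun ξ => yxx ξ t
  ct : ∀ t, Continuous fun ξ => yt ξ t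
  eq : ∀ ξ t, yt ξ t = ι • yxx ξ t + F ξ t

/-- cutoff function -/
structure Cutoff (p q : ℝ) (χ χ1 χ2 : ℝ → ℝ) : Prop where
  d1 : ∀ ξ, HasDerivAt χ (χ1 ξ) ξ
  d2 : ∀ ξ, HasDerivAt χ1 (χ2 ξ) ξ
  c2 : Continuous χ2
  z0 : ∀ ξ, ξ ∉ Ioo p q → χ ξ = 0
  z1 : ∀ ξ, ξ ∉ Ioo p q → χ1 ξ = 0

section
variable {E : Type*} [NormedAddCommGroup E] [NormedSpace ℂ E] {ι : ℂ}
    {y yx yxx yt F : ℝ → ℝ → E} {p q : ℝ} {χ χ1 χ2 : ℝ → ℝ}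

theorem LinSol.cy (S : LinSol ι y yx yxx yt F) (t : ℝ) : Continuous fun ξ => y ξ t :=
  continuous_iff_continuousAt.2 fun ξ => (S.hy ξ t).continuousAt
theorem LinSol.cyx (S : LinSol ι y yx yxx yt F) (t : ℝ) : Continuous fun ξ => yx ξ t :=
  continuous_iff_continuousAt.2 fun ξ => (S.hyx ξ t).continuousAt
theorem LinSol.cF (S : LinSol ι y yx yxx yt F) (t : ℝ) : Continuous fun ξ => F ξ t := by
  have : (fun ξ => F ξ t) = fun ξ => yt ξ t - ι • yxx ξ t := by
    funext ξ; rw [S.eq]; abel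
  rw [this]
  exact (S.ct t).sub ((S.cxx t).const_smul ι)
theorem Cutoff.c0 (X : Cutoff p q χ χ1 χ2) : Continuous χ :=
  continuous_iff_continuousAt.2 fun ξ => (X.d1 ξ).continuousAt
theorem Cutoff.c1 (X : Cutoff p q χ χ1 χ2) : Continuous χ1 :=
  continuous_iff_continuousAt.2 fun ξ => (X.d2 ξ).continuousAt

/-- two integrations by parts against a kernel -/
theorem ibp2 (S : LinSol ι y yx yxx yt F) (X : Cutoff p q χ χ1 χ2) [CompleteSpace E] (t : ℝ)
    {k k1 k2 : ℝ → ℂ} (h1 : ∀ ξ, HasDerivAt k (k1 ξ) ξ) (h2 : ∀ ξ, HasDerivAt k1 (k2 ξ) ξ)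
    (hk2 : Continuous k2) :
    ∫ ξ in p..q, ((χ ξ : ℂ) * k2 ξ) • y ξ t
      - k ξ • ((χ2 ξ : ℂ) • y ξ t + (2 * (χ1 ξ : ℂ)) • yx ξ t + (χ ξ : ℂ) • yxx ξ t) = 0 := by
  have ck : Continuous k := continuous_iff_continuousAt.2 fun ξ => (h1 ξ).continuousAt
  have ck1 : Continuous k1 := continuous_iff_continuousAt.2 fun ξ => (h2 ξ).continuousAt
  have c0 := X.c0
  have c1 := X.c1
  have c2 := X.c2
  have a0 := S.cy t
  have a1 := S.cyx t
  have a2 := S.cxx t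
  have key : ∀ ξ, HasDerivAt (fun ξ => ((χ ξ : ℂ) * k1 ξ) • y ξ t
      - k ξ • ((χ1 ξ : ℂ) • y ξ t + (χ ξ : ℂ) • yx ξ t))
      (((χ ξ : ℂ) * k2 ξ) • y ξ t
      - k ξ • ((χ2 ξ : ℂ) • y ξ t + (2 * (χ1 ξ : ℂ)) • yx ξ t + (χ ξ : ℂ) • yxx ξ t)) ξ := by
    intro ξ
    have d1 := (X.d1 ξ).ofReal_comp
    have d2 := (X.d2 ξ).ofReal_comp
    have := ((d1.mul (h2 ξ)).smul (S.hy ξ t)).sub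
      ((h1 ξ).smul ((d2.smul (S.hy ξ t)).add (d1.smul (S.hyx ξ t))))
    refine this.congr_deriv ?_
    simp only [Pi.mul_apply, Pi.add_apply, Pi.smul_apply']
    module
  rw [intervalIntegral.integral_eq_sub_of_hasDerivAt (fun ξ _ => key ξ)
    (Continuous.intervalIntegrable (by fun_prop) _ _)]
  simp [X.z0 p (by simp), X.z0 q (by simp), X.z1 p (by simp), X.z1 q (by simp)]

end

theorem zs_slit {ι : ℂ} (hι : ι = Complex.I ∨ ι = -Complex.I) {s : ℝ} (hs : 0 < s) (r : ℝ) :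
    (s : ℂ) + ι * (r : ℂ) ∈ Complex.slitPlane ∧ ((s : ℂ) + ι * (r : ℂ)).re = s ∧
    |r| ≤ ‖(s : ℂ) + ι * (r : ℂ)‖ := by
  rcases hι with rfl | rfl
  · refine ⟨Or.inl (by simpa using hs), by simp, ?_⟩
    have := Complex.abs_im_le_norm ((s : ℂ) + Complex.I * (r : ℂ))
    simpa using this
  · refine ⟨Or.inl (by simpa using hs), by simp, ?_⟩
    have := Complex.abs_im_le_norm ((s : ℂ) + -Complex.I * (r : ℂ))
    simpa using this

theorem slice1 {E : Type*} [TopologicalSpace E] {f : ℝ → ℝ → E}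
    (h : Continuous fun z : ℝ × ℝ => f z.1 z.2) (σ : ℝ) : Continuous fun ξ => f ξ σ :=
  h.comp (by fun_prop : Continuous fun ξ : ℝ => (ξ, σ))
theorem slice2 {E : Type*} [TopologicalSpace E] {f : ℝ → ℝ → E}
    (h : Continuous fun z : ℝ × ℝ => f z.1 z.2) (ξ : ℝ) : Continuous fun σ => f ξ σ :=
  h.comp (by fun_prop : Continuous fun σ : ℝ => (ξ, σ))

theorem kap_dx' {z : ℂ} (hz : z ≠ 0) (ξ ξ0 : ℝ) :
    HasDerivAt (fun ξ : ℝ => kap z (ξ - ξ0))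
      (kap z (ξ - ξ0) * (-((ξ - ξ0 : ℝ):ℂ)/(2*z))) ξ := by
  have := HasDerivAt.scomp ξ (kap_deriv_x hz (ξ - ξ0)) ((hasDerivAt_id ξ).sub_const ξ0)
  rw [one_smul] at this
  exact this

theorem kap_dxx' {z : ℂ} (hz : z ≠ 0) (ξ ξ0 : ℝ) :
    HasDerivAt (fun ξ : ℝ => kap z (ξ - ξ0) * (-((ξ - ξ0 : ℝ):ℂ)/(2*z)))
      (kap z (ξ - ξ0) * (((ξ - ξ0 : ℝ):ℂ)^2/(4*z^2) - 1/(2*z))) ξ := by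
  have := HasDerivAt.scomp ξ (kap_deriv_xx hz (ξ - ξ0)) ((hasDerivAt_id ξ).sub_const ξ0)
  rw [one_smul] at this
  exact this

set_option maxHeartbeats 1000000 in
theorem KLs {E : Type*} [NormedAddCommGroup E] [NormedSpace ℂ E] [CompleteSpace E] {ι : ℂ}
    {y yx yxx yt F : ℝ → ℝ → E} {p q : ℝ} {χ χ1 χ2 : ℝ → ℝ}
    (S : LinSol ι y yx yxx yt F) (X : Cutoff p q χ χ1 χ2) (hpq : p ≤ q)
    {a τ s B C ξ0 : ℝ} (haτ : a < τ) (hs : 0 < s)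
    (hL : ∀ t ∈ Ioo a τ, L1D p q y yt t)
    (hB : ∀ ξ ∈ Icc p q, ∀ t ∈ Icc a τ, ‖y ξ t‖ ≤ B)
    (hc : ∀ ξ ∈ Icc p q, ContinuousOn (fun t => y ξ t) (Icc a τ))
    (hC : ∀ t ∈ Ioo a τ, ∫ ξ in p..q, ‖(χ ξ : ℂ) • F ξ t
      - ι • ((χ2 ξ : ℂ) • y ξ t + (2 * (χ1 ξ : ℂ)) • yx ξ t)‖ ≤ C) :
    ‖(∫ ξ in p..q, ((χ ξ : ℂ) * kap s (ξ - ξ0)) • y ξ τ)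
      - ∫ ξ in p..q, ((χ ξ : ℂ) * kap (s + ι * (τ - a : ℝ)) (ξ - ξ0)) • y ξ a‖
      ≤ 2 * C * √(τ - a) := by
  have c0 := X.c0
  have c1 := X.c1
  have c2 := X.c2
  set Z : ℝ → ℂ := fun σ => (s:ℂ) + ι * ((τ - σ : ℝ) : ℂ) with hZ
  have hZs : ∀ σ, Z σ ∈ Complex.slitPlane := fun σ => (zs_slit S.hι hs _).1
  have hZ0 : ∀ σ, Z σ ≠ 0 := fun σ => Complex.slitPlane_ne_zero (hZs σ)
  have cZ : Continuous Z := by fun_prop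
  have dZ : ∀ σ, HasDerivAt Z (-ι) σ := fun σ => by
    have := ((((hasDerivAt_id σ).const_sub τ).ofReal_comp).const_mul ι).const_add (s:ℂ)
    exact this.congr_deriv (by simp)
  have ck : Continuous fun z : ℝ × ℝ => kap (Z z.2) (z.1 - ξ0) := by
    have := kap_cont.comp_continuous (f := fun z : ℝ × ℝ => (Z z.2, z.1 - ξ0)) (by fun_prop)
      (fun z => hZs z.2)
    exact this
  set k2 : ℝ → ℝ → ℂ := fun ξ σ => kap (Z σ) (ξ - ξ0) *
    (((ξ - ξ0 : ℝ) : ℂ)^2/(4*(Z σ)^2) - 1/(2*(Z σ))) with hk2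
  have ck2 : Continuous fun z : ℝ × ℝ => k2 z.1 z.2 := by
    refine ck.mul (Continuous.sub ?_ ?_)
    · exact Continuous.div (by fun_prop) (by fun_prop) (fun z => by simp [hZ0])
    · exact Continuous.div (by fun_prop) (by fun_prop) (fun z => by simp [hZ0])
  set m : ℝ → E := fun σ => ∫ ξ in p..q, ((χ ξ : ℂ) * kap (Z σ) (ξ - ξ0)) • y ξ σ with hm
  have hmτ : m τ = ∫ ξ in p..q, ((χ ξ : ℂ) * kap s (ξ - ξ0)) • y ξ τ := by
    simp [hm, hZ]
  have hma : m a = ∫ ξ in p..q, ((χ ξ : ℂ) * kap (s + ι * (τ - a : ℝ)) (ξ - ξ0)) • y ξ a := rfl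
  rw [← hmτ, ← hma]
  -- derivative
  have hmd : ∀ σ ∈ Ioo a τ, HasDerivAt m (∫ ξ in p..q, kap (Z σ) (ξ - ξ0) • ((χ ξ : ℂ) • F ξ σ
      - ι • ((χ2 ξ : ℂ) • y ξ σ + (2 * (χ1 ξ : ℂ)) • yx ξ σ))) σ := by
    intro σ hσ
    have h1 := (hL σ hσ).prodRule hpq S.cy (S.ct σ)
      (k := fun ξ σ => (χ ξ : ℂ) * kap (Z σ) (ξ - ξ0))
      (k' := fun ξ σ => (χ ξ : ℂ) * (-ι * k2 ξ σ)) (by fun_prop) (by fun_prop)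
      (fun ξ σ => by
        have := (kap_deriv_z (hZs σ) (ξ - ξ0)).scomp σ (dZ σ)
        exact (this.const_mul (χ ξ : ℂ)))
    refine h1.congr_deriv ?_
    have ckσ : Continuous fun ξ => kap (Z σ) (ξ - ξ0) :=
      slice1 (f := fun ξ σ => kap (Z σ) (ξ - ξ0)) ck σ
    have ck2σ : Continuous fun ξ => k2 ξ σ :=
      slice1 (f := k2) ck2 σ
    have e := ibp2 S X σ (k := fun ξ => kap (Z σ) (ξ - ξ0))
      (k1 := fun ξ => kap (Z σ) (ξ - ξ0) * (-((ξ - ξ0 : ℝ):ℂ)/(2*Z σ))) (k2 := fun ξ => k2 ξ σ)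
      (fun ξ => kap_dx' (hZ0 σ) ξ ξ0)
      (fun ξ => kap_dxx' (hZ0 σ) ξ ξ0)
      ck2σ
    have a0 := S.cy σ
    have a1 := S.cyx σ
    have a2 := S.cxx σ
    have a3 := S.cF σ
    have a4 := S.ct σ
    rw [← sub_eq_zero, ← intervalIntegral.integral_sub
      (Continuous.intervalIntegrable (by fun_prop) _ _)
      (Continuous.intervalIntegrable (by fun_prop) _ _)]
    have e2 := congrArg (fun v => (-ι) • v) e
    simp only [smul_zero, ← intervalIntegral.integral_smul] at e2
    rw [← e2]
    congr 1; funext ξ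
    rw [S.eq]
    module
  have hmc : ContinuousOn m (Icc a τ) := by
    obtain ⟨M, hM⟩ := (isCompact_Icc (a := p) (b := q)).prod (isCompact_Icc (a := a) (b := τ))
      |>.exists_bound_of_continuousOn
        (f := fun z : ℝ × ℝ => (χ z.1 : ℂ) * kap (Z z.2) (z.1 - ξ0)) (by fun_prop)
    intro σ hσ
    have ckσ : ∀ σ, Continuous fun ξ => kap (Z σ) (ξ - ξ0) := fun σ =>
      slice1 (f := fun ξ σ => kap (Z σ) (ξ - ξ0)) ck σ
    refine intervalIntegral.continuousWithinAt_of_dominated_interval (bound := fun _ => M * B)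
      ?_ ?_ (by simp) ?_
    · refine Eventually.of_forall fun σ => Continuous.aestronglyMeasurable ?_
      have := S.cy σ
      have := ckσ σ
      fun_prop
    · filter_upwards [self_mem_nhdsWithin] with σ' hσ'
      refine ae_of_all _ fun ξ hξ => ?_
      rw [uIoc_of_le hpq] at hξ
      have hξ' := Ioc_subset_Icc_self hξ
      rw [norm_smul]
      exact mul_le_mul (hM (ξ, σ') ⟨hξ', hσ'⟩) (hB ξ hξ' σ' hσ') (norm_nonneg _)
        ((norm_nonneg _).trans (hM (ξ, σ') ⟨hξ', hσ'⟩))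
    · refine ae_of_all _ fun ξ hξ => ?_
      rw [uIoc_of_le hpq] at hξ
      have hξ' := Ioc_subset_Icc_self hξ
      refine ContinuousWithinAt.smul ?_ (hc ξ hξ' σ hσ)
      have : Continuous fun σ => (χ ξ : ℂ) * kap (Z σ) (ξ - ξ0) :=
        continuous_const.mul (slice2 (f := fun ξ σ => kap (Z σ) (ξ - ξ0)) ck ξ)
      exact this.continuousWithinAt
  have hC0 : 0 ≤ C := by
    have := hC ((a+τ)/2) ⟨by linarith, by linarith⟩
    exact (intervalIntegral.integral_nonneg hpq (fun _ _ => norm_nonneg _)).trans this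
  have hbd : ∀ σ ∈ Ioo a τ, ‖∫ ξ in p..q, kap (Z σ) (ξ - ξ0) • ((χ ξ : ℂ) • F ξ σ
      - ι • ((χ2 ξ : ℂ) • y ξ σ + (2 * (χ1 ξ : ℂ)) • yx ξ σ))‖ ≤ C / √(τ - σ) := by
    intro σ hσ
    have hpos : 0 < τ - σ := by linarith [hσ.2]
    have hk : ∀ x, ‖kap (Z σ) x‖ ≤ 1 / √(τ - σ) := by
      intro x
      obtain ⟨_, h2, h3⟩ := zs_slit S.hι hs (τ - σ)
      refine (kap_norm_le (hZ0 σ) (by rw [show (Z σ).re = s from h2]; exact hs.le) x).trans ?_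
      rw [Real.rpow_neg (norm_nonneg _), ← Real.sqrt_eq_rpow, one_div]
      gcongr
      rw [abs_of_pos hpos] at h3
      exact h3
    have a0 := S.cy σ
    have a1 := S.cyx σ
    have a3 := S.cF σ
    have h1 : ‖∫ ξ in p..q, kap (Z σ) (ξ - ξ0) • ((χ ξ : ℂ) • F ξ σ
      - ι • ((χ2 ξ : ℂ) • y ξ σ + (2 * (χ1 ξ : ℂ)) • yx ξ σ))‖ ≤
      ∫ ξ in p..q, (1 / √(τ - σ)) * ‖((χ ξ : ℂ) • F ξ σ
      - ι • ((χ2 ξ : ℂ) • y ξ σ + (2 * (χ1 ξ : ℂ)) • yx ξ σ))‖ := by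
      refine intervalIntegral.norm_integral_le_of_norm_le hpq (ae_of_all _ fun ξ _ => ?_)
        (Continuous.intervalIntegrable (by fun_prop) _ _)
      rw [norm_smul]
      exact mul_le_mul_of_nonneg_right (hk _) (norm_nonneg _)
    rw [intervalIntegral.integral_const_mul] at h1
    refine h1.trans ?_
    rw [show C / √(τ - σ) = (1 / √(τ - σ)) * C by ring]
    exact mul_le_mul_of_nonneg_left (hC σ hσ) (by positivity)
  have step : ∀ a' ∈ Ioo a τ, ‖m τ - m a'‖ ≤ 2 * C * √(τ - a) := by
    intro a' ha'
    have h := image_norm_le_of_norm_deriv_right_le_deriv_boundary' (a := a') (b := τ)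
      (f := fun σ => m σ - m a')
      (B := fun σ => 2 * C * (√(τ - a') - √(τ - σ))) (B' := fun σ => C / √(τ - σ))
      ((hmc.mono (Icc_subset_Icc_left ha'.1.le)).sub continuousOn_const)
      (fun σ hσ => ((hmd σ ⟨by linarith [ha'.1, hσ.1], hσ.2⟩).sub_const _).hasDerivWithinAt)
      (by simp) (Continuous.continuousOn (by fun_prop))
      (fun σ hσ => by
        have hpos : 0 < τ - σ := by linarith [hσ.2]
        have := ((((hasDerivAt_id σ).const_sub τ).sqrt hpos.ne').const_sub (√(τ-a'))).const_mul (2*C)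
        refine (this.congr_deriv ?_).hasDerivWithinAt
        simp only [id]; field_simp)
      (fun σ hσ => hbd σ ⟨by linarith [ha'.1, hσ.1], hσ.2⟩)
      (right_mem_Icc.2 ha'.2.le)
    refine h.trans ?_
    simp only [sub_self, Real.sqrt_zero, sub_zero]
    have : √(τ - a') ≤ √(τ - a) := Real.sqrt_le_sqrt (by linarith [ha'.1])
    gcongr
  have hlim : Tendsto (fun a' => ‖m τ - m a'‖) (𝓝[Ioo a τ] a) (𝓝 ‖m τ - m a‖) := by
    have : Tendsto m (𝓝[Ioo a τ] a) (𝓝 (m a)) :=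
      (hmc a (left_mem_Icc.2 haτ.le)).mono Ioo_subset_Icc_self
    exact (tendsto_const_nhds.sub this).norm
  have : (𝓝[Ioo a τ] a).NeBot := by
    rw [nhdsWithin_Ioo_eq_nhdsGT haτ]; infer_instance
  refine le_of_tendsto hlim ?_
  filter_upwards [self_mem_nhdsWithin] with a' ha' using step a' ha'

open Set Filter Topology MeasureTheory Asymptotics

theorem gauss_lim {E : Type*} [NormedAddCommGroup E] [NormedSpace ℂ E] [CompleteSpace E]
    {p q : ℝ} (hpq : p ≤ q) {f : ℝ → E} (hf : Continuous f) (h0 : ∀ ξ, ξ ∉ Ioo p q → f ξ = 0)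
    (ξ0 : ℝ) :
    Tendsto (fun s : ℝ => ∫ ξ in p..q, kap s (ξ - ξ0) • f ξ) (𝓝[>] 0)
      (𝓝 (((√(4 * Real.pi) : ℝ) : ℂ) • f ξ0)) := by
  have hcs : HasCompactSupport f := HasCompactSupport.intro (isCompact_Icc (a := p) (b := q))
    (fun ξ hξ => h0 ξ (fun h => hξ (Ioo_subset_Icc_self h)))
  have h1 := Real.tendsto_integral_gaussian_smul' (hf.integrable_of_hasCompactSupport hcs)
    (hf.continuousAt (x := ξ0))
  have h2 : Tendsto (fun s : ℝ => (4 * Real.pi^2)⁻¹ * s⁻¹) (𝓝[>] 0) atTop :=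
    tendsto_inv_nhdsGT_zero.const_mul_atTop (by positivity)
  have h3 := (h1.comp h2).const_smul (((√(4 * Real.pi) : ℝ) : ℂ))
  refine h3.congr' ?_
  filter_upwards [self_mem_nhdsWithin] with s hs
  have hs : 0 < s := hs
  simp only [Function.comp_apply]
  rw [← integral_smul]
  rw [intervalIntegral.integral_of_le hpq, ← integral_Icc_eq_integral_Ioc,
    ← setIntegral_eq_integral_of_forall_compl_eq_zero (s := Icc p q)]
  · refine setIntegral_congr_fun measurableSet_Icc fun ξ _ => ?_
    rw [← smul_assoc]
    congr 1
    rw [kap, smul_eq_mul, ← mul_assoc]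
    have hpi := Real.pi_pos
    congr 1
    · have e1 : ((Module.finrank ℝ ℝ : ℂ) / 2) = ((1/2 : ℝ) : ℂ) := by simp
      have e2 : ((Real.pi : ℂ) * (((4 * Real.pi^2)⁻¹ * s⁻¹ : ℝ) : ℂ))
        = ((Real.pi * ((4 * Real.pi^2)⁻¹ * s⁻¹) : ℝ) : ℂ) := by push_cast; rfl
      have e3 : (-(1/2) : ℂ) = ((-(1/2) : ℝ) : ℂ) := by push_cast; rfl
      rw [e1, e2, e3, ← Complex.ofReal_cpow (by positivity), ← Complex.ofReal_cpow hs.le,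
        ← Complex.ofReal_mul]
      congr 1
      rw [← Real.sqrt_eq_rpow, Real.rpow_neg hs.le, ← Real.sqrt_eq_rpow, ← Real.sqrt_inv,
        ← Real.sqrt_mul (by positivity)]
      congr 1
      field_simp
    · congr 1
      have hn : ((‖ξ0 - ξ‖ : ℝ) : ℂ)^2 = ((ξ - ξ0 : ℝ) : ℂ)^2 := by
        rw [← Complex.ofReal_pow, ← Complex.ofReal_pow]
        congr 1
        rw [Real.norm_eq_abs, sq_abs]; ring
      rw [hn]
      have : (Real.pi : ℂ) ≠ 0 := by exact_mod_cast hpi.ne'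
      have : (s : ℂ) ≠ 0 := by exact_mod_cast hs.ne'
      push_cast
      field_simp
  · intro ξ hξ
    simp [h0 ξ (fun h => hξ (Ioo_subset_Icc_self h))]

theorem iota_slit {ι : ℂ} (hι : ι = Complex.I ∨ ι = -Complex.I) {r : ℝ} (hr : r ≠ 0) :
    ι * (r : ℂ) ∈ Complex.slitPlane := by
  rcases hι with rfl | rfl <;> right <;> simpa using hr

theorem KL {E : Type*} [NormedAddCommGroup E] [NormedSpace ℂ E] [CompleteSpace E] {ι : ℂ}
    {y yx yxx yt F : ℝ → ℝ → E} {p q : ℝ} {χ χ1 χ2 : ℝ → ℝ}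
    (S : LinSol ι y yx yxx yt F) (X : Cutoff p q χ χ1 χ2) (hpq : p ≤ q)
    {a τ B C : ℝ} (haτ : a < τ)
    (hL : ∀ t ∈ Ioo a τ, L1D p q y yt t)
    (hB : ∀ ξ ∈ Icc p q, ∀ t ∈ Icc a τ, ‖y ξ t‖ ≤ B)
    (hc : ∀ ξ ∈ Icc p q, ContinuousOn (fun t => y ξ t) (Icc a τ))
    (hC : ∀ t ∈ Ioo a τ, ∫ ξ in p..q, ‖(χ ξ : ℂ) • F ξ t
      - ι • ((χ2 ξ : ℂ) • y ξ t + (2 * (χ1 ξ : ℂ)) • yx ξ t)‖ ≤ C) (ξ0 : ℝ) :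
    ‖((√(4 * Real.pi) : ℝ) : ℂ) • (χ ξ0 : ℂ) • y ξ0 τ
      - ∫ ξ in p..q, ((χ ξ : ℂ) * kap (ι * (τ - a : ℝ)) (ξ - ξ0)) • y ξ a‖
      ≤ 2 * C * √(τ - a) := by
  have c0 := X.c0
  have hr : 0 < τ - a := by linarith
  have h1 := gauss_lim hpq (f := fun ξ => (χ ξ : ℂ) • y ξ τ)
    (by have := S.cy τ; fun_prop) (fun ξ hξ => by simp [X.z0 ξ hξ]) ξ0
  have h2 : Tendsto (fun s : ℝ => ∫ ξ in p..q,
      ((χ ξ : ℂ) * kap (s + ι * (τ - a : ℝ)) (ξ - ξ0)) • y ξ a) (𝓝[>] 0)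
      (𝓝 (∫ ξ in p..q, ((χ ξ : ℂ) * kap (ι * (τ - a : ℝ)) (ξ - ξ0)) • y ξ a)) := by
    have cya := S.cy a
    refine intervalIntegral.tendsto_integral_filter_of_dominated_convergence
      (fun ξ => ‖(χ ξ : ℂ)‖ * (1/√(τ - a)) * ‖y ξ a‖) ?_ ?_ ?_ ?_
    · filter_upwards [self_mem_nhdsWithin] with s hs
      have : Continuous fun ξ : ℝ => kap (s + ι * (τ - a : ℝ)) (ξ - ξ0) :=
        kap_cont.comp_continuous (f := fun ξ : ℝ => ((s : ℂ) + ι * (τ - a : ℝ), ξ - ξ0)) (by fun_prop)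
          (fun z => (zs_slit S.hι hs _).1)
      exact Continuous.aestronglyMeasurable (by fun_prop)
    · filter_upwards [self_mem_nhdsWithin] with s hs
      refine ae_of_all _ fun ξ _ => ?_
      rw [norm_smul, norm_mul]
      obtain ⟨h1, h2, h3⟩ := zs_slit S.hι hs (τ - a)
      have := kap_norm_le (Complex.slitPlane_ne_zero h1)
        (by rw [h2]; exact (le_of_lt hs)) (ξ - ξ0)
      have h4 : ‖kap (s + ι * (τ - a : ℝ)) (ξ - ξ0)‖ ≤ 1 / √(τ - a) := by
        refine this.trans ?_
        rw [Real.rpow_neg (norm_nonneg _), ← Real.sqrt_eq_rpow, one_div]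
        gcongr
        rwa [abs_of_pos hr] at h3
      gcongr
    · exact Continuous.intervalIntegrable (by fun_prop) _ _
    · refine ae_of_all _ fun ξ _ => ?_
      refine Tendsto.smul_const (Tendsto.const_mul _ ?_) _
      have hz := iota_slit S.hι hr.ne'
      have hk : ContinuousAt (fun z : ℂ => kap z (ξ - ξ0)) (ι * (τ - a : ℝ)) :=
        (kap_deriv_z hz _).continuousAt
      have : Tendsto (fun s : ℝ => (s : ℂ) + ι * (τ - a : ℝ)) (𝓝[>] 0) (𝓝 (ι * (τ - a : ℝ))) := by
        have : Continuous (fun s : ℝ => (s : ℂ) + ι * (τ - a : ℝ)) := by fun_prop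
        have := (this.tendsto 0).mono_left (nhdsWithin_le_nhds (s := Ioi 0))
        simpa using this
      exact hk.tendsto.comp this
  refine le_of_tendsto (h1.sub h2).norm ?_
  filter_upwards [self_mem_nhdsWithin] with s hs
  have := KLs S X hpq haτ hs hL hB hc hC (ξ0 := ξ0)
  have e : (∫ ξ in p..q, kap s (ξ - ξ0) • (χ ξ : ℂ) • y ξ τ)
      = ∫ ξ in p..q, ((χ ξ : ℂ) * kap s (ξ - ξ0)) • y ξ τ := by
    congr 1; funext ξ
    rw [smul_smul, mul_comm]
  rw [e]
  exact this

open Set Filter Topology MeasureTheory Asymptotics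
set_option linter.unusedSectionVars false

/-- separately regular solution of a cubic Schrödinger equation -/
structure Sol {E : Type*} [NormedAddCommGroup E] [InnerProductSpace ℂ E] (ι A : ℂ) (h : ℝ)
    (w wx wxx wt : ℝ → ℝ → E) : Prop where
  hι : ι = Complex.I ∨ ι = -Complex.I
  hx : ∀ ξ t, HasDerivAt (fun ξ => w ξ t) (wx ξ t) ξ
  hxx : ∀ ξ t, HasDerivAt (fun ξ => wx ξ t) (wxx ξ t) ξ
  ht : ∀ ξ t, HasDerivAt (fun t => w ξ t) (wt ξ t) t
  cxx : ∀ t, Continuous fun ξ => wxx ξ t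
  ct : ∀ ξ, Continuous fun t => wt ξ t
  eq : ∀ ξ t, wt ξ t = ι • wxx ξ t + (-(A + Complex.I * (h * ‖w ξ t‖ ^ 2 : ℝ))) • w ξ t

structure Setup {E : Type*} [NormedAddCommGroup E] [InnerProductSpace ℂ E] (ι A : ℂ) (h : ℝ)
    (p p1 q1 q Nc X : ℝ) (χ χ1 χ2 : ℝ → ℝ) (J : Set ℝ)
    (w wx wxx wt : ℝ → ℝ → E) : Prop where
  sol : Sol ι A h w wx wxx wt
  cut : Cutoff p q χ χ1 χ2
  hp : p < p1
  hpq1 : p1 < q1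
  hq : q1 < q
  hNc : 0 ≤ Nc
  hX : 0 ≤ X
  one : ∀ ξ ∈ Icc p1 q1, χ ξ = 1
  b0 : ∀ ξ, |χ ξ| ≤ 1
  b1 : ∀ ξ, |χ1 ξ| ≤ X
  b2 : ∀ ξ, |χ2 ξ| ≤ X
  v1 : ∀ ξ ∈ Icc p1 q1, χ1 ξ = 0
  v2 : ∀ ξ ∈ Icc p1 q1, χ2 ξ = 0
  cw : ∀ t ∈ J, ∀ ξ ∈ Icc p p1 ∪ Icc q1 q, ‖w ξ t‖ ≤ Nc
  cwx : ∀ t ∈ J, ∀ ξ ∈ Icc p p1 ∪ Icc q1 q, ‖wx ξ t‖ ≤ Nc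
  cwt : ∀ t ∈ J, ∀ ξ ∈ Icc p p1 ∪ Icc q1 q, ‖wt ξ t‖ ≤ Nc

structure Seg {E : Type*} [NormedAddCommGroup E] [NormedSpace ℝ E]
    (p q : ℝ) (J : Set ℝ) (w wt : ℝ → ℝ → E) (a b B : ℝ) : Prop where
  hab : a ≤ b
  sub : Icc a b ⊆ J
  L : ∀ t ∈ Ioo a b, L1D p q w wt t
  bd : ∀ ξ ∈ Icc p q, ∀ t ∈ Icc a b, ‖w ξ t‖ ≤ B

section
variable {E : Type*} [NormedAddCommGroup E] [InnerProductSpace ℂ E] {ι A : ℂ} {h : ℝ}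
    {p p1 q1 q Nc X : ℝ} {χ χ1 χ2 : ℝ → ℝ} {J : Set ℝ}
    {w wx wxx wt : ℝ → ℝ → E}

theorem Sol.cw (S : Sol ι A h w wx wxx wt) (t : ℝ) : Continuous fun ξ => w ξ t :=
  continuous_iff_continuousAt.2 fun ξ => (S.hx ξ t).continuousAt
theorem Sol.cwt (S : Sol ι A h w wx wxx wt) (ξ : ℝ) : Continuous fun t => w ξ t :=
  continuous_iff_continuousAt.2 fun t => (S.ht ξ t).continuousAt
theorem Sol.cG (S : Sol ι A h w wx wxx wt) (t : ℝ) :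
    Continuous fun ξ => (-(A + Complex.I * (h * ‖w ξ t‖ ^ 2 : ℝ))) • w ξ t := by
  have := S.cw t
  fun_prop
theorem Sol.cts (S : Sol ι A h w wx wxx wt) (t : ℝ) : Continuous fun ξ => wt ξ t := by
  simp only [S.eq]
  exact ((S.cxx t).const_smul ι).add (S.cG t)

theorem Sol.lin (S : Sol ι A h w wx wxx wt) :
    LinSol ι w wx wxx wt (fun ξ t => (-(A + Complex.I * (h * ‖w ξ t‖ ^ 2 : ℝ))) • w ξ t) :=
  ⟨S.hι, S.hx, S.hxx, S.cxx, S.cts, S.eq⟩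

theorem iota_re {ι : ℂ} (hι : ι = Complex.I ∨ ι = -Complex.I) : ι.re = 0 := by
  rcases hι with rfl | rfl <;> simp
theorem iota_norm {ι : ℂ} (hι : ι = Complex.I ∨ ι = -Complex.I) : ‖ι‖ = 1 := by
  rcases hι with rfl | rfl <;> simp

theorem L1D.subConst {t : ℝ} (hL : L1D p q w wt t) (f : ℝ → E) :
    L1D p q (fun ξ t => w ξ t - f ξ) wt t := by
  unfold L1D at *
  simpa using hL

/-- difference from the initial slice -/
theorem Sol.lin0 (S : Sol ι A h w wx wxx wt) (a : ℝ) :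
    LinSol ι (fun ξ t => w ξ t - w ξ a) (fun ξ t => wx ξ t - wx ξ a)
      (fun ξ t => wxx ξ t - wxx ξ a) wt
      (fun ξ t => (-(A + Complex.I * (h * ‖w ξ t‖ ^ 2 : ℝ))) • w ξ t + ι • wxx ξ a) :=
  ⟨S.hι, fun ξ t => (S.hx ξ t).sub (S.hx ξ a), fun ξ t => (S.hxx ξ t).sub (S.hxx ξ a),
    fun t => (S.cxx t).sub (S.cxx a), S.cts, fun ξ t => by rw [S.eq]; module⟩

theorem normG (z : E) : ‖(-(A + Complex.I * (h * ‖z‖ ^ 2 : ℝ))) • z‖ ≤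
    ‖A‖ * ‖z‖ + |h| * ‖z‖ ^ 3 := by
  rw [norm_smul, norm_neg]
  have : ‖A + Complex.I * (h * ‖z‖ ^ 2 : ℝ)‖ ≤ ‖A‖ + |h| * ‖z‖^2 := by
    refine (norm_add_le _ _).trans ?_
    rw [norm_mul, Complex.norm_I, one_mul, Complex.norm_real, Real.norm_eq_abs, abs_mul,
      abs_of_nonneg (sq_nonneg ‖z‖)]
  calc _ ≤ (‖A‖ + |h| * ‖z‖^2) * ‖z‖ := by gcongr
    _ = _ := by ring

theorem rinG (z : E) : (inner ℂ z ((-(A + Complex.I * (h * ‖z‖ ^ 2 : ℝ))) • z) : ℂ).re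
    = -A.re * ‖z‖ ^ 2 := by
  rw [rin_smul_self]
  congr 1
  simp only [Complex.neg_re, Complex.add_re, Complex.re_mul_ofReal, Complex.I_re, zero_mul,
    add_zero]

/-- continuity of the mass of bounded, time-continuous functions -/
theorem mass_cont {y : ℝ → ℝ → E} {a b B : ℝ} (hpq : p ≤ q)
    (hy : ∀ t, Continuous fun ξ => y ξ t)
    (hc : ∀ ξ, Continuous fun t => y ξ t)
    (bd : ∀ ξ ∈ Icc p q, ∀ t ∈ Icc a b, ‖y ξ t‖ ≤ B) :
    ContinuousOn (fun t => ∫ ξ in p..q, ‖y ξ t‖ ^ 2) (Icc a b) := by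
  intro t ht
  refine intervalIntegral.continuousWithinAt_of_dominated_interval (bound := fun _ => B ^ 2)
    (Eventually.of_forall fun σ => Continuous.aestronglyMeasurable (by have := hy σ; fun_prop))
    ?_ (by simp) ?_
  · filter_upwards [self_mem_nhdsWithin] with s hs
    refine ae_of_all _ fun ξ hξ => ?_
    rw [uIoc_of_le hpq] at hξ
    rw [norm_pow, norm_norm]
    have := bd ξ (Ioc_subset_Icc_self hξ) s hs
    gcongr
  · exact ae_of_all _ fun ξ _ => ((hc ξ).norm.pow 2).continuousWithinAt

theorem Setup.pq (U : Setup ι A h p p1 q1 q Nc X χ χ1 χ2 J w wx wxx wt) : p ≤ q := by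
  linarith [U.hp, U.hpq1, U.hq]

theorem Setup.mem_p (U : Setup ι A h p p1 q1 q Nc X χ χ1 χ2 J w wx wxx wt) :
    p ∈ Icc p p1 ∪ Icc q1 q := Or.inl (left_mem_Icc.2 U.hp.le)
theorem Setup.mem_q (U : Setup ι A h p p1 q1 q Nc X χ χ1 χ2 J w wx wxx wt) :
    q ∈ Icc p p1 ∪ Icc q1 q := Or.inr (right_mem_Icc.2 U.hq.le)

theorem Setup.mass (U : Setup ι A h p p1 q1 q Nc X χ χ1 χ2 J w wx wxx wt) {a b B : ℝ}
    (G : Seg p q J w wt a b B) :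
    (1 + ∫ ξ in p..q, ‖w ξ b‖ ^ 2)
      ≤ Real.exp ((4 * Nc^2 + 2 * ‖A‖) * (b - a)) * (1 + ∫ ξ in p..q, ‖w ξ a‖ ^ 2) ∧
    (1 + ∫ ξ in p..q, ‖w ξ a‖ ^ 2)
      ≤ Real.exp ((4 * Nc^2 + 2 * ‖A‖) * (b - a)) * (1 + ∫ ξ in p..q, ‖w ξ b‖ ^ 2) := by
  have S := U.sol
  have hpq := U.pq
  refine energy_ineq hpq G.hab one_pos (iota_re S.hι) S.hx S.hxx S.cxx S.cts S.eq G.L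
    (mass_cont hpq S.cw S.cwt G.bd) ?_
  intro t ht
  have htJ := G.sub (Ioo_subset_Icc_self ht)
  have h1 := U.cw t htJ p U.mem_p
  have h2 := U.cw t htJ q U.mem_q
  have h3 := U.cwx t htJ p U.mem_p
  have h4 := U.cwx t htJ q U.mem_q
  have hQ : 0 ≤ ∫ ξ in p..q, ‖w ξ t‖ ^ 2 :=
    intervalIntegral.integral_nonneg hpq (fun _ _ => by positivity)
  simp only [rinG]
  rw [intervalIntegral.integral_const_mul, iota_norm S.hι, one_mul, one_mul, abs_mul,
    abs_of_nonneg hQ, abs_neg]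
  have h5 : |A.re| ≤ ‖A‖ := Complex.abs_re_le_norm A
  have h6 : ‖w q t‖ * ‖wx q t‖ ≤ Nc ^ 2 := by
    rw [sq]; exact mul_le_mul h2 h4 (norm_nonneg _) U.hNc
  have h7 : ‖w p t‖ * ‖wx p t‖ ≤ Nc ^ 2 := by
    rw [sq]; exact mul_le_mul h1 h3 (norm_nonneg _) U.hNc
  have h8 : |A.re| * (∫ ξ in p..q, ‖w ξ t‖ ^ 2) ≤ ‖A‖ * ∫ ξ in p..q, ‖w ξ t‖ ^ 2 := by gcongr
  nlinarith [norm_nonneg A, sq_nonneg Nc, mul_nonneg (sq_nonneg Nc) hQ]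

noncomputable def LL (p q Nc X N : ℝ) : ℝ := N + Nc + 2 * ((q - p) * (N + 6 * X * Nc))

set_option maxHeartbeats 400000 in
theorem Setup.supStep [CompleteSpace E] (U : Setup ι A h p p1 q1 q Nc X χ χ1 χ2 J w wx wxx wt)
    {a b S A0 N : ℝ}
    (G : Seg p q J w wt a b S) (hN : ∀ ξ ∈ Icc p q, ‖w ξ a‖ ≤ N ∧ ‖wxx ξ a‖ ≤ N)
    (hA0 : ∀ t ∈ Ioo a b, ∫ ξ in p..q, ‖w ξ t‖ ^ 2 ≤ A0)
    (hb1 : b - a ≤ 1) (hT : 2 * √(b - a) * (‖A‖ * (q - p) + |h| * A0) ≤ 1 / 2) :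
    ∀ ξ ∈ Icc p q, ∀ t ∈ Icc a b, ‖w ξ t‖ ≤ LL p q Nc X N + S / 2 := by
  intro ξ hξ t ht
  have hpq := U.pq
  have hpm : p ∈ Icc p q := left_mem_Icc.2 hpq
  have hN0 : 0 ≤ N := (norm_nonneg _).trans (hN p hpm).1
  have hS0 : 0 ≤ S := (norm_nonneg _).trans (G.bd p hpm a (left_mem_Icc.2 G.hab))
  have hNc := U.hNc
  have hX := U.hX
  have hqp : 0 ≤ q - p := by linarith
  have hLL : N + Nc ≤ LL p q Nc X N := by
    unfold LL
    have : 0 ≤ 2 * ((q - p) * (N + 6 * X * Nc)) := by positivity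
    linarith
  by_cases hcol : ξ ∈ Icc p p1 ∪ Icc q1 q
  · have := U.cw t (G.sub ht) ξ hcol
    linarith
  have hξ1 : ξ ∈ Icc p1 q1 := by
    rw [mem_union, not_or, mem_Icc, mem_Icc, not_and, not_and] at hcol
    constructor
    · by_contra hh; exact hcol.1 hξ.1 (by linarith)
    · by_contra hh; exact hcol.2 (by linarith) hξ.2
  rcases eq_or_lt_of_le ht.1 with rfl | hat
  · have := (hN ξ hξ).1
    linarith
  have Sl := U.sol
  set C : ℝ := (q - p) * (N + 6 * X * Nc) + S * (‖A‖ * (q - p) + |h| * A0) with hC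
  have hIoo : Ioo a t ⊆ Ioo a b := Ioo_subset_Ioo_right ht.2
  have hIcc : Icc a t ⊆ Icc a b := Icc_subset_Icc_right ht.2
  have key := KL (Sl.lin0 a) U.cut hpq hat (B := S + S) (C := C)
    (fun s hs => (G.L s (hIoo hs)).subConst _)
    (fun ξ hξ s hs => (norm_sub_le _ _).trans (add_le_add (G.bd ξ hξ s (hIcc hs))
      (G.bd ξ hξ a (left_mem_Icc.2 G.hab))))
    (fun ξ _ => ((Sl.cwt ξ).sub continuous_const).continuousOn)
    (fun s hs => by
      have hsb := hIoo hs
      have hsJ := G.sub (Ioo_subset_Icc_self hsb)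
      have haJ := G.sub (left_mem_Icc.2 G.hab)
      have cws := Sl.cw s
      have cwa := Sl.cw a
      have cws1 := Sl.lin.cyx s
      have cwa1 := Sl.lin.cyx a
      have cwa2 := Sl.cxx a
      have c0 := U.cut.c0
      have c1 := U.cut.c1
      have c2 := U.cut.c2
      have h1 : ∀ ξ ∈ Icc p q, ‖(χ ξ : ℂ) • ((-(A + Complex.I * (h * ‖w ξ s‖ ^ 2 : ℝ))) • w ξ s
          + ι • wxx ξ a) - ι • ((χ2 ξ : ℂ) • (w ξ s - w ξ a) + (2 * (χ1 ξ : ℂ)) • (wx ξ s - wx ξ a))‖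
          ≤ (N + 6 * X * Nc + ‖A‖ * S) + |h| * S * ‖w ξ s‖ ^ 2 := by
        intro ξ hξ
        have g1 : ‖(χ ξ : ℂ) • ((-(A + Complex.I * (h * ‖w ξ s‖ ^ 2 : ℝ))) • w ξ s
          + ι • wxx ξ a)‖ ≤ ‖A‖ * S + |h| * S * ‖w ξ s‖ ^ 2 + N := by
          rw [norm_smul, Complex.norm_real, Real.norm_eq_abs]
          refine (mul_le_of_le_one_left (norm_nonneg _) (U.b0 ξ)).trans ?_
          refine (norm_add_le _ _).trans (add_le_add ?_ ?_)
          · refine (normG _).trans ?_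
            have := G.bd ξ hξ s (Ioo_subset_Icc_self hsb)
            have : ‖w ξ s‖ ^ 3 ≤ S * ‖w ξ s‖ ^ 2 := by
              rw [pow_succ, mul_comm]; gcongr
            calc _ ≤ ‖A‖ * S + |h| * (S * ‖w ξ s‖ ^ 2) := by gcongr
              _ = _ := by ring
          · rw [norm_smul, iota_norm Sl.hι, one_mul]
            exact (hN ξ hξ).2
        have g2 : ‖ι • ((χ2 ξ : ℂ) • (w ξ s - w ξ a) + (2 * (χ1 ξ : ℂ)) • (wx ξ s - wx ξ a))‖
            ≤ 6 * X * Nc := by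
          rw [norm_smul, iota_norm Sl.hι, one_mul]
          by_cases hcol : ξ ∈ Icc p p1 ∪ Icc q1 q
          · have e1 : ‖w ξ s - w ξ a‖ ≤ Nc + Nc := (norm_sub_le _ _).trans
              (add_le_add (U.cw s hsJ ξ hcol) (U.cw a haJ ξ hcol))
            have e2 : ‖wx ξ s - wx ξ a‖ ≤ Nc + Nc := (norm_sub_le _ _).trans
              (add_le_add (U.cwx s hsJ ξ hcol) (U.cwx a haJ ξ hcol))
            refine (norm_add_le _ _).trans ?_
            rw [norm_smul, norm_smul, norm_mul, Complex.norm_real, Complex.norm_real,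
              Real.norm_eq_abs, Real.norm_eq_abs, Complex.norm_ofNat]
            have := U.b1 ξ
            have := U.b2 ξ
            calc _ ≤ X * (Nc + Nc) + 2 * X * (Nc + Nc) := by gcongr
              _ = _ := by ring
          · have hξ1 : ξ ∈ Icc p1 q1 := by
              rw [mem_union, not_or, mem_Icc, mem_Icc, not_and, not_and] at hcol
              constructor
              · by_contra hh; exact hcol.1 hξ.1 (by linarith)
              · by_contra hh; exact hcol.2 (by linarith) hξ.2
            rw [U.v1 ξ hξ1, U.v2 ξ hξ1]
            simp
            positivity
        refine (norm_sub_le _ _).trans ?_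
        linarith
      calc _ ≤ ∫ ξ in p..q, ((N + 6 * X * Nc + ‖A‖ * S) + |h| * S * ‖w ξ s‖ ^ 2) := by
            refine intervalIntegral.integral_mono_on hpq
              (Continuous.intervalIntegrable (by fun_prop) _ _)
              (Continuous.intervalIntegrable (by fun_prop) _ _) h1
        _ = (q - p) * (N + 6 * X * Nc + ‖A‖ * S) + |h| * S * ∫ ξ in p..q, ‖w ξ s‖ ^ 2 := by
            rw [intervalIntegral.integral_add (by simp)
              (Continuous.intervalIntegrable (by fun_prop) _ _),
              intervalIntegral.integral_const_mul, intervalIntegral.integral_const, smul_eq_mul]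
        _ ≤ (q - p) * (N + 6 * X * Nc + ‖A‖ * S) + |h| * S * A0 := by
            have := hA0 s hsb
            gcongr
        _ = C := by rw [hC]; ring) ξ
  simp only [sub_self, smul_zero, intervalIntegral.integral_zero, sub_zero] at key
  rw [U.one ξ hξ1, Complex.ofReal_one, one_smul, norm_smul, Complex.norm_real,
    Real.norm_of_nonneg (Real.sqrt_nonneg _)] at key
  have hpi : 1 ≤ √(4 * Real.pi) := by
    rw [Real.one_le_sqrt]; linarith [Real.pi_gt_three]
  have hst : √(t - a) ≤ √(b - a) := Real.sqrt_le_sqrt (by linarith [ht.2])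
  have hs1 : √(b - a) ≤ 1 := Real.sqrt_le_one.2 hb1
  have hA00 : 0 ≤ A0 := by
    have : (a + t)/2 ∈ Ioo a b := ⟨by linarith, by linarith [ht.2]⟩
    exact (intervalIntegral.integral_nonneg hpq (fun _ _ => by positivity)).trans (hA0 _ this)
  have k1 : ‖w ξ t - w ξ a‖ ≤ 2 * C * √(t - a) :=
    (le_mul_of_one_le_left (norm_nonneg _) hpi).trans key
  have hC0 : 0 ≤ C := by positivity
  have k2 : 2 * C * √(t - a) ≤ 2 * ((q - p) * (N + 6 * X * Nc)) + S / 2 := by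
    calc 2 * C * √(t - a) ≤ 2 * C * √(b - a) := by gcongr
      _ = √(b - a) * (2 * ((q - p) * (N + 6 * X * Nc)))
          + S * (2 * √(b - a) * (‖A‖ * (q - p) + |h| * A0)) := by rw [hC]; ring
      _ ≤ 1 * (2 * ((q - p) * (N + 6 * X * Nc))) + S * (1/2) := by gcongr
      _ = _ := by ring
  have k3 : ‖w ξ t‖ ≤ ‖w ξ t - w ξ a‖ + ‖w ξ a‖ := by
    simpa using norm_add_le (w ξ t - w ξ a) (w ξ a)
  have := (hN ξ hξ).1
  unfold LL
  linarith

theorem Setup.supBound [CompleteSpace E] (U : Setup ι A h p p1 q1 q Nc X χ χ1 χ2 J w wx wxx wt)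
    {a b B A0 N : ℝ}
    (G : Seg p q J w wt a b B) (hN : ∀ ξ ∈ Icc p q, ‖w ξ a‖ ≤ N ∧ ‖wxx ξ a‖ ≤ N)
    (hA0 : ∀ t ∈ Ioo a b, ∫ ξ in p..q, ‖w ξ t‖ ^ 2 ≤ A0)
    (hb1 : b - a ≤ 1) (hT : 2 * √(b - a) * (‖A‖ * (q - p) + |h| * A0) ≤ 1 / 2) :
    ∀ ξ ∈ Icc p q, ∀ t ∈ Icc a b, ‖w ξ t‖ ≤ 2 * LL p q Nc X N := by
  set T : Set ℝ := Set.image (fun z : ℝ × ℝ => ‖w z.1 z.2‖) (Icc p q ×ˢ Icc a b) with hTd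
  have hbdd : BddAbove T := ⟨B, by
    rintro _ ⟨z, hz, rfl⟩; exact G.bd _ hz.1 _ hz.2⟩
  have hle : ∀ ξ ∈ Icc p q, ∀ t ∈ Icc a b, ‖w ξ t‖ ≤ sSup T := fun ξ hξ t ht =>
    le_csSup hbdd ⟨(ξ, t), ⟨hξ, ht⟩, rfl⟩
  have hne : T.Nonempty := ⟨_, (p, a), ⟨left_mem_Icc.2 U.pq, left_mem_Icc.2 G.hab⟩, rfl⟩
  have h1 := U.supStep ⟨G.hab, G.sub, G.L, hle⟩ hN hA0 hb1 hT
  have h2 : sSup T ≤ LL p q Nc X N + sSup T / 2 := csSup_le hne (by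
    rintro _ ⟨z, hz, rfl⟩; exact h1 _ hz.1 _ hz.2)
  intro ξ hξ t ht
  linarith [hle ξ hξ t ht]

end

open Set Filter Topology MeasureTheory Asymptotics
set_option linter.unusedSectionVars false

section
variable {E : Type*} [NormedAddCommGroup E] [InnerProductSpace ℂ E] {ι A : ℂ} {h : ℝ}
    {p p1 q1 q Nc X : ℝ} {χ χ1 χ2 : ℝ → ℝ} {J : Set ℝ}
    {w wx wxx wt : ℝ → ℝ → E}

noncomputable def FF (A : ℂ) (h S N : ℝ) : ℝ := ‖A‖ * S + |h| * S ^ 3 + N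

noncomputable def CC (A : ℂ) (h p q Nc S N : ℝ) : ℝ := 8 * Nc^2 + (q - p) * (FF A h S N) ^ 2 + 1

/-- L2-Lipschitz at the initial time -/
theorem Setup.l2lip (U : Setup ι A h p p1 q1 q Nc X χ χ1 χ2 J w wx wxx wt)
    {a b S N : ℝ}
    (G : Seg p q J w wt a b S) (hN : ∀ ξ ∈ Icc p q, ‖wxx ξ a‖ ≤ N) :
    ∫ ξ in p..q, ‖w ξ b - w ξ a‖ ^ 2 ≤ Real.exp (CC A h p q Nc S N) * (b - a) ^ 2 := by
  rcases eq_or_lt_of_le G.hab with rfl | hab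
  · simp
  have Sl := U.sol
  have hpq := U.pq
  have hNc := U.hNc
  set s := b - a with hs
  have hs0 : 0 < s := by linarith
  set L := Sl.lin0 a
  have haI : a ∈ Icc a b := left_mem_Icc.2 G.hab
  have hpm : p ∈ Icc p q := left_mem_Icc.2 hpq
  have hS0 : 0 ≤ S := (norm_nonneg _).trans (G.bd p hpm a haI)
  have hqp : 0 ≤ q - p := by linarith
  have key := energy_ineq (C := CC A h p q Nc S N / s) (δ := s ^ 2) hpq G.hab (by positivity)
    (iota_re Sl.hι) L.hy L.hyx L.cxx L.ct L.eq (fun t ht => (G.L t ht).subConst _)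
    (mass_cont hpq L.cy (fun ξ => (Sl.cwt ξ).sub continuous_const) (B := S + S)
      (fun ξ hξ t ht => (norm_sub_le _ _).trans (add_le_add (G.bd ξ hξ t ht) (G.bd ξ hξ a haI))))
    (fun t ht => by
      have htI := Ioo_subset_Icc_self ht
      have hbdy : ∀ ξ ∈ Icc p p1 ∪ Icc q1 q, ‖w ξ t - w ξ a‖ * ‖wx ξ t - wx ξ a‖ ≤ 2 * Nc ^ 2 * s := by
        intro ξ hξ
        have e1 : ‖w ξ t - w ξ a‖ ≤ Nc * s := by
          have := (convex_Icc a b).norm_image_sub_le_of_norm_hasDerivWithin_le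
            (f := fun t => w ξ t) (f' := fun t => wt ξ t) (C := Nc)
            (fun r _ => (Sl.ht ξ r).hasDerivWithinAt) (fun r hr => U.cwt r (G.sub hr) ξ hξ) haI htI
          refine this.trans ?_
          rw [Real.norm_of_nonneg (by linarith [ht.1])]
          gcongr
          linarith [ht.2]
        have e2 : ‖wx ξ t - wx ξ a‖ ≤ Nc + Nc := (norm_sub_le _ _).trans
          (add_le_add (U.cwx t (G.sub htI) ξ hξ) (U.cwx a (G.sub haI) ξ hξ))
        calc _ ≤ (Nc * s) * (Nc + Nc) := by gcongr
          _ = _ := by ring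
      have hp := hbdy p U.mem_p
      have hq := hbdy q U.mem_q
      have cy := L.cy t
      have cF := L.cF t
      have hF : 2 * |∫ ξ in p..q, (inner ℂ (w ξ t - w ξ a)
          ((-(A + Complex.I * (h * ‖w ξ t‖ ^ 2 : ℝ))) • w ξ t + ι • wxx ξ a) : ℂ).re|
          ≤ s⁻¹ * (∫ ξ in p..q, ‖w ξ t - w ξ a‖ ^ 2) + (q - p) * (s * (FF A h S N) ^ 2) := by
        have h1 : |∫ ξ in p..q, (inner ℂ (w ξ t - w ξ a)
          ((-(A + Complex.I * (h * ‖w ξ t‖ ^ 2 : ℝ))) • w ξ t + ι • wxx ξ a) : ℂ).re|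
          ≤ ∫ ξ in p..q, (1/2) * (s⁻¹ * ‖w ξ t - w ξ a‖ ^ 2 + s * (FF A h S N) ^ 2) := by
          rw [← Real.norm_eq_abs]
          refine intervalIntegral.norm_integral_le_of_norm_le hpq (ae_of_all _ fun ξ hξ => ?_)
            (Continuous.intervalIntegrable (by fun_prop) _ _)
          have hξ' := Ioc_subset_Icc_self hξ
          rw [Real.norm_eq_abs]
          refine (abs_rin_le _ _).trans ?_
          have hf : ‖(-(A + Complex.I * (h * ‖w ξ t‖ ^ 2 : ℝ))) • w ξ t + ι • wxx ξ a‖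
              ≤ FF A h S N := by
            refine (norm_add_le _ _).trans (add_le_add ((normG _).trans ?_) ?_)
            · have := G.bd ξ hξ' t htI
              gcongr
            · rw [norm_smul, iota_norm Sl.hι, one_mul]; exact hN ξ hξ'
          set Y := ‖w ξ t - w ξ a‖
          have hY : 0 ≤ Y := norm_nonneg _
          have h2 : Y * FF A h S N ≤ (1/2) * (s⁻¹ * Y ^ 2 + s * (FF A h S N) ^ 2) := by
            have := sq_nonneg (Y - s * FF A h S N)
            have h3 : (1/2) * (s⁻¹ * Y ^ 2 + s * (FF A h S N) ^ 2) - Y * FF A h S N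
              = (1/2) * s⁻¹ * (Y - s * FF A h S N)^2 := by field_simp; ring
            have : 0 ≤ (1/2) * s⁻¹ * (Y - s * FF A h S N)^2 := by positivity
            linarith
          exact (mul_le_mul_of_nonneg_left hf hY).trans h2
        rw [intervalIntegral.integral_const_mul, intervalIntegral.integral_add
          (Continuous.intervalIntegrable (by fun_prop) _ _) (by simp),
          intervalIntegral.integral_const_mul, intervalIntegral.integral_const, smul_eq_mul] at h1
        linarith
      rw [iota_norm Sl.hι, one_mul, one_mul]
      have hQ : 0 ≤ ∫ ξ in p..q, ‖w ξ t - w ξ a‖ ^ 2 :=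
        intervalIntegral.integral_nonneg hpq (fun _ _ => by positivity)
      set Q := ∫ ξ in p..q, ‖w ξ t - w ξ a‖ ^ 2
      have hfin : CC A h p q Nc S N / s * (s ^ 2 + Q) = 8 * Nc^2 * s
          + (q - p) * (s * (FF A h S N) ^ 2) + s + (8 * Nc^2 + (q - p) * (FF A h S N) ^ 2) * (s⁻¹ * Q)
          + s⁻¹ * Q := by
        unfold CC; field_simp; ring
      rw [hfin]
      have : 0 ≤ (8 * Nc^2 + (q - p) * (FF A h S N) ^ 2) * (s⁻¹ * Q) := by positivity
      linarith)
  have k := key.1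
  simp only [sub_self, norm_zero] at k
  rw [show CC A h p q Nc S N / s * (b - a) = CC A h p q Nc S N by rw [← hs]; field_simp] at k
  simp only [ne_eq, OfNat.ofNat_ne_zero, not_false_eq_true, zero_pow,
    intervalIntegral.integral_zero, add_zero] at k
  linarith [sq_nonneg s]

/-- time reversal -/
theorem Sol.rev (S : Sol ι A h w wx wxx wt) :
    Sol (-ι) (-A) (-h) (fun ξ t => w ξ (-t)) (fun ξ t => wx ξ (-t)) (fun ξ t => wxx ξ (-t))
      (fun ξ t => -wt ξ (-t)) where
  hι := by rcases S.hι with h | h <;> simp [h]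
  hx ξ t := S.hx ξ (-t)
  hxx ξ t := S.hxx ξ (-t)
  ht ξ t := by
    have := (S.ht ξ (-t)).scomp t (hasDerivAt_neg t)
    exact this.congr_deriv (by simp)
  cxx t := S.cxx (-t)
  ct ξ := ((S.ct ξ).comp continuous_neg).neg
  eq ξ t := by
    rw [S.eq]
    push_cast
    module

theorem Setup.rev (U : Setup ι A h p p1 q1 q Nc X χ χ1 χ2 J w wx wxx wt) :
    Setup (-ι) (-A) (-h) p p1 q1 q Nc X χ χ1 χ2 {t | -t ∈ J}
      (fun ξ t => w ξ (-t)) (fun ξ t => wx ξ (-t)) (fun ξ t => wxx ξ (-t))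
      (fun ξ t => -wt ξ (-t)) :=
  { U with
    sol := U.sol.rev
    cw := fun t ht => U.cw (-t) ht
    cwx := fun t ht => U.cwx (-t) ht
    cwt := fun t ht ξ hξ => by rw [norm_neg]; exact U.cwt (-t) ht ξ hξ }

theorem L1D.rev {t : ℝ} (hL : L1D p q w wt (-t)) :
    L1D p q (fun ξ t => w ξ (-t)) (fun ξ t => -wt ξ (-t)) t := by
  unfold L1D at *
  have h2 : Tendsto (fun σ : ℝ => -σ) (𝓝 t) (𝓝 (-t)) := continuous_neg.tendsto t
  have h3 := hL.comp_tendsto h2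
  refine (h3.congr' (Eventually.of_forall fun σ => ?_) (Eventually.of_forall fun σ => rfl)).trans_isBigO ?_
  · simp only [Function.comp_apply]
    congr 1; funext ξ
    congr 1
    module
  · refine IsBigO.of_bound 1 (Eventually.of_forall fun σ => ?_)
    simp only [Function.comp_apply]
    rw [one_mul, ← norm_neg, neg_sub]
    apply le_of_eq; congr 1; ring

/-- good times -/
def Good {E : Type*} [NormedAddCommGroup E] [NormedSpace ℝ E] (p q : ℝ) (w wt : ℝ → ℝ → E)
    (t : ℝ) : Prop :=
  ∃ C : ℝ, ∀ᶠ s in 𝓝 t, L1D p q w wt s ∧ ∀ ξ ∈ Icc p q, ‖w ξ s‖ ≤ C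

theorem Good.l1d {t : ℝ} (hg : Good p q w wt t) : L1D p q w wt t := by
  obtain ⟨C, hC⟩ := hg
  exact hC.self_of_nhds.1

theorem Good.rev {t : ℝ} (hg : Good p q w wt (-t)) :
    Good p q (fun ξ t => w ξ (-t)) (fun ξ t => -wt ξ (-t)) t := by
  obtain ⟨C, hC⟩ := hg
  refine ⟨C, ?_⟩
  have h2 : Tendsto (fun σ : ℝ => -σ) (𝓝 t) (𝓝 (-t)) := continuous_neg.tendsto t
  filter_upwards [h2.eventually hC] with s hs
  exact ⟨hs.1.rev, hs.2⟩

theorem isOpen_good : IsOpen {t | Good p q w wt t} := by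
  rw [isOpen_iff_mem_nhds]
  rintro t ⟨C, hC⟩
  filter_upwards [hC.eventually_nhds] with s hs using ⟨C, hs⟩

theorem good_seg {a b : ℝ} (hab : a ≤ b) (hJ : Icc a b ⊆ J)
    (hg : ∀ t ∈ Icc a b, Good p q w wt t) : ∃ B, Seg p q J w wt a b B := by
  have : ∃ B, ∀ t ∈ Icc a b, ∀ ξ ∈ Icc p q, ‖w ξ t‖ ≤ B := by
    refine (isCompact_Icc (a := a) (b := b)).induction_on
      (p := fun s => ∃ B, ∀ t ∈ s, ∀ ξ ∈ Icc p q, ‖w ξ t‖ ≤ B) ⟨0, by simp⟩ ?_ ?_ ?_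
    · rintro s t hst ⟨B, hB⟩
      exact ⟨B, fun r hr => hB r (hst hr)⟩
    · rintro s t ⟨B, hB⟩ ⟨B', hB'⟩
      refine ⟨max B B', fun r hr ξ hξ => ?_⟩
      rcases hr with hr | hr
      · exact (hB r hr ξ hξ).trans (le_max_left _ _)
      · exact (hB' r hr ξ hξ).trans (le_max_right _ _)
    · intro t ht
      obtain ⟨C, hC⟩ := hg t ht
      exact ⟨{s | L1D p q w wt s ∧ ∀ ξ ∈ Icc p q, ‖w ξ s‖ ≤ C}, mem_nhdsWithin_of_mem_nhds hC,
        C, fun r hr => hr.2⟩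
  obtain ⟨B, hB⟩ := this
  exact ⟨B, hab, hJ, fun t ht => (hg t (Ioo_subset_Icc_self ht)).l1d, fun ξ hξ t ht => hB t ht ξ hξ⟩

end

open Set Filter Topology MeasureTheory Asymptotics
set_option linter.unusedSectionVars false

theorem bd_closure {E : Type*} [NormedAddCommGroup E] {f : ℝ → E} {a b M : ℝ} (hab : a < b)
    (hf : Continuous f) (h : ∀ t ∈ Ioo a b, ‖f t‖ ≤ M) : ∀ t ∈ Icc a b, ‖f t‖ ≤ M := by
  have hc : IsClosed {t | ‖f t‖ ≤ M} := isClosed_le hf.norm continuous_const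
  have := hc.closure_subset_iff.2 (show Ioo a b ⊆ {t | ‖f t‖ ≤ M} from h)
  rw [closure_Ioo hab.ne] at this
  exact this

theorem small_time (K : ℝ) (hK : 0 ≤ K) : ∃ T : ℝ, 0 < T ∧ T ≤ 1 ∧
    ∀ r ≤ T, 2 * √r * K ≤ 1 / 2 := by
  have h1 : 0 < 1 / (4 * (K + 1)) := by positivity
  refine ⟨min 1 ((1 / (4 * (K + 1))) ^ 2), by positivity, min_le_left _ _, fun r hr => ?_⟩
  have h2 : √r ≤ 1 / (4 * (K + 1)) := by
    rw [Real.sqrt_le_left h1.le]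
    exact hr.trans (min_le_right _ _)
  calc 2 * √r * K ≤ 2 * (1 / (4 * (K + 1))) * (K + 1) := by gcongr; linarith
    _ = 1 / 2 := by field_simp; norm_num

section
variable {E : Type*} [NormedAddCommGroup E] [InnerProductSpace ℂ E] [CompleteSpace E]
    {ι A : ℂ} {h : ℝ}
    {p p1 q1 q Nc X : ℝ} {χ χ1 χ2 : ℝ → ℝ} {J : Set ℝ}
    {w wx wxx wt : ℝ → ℝ → E}

theorem Setup.gapA (U : Setup ι A h p p1 q1 q Nc X χ χ1 χ2 J w wx wxx wt) {a b b' : ℝ}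
    (hJ : Icc a b ⊆ J) (hg : ∀ t ∈ Ioo a b, Good p q w wt t) (hb' : b' ∈ Ioo a b) :
    ∃ B, Seg p q J w wt a b' B := by
  have hpq := U.pq
  have Sl := U.sol
  obtain ⟨ha', hbb⟩ := hb'
  have hsub : ∀ {s t}, a < s → t ≤ b' → Icc s t ⊆ Ioo a b := fun hs ht r hr =>
    ⟨hs.trans_le hr.1, (hr.2.trans ht).trans_lt hbb⟩
  set M := Real.exp ((4 * Nc^2 + 2 * ‖A‖) * (b' - a)) * (1 + ∫ ξ in p..q, ‖w ξ b'‖ ^ 2) with hM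
  have hmass : ∀ t, a < t → t ≤ b' → ∫ ξ in p..q, ‖w ξ t‖ ^ 2 ≤ M := by
    intro t h1 h2
    obtain ⟨B, G⟩ := good_seg h2 ((hsub h1 le_rfl).trans (Ioo_subset_Icc_self.trans hJ))
      (fun r hr => hg r (hsub h1 le_rfl hr))
    have := (U.mass G).2
    have hQ : 0 ≤ ∫ ξ in p..q, ‖w ξ b'‖ ^ 2 :=
      intervalIntegral.integral_nonneg hpq (fun _ _ => by positivity)
    have h3 : Real.exp ((4 * Nc^2 + 2 * ‖A‖) * (b' - t)) ≤
        Real.exp ((4 * Nc^2 + 2 * ‖A‖) * (b' - a)) := by gcongr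
    have h4 : Real.exp ((4 * Nc^2 + 2 * ‖A‖) * (b' - t)) * (1 + ∫ ξ in p..q, ‖w ξ b'‖ ^ 2) ≤ M := by
      rw [hM]; gcongr
    linarith
  have hM0 : 0 ≤ M := (intervalIntegral.integral_nonneg hpq (fun _ _ => by positivity)).trans
    (hmass b' ha' le_rfl)
  obtain ⟨T, hT0, hT1, hT⟩ := small_time (‖A‖ * (q - p) + |h| * M)
    (by have : 0 ≤ q - p := by linarith
        positivity)
  set c := min b' (a + T) with hc
  have hac : a < c := lt_min ha' (by linarith)
  have hcb : c ≤ b' := min_le_left _ _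
  have hcT : c - a ≤ T := by linarith [min_le_right b' (a + T)]
  obtain ⟨N1, hN1⟩ := isCompact_Icc.exists_bound_of_continuousOn (Sl.cw c).continuousOn (s := Icc p q)
  obtain ⟨N2, hN2⟩ := isCompact_Icc.exists_bound_of_continuousOn (Sl.cxx c).continuousOn (s := Icc p q)
  have hback : ∀ t ∈ Ioo a c, ∀ ξ ∈ Icc p q, ‖w ξ t‖ ≤ 2 * LL p q Nc X (max N1 N2) := by
    intro t ht ξ hξ
    have hs := hsub (s := t) (t := c) ht.1 hcb
    have hmem : ∀ {r}, r ∈ Icc (-c) (-t) → -r ∈ Icc t c := fun hr =>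
      ⟨by linarith [hr.2], by linarith [hr.1]⟩
    obtain ⟨B, G⟩ := good_seg (J := {t | -t ∈ J}) (p := p) (q := q)
      (w := fun ξ t => w ξ (-t)) (wt := fun ξ t => -wt ξ (-t)) (a := -c) (b := -t)
      (by linarith [ht.2])
      (fun r hr => hJ (Ioo_subset_Icc_self (hs (hmem hr))))
      (fun r hr => (hg (-r) (hs (hmem hr))).rev)
    have := U.rev.supBound G (N := max N1 N2) (A0 := M)
      (fun ξ hξ => by
        simp only [neg_neg]
        exact ⟨(hN1 ξ hξ).trans (le_max_left _ _), (hN2 ξ hξ).trans (le_max_right _ _)⟩)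
      (fun r hr => hmass (-r) (ht.1.trans (by linarith [hr.2])) (by linarith [hr.1]))
      (by linarith [ht.1]) (by
        rw [norm_neg, abs_neg]
        exact hT _ (by linarith [ht.1])) ξ hξ (-t) (right_mem_Icc.2 (by linarith [ht.2]))
    simpa using this
  obtain ⟨B, G⟩ := good_seg (J := J) hcb ((hsub hac le_rfl).trans (Ioo_subset_Icc_self.trans hJ))
      (fun r hr => hg r (hsub hac le_rfl hr))
  refine ⟨max B (2 * LL p q Nc X (max N1 N2)), ha'.le, (Icc_subset_Icc_right hbb.le).trans hJ,
    fun t ht => (hg t ⟨ht.1, ht.2.trans hbb⟩).l1d, fun ξ hξ t ht => ?_⟩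
  rcases le_total t c with htc | htc
  · exact (bd_closure hac (Sl.cwt ξ) (fun t ht => hback t ht ξ hξ) t ⟨ht.1, htc⟩).trans
      (le_max_right _ _)
  · exact (G.bd ξ hξ t ⟨htc, ht.2⟩).trans (le_max_left _ _)

noncomputable def AA (A : ℂ) (p q Nc N : ℝ) : ℝ :=
  Real.exp (4 * Nc^2 + 2 * ‖A‖) * (1 + (q - p) * N ^ 2)

theorem Setup.gl (U : Setup ι A h p p1 q1 q Nc X χ χ1 χ2 J w wx wxx wt) {a b N : ℝ} (hab : a < b)
    (hJ : Icc a b ⊆ J) (hg : ∀ t ∈ Ioo a b, Good p q w wt t)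
    (hN : ∀ ξ ∈ Icc p q, ‖w ξ a‖ ≤ N ∧ ‖wxx ξ a‖ ≤ N) (hb1 : b - a ≤ 1)
    (hT : 2 * √(b - a) * (‖A‖ * (q - p) + |h| * AA A p q Nc N) ≤ 1 / 2) :
    Seg p q J w wt a b (2 * LL p q Nc X N) := by
  have hpq := U.pq
  have Sl := U.sol
  have hqp : 0 ≤ q - p := by linarith
  have hAA : 0 ≤ AA A p q Nc N := by unfold AA; positivity
  have key : ∀ b' ∈ Ioo a b, ∀ ξ ∈ Icc p q, ∀ t ∈ Icc a b', ‖w ξ t‖ ≤ 2 * LL p q Nc X N := by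
    intro b' hb'
    obtain ⟨B, G⟩ := U.gapA hJ hg hb'
    refine U.supBound G hN (A0 := AA A p q Nc N) (fun t ht => ?_) (by linarith [hb'.2]) ?_
    · have Gt : Seg p q J w wt a t B := ⟨ht.1.le, (Icc_subset_Icc_right ht.2.le).trans G.sub,
        fun s hs => G.L s ⟨hs.1, hs.2.trans ht.2⟩,
        fun ξ hξ s hs => G.bd ξ hξ s ⟨hs.1, hs.2.trans ht.2.le⟩⟩
      have h1 := (U.mass Gt).1
      have h2 : ∫ ξ in p..q, ‖w ξ a‖ ^ 2 ≤ (q - p) * N ^ 2 := by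
        have : ∫ ξ in p..q, ‖w ξ a‖ ^ 2 ≤ ∫ ξ in p..q, N ^ 2 := by
          refine intervalIntegral.integral_mono_on hpq
            (Continuous.intervalIntegrable (by have := Sl.cw a; fun_prop) _ _) (by simp) ?_
          intro ξ hξ
          have := (hN ξ hξ).1
          gcongr
        simpa using this
      have h3 : Real.exp ((4 * Nc^2 + 2 * ‖A‖) * (t - a)) ≤ Real.exp (4 * Nc^2 + 2 * ‖A‖) := by
        rw [Real.exp_le_exp]
        refine mul_le_of_le_one_right (by positivity) (by linarith [ht.2, hb'.2])
      have h4 : Real.exp ((4 * Nc^2 + 2 * ‖A‖) * (t - a)) * (1 + ∫ ξ in p..q, ‖w ξ a‖ ^ 2)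
          ≤ AA A p q Nc N := by
        unfold AA
        have hQ : 0 ≤ ∫ ξ in p..q, ‖w ξ a‖ ^ 2 :=
          intervalIntegral.integral_nonneg hpq (fun _ _ => by positivity)
        gcongr
      linarith
    · refine le_trans ?_ hT
      have : √(b' - a) ≤ √(b - a) := Real.sqrt_le_sqrt (by linarith [hb'.2])
      gcongr
  refine ⟨hab.le, hJ, fun t ht => (hg t ht).l1d, fun ξ hξ => ?_⟩
  exact bd_closure hab (Sl.cwt ξ) (fun t ht => key t ht ξ hξ t (right_mem_Icc.2 ht.1.le))

end

open Set Filter Topology MeasureTheory Asymptotics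
set_option linter.unusedSectionVars false

/-- Times at which everything is bounded by `N`. -/
def HH {E : Type*} [NormedAddCommGroup E] (p q : ℝ) (w wxx wt : ℝ → ℝ → E) (N : ℝ) : Set ℝ :=
  {t | ∀ ξ ∈ Icc p q, ‖w ξ t‖ ≤ N ∧ ‖wxx ξ t‖ ≤ N ∧ ‖wt ξ t‖ ≤ N}

section
variable {E : Type*} [NormedAddCommGroup E] [InnerProductSpace ℂ E] [CompleteSpace E]
    {ι A : ℂ} {h : ℝ}
    {p p1 q1 q Nc X : ℝ} {χ χ1 χ2 : ℝ → ℝ} {J : Set ℝ}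
    {w wx wxx wt : ℝ → ℝ → E}

theorem Sol.wxx_eq (S : Sol ι A h w wx wxx wt) (ξ t : ℝ) :
    wxx ξ t = (-ι) • (wt ξ t + (A + Complex.I * (h * ‖w ξ t‖ ^ 2 : ℝ)) • w ξ t) := by
  rw [S.eq]
  have h2 : ι * ι = -1 := by rcases S.hι with h | h <;> simp [h]
  have : (-ι) • (ι • wxx ξ t + (-(A + Complex.I * (h * ‖w ξ t‖ ^ 2 : ℝ))) • w ξ t +
      (A + Complex.I * (h * ‖w ξ t‖ ^ 2 : ℝ)) • w ξ t) = (-(ι * ι)) • wxx ξ t := by module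
  rw [this, h2]; simp

theorem Sol.cxxt (S : Sol ι A h w wx wxx wt) (ξ : ℝ) : Continuous fun t => wxx ξ t := by
  have h1 := S.ct ξ
  have h2 := S.cwt ξ
  have : (fun t => wxx ξ t) = fun t =>
      (-ι) • (wt ξ t + (A + Complex.I * (h * ‖w ξ t‖ ^ 2 : ℝ)) • w ξ t) :=
    funext fun t => S.wxx_eq ξ t
  rw [this]
  fun_prop

theorem Sol.closed_HH (S : Sol ι A h w wx wxx wt) (N : ℝ) : IsClosed (HH p q w wxx wt N) := by
  have : HH p q w wxx wt N = ⋂ ξ ∈ Icc p q,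
      ({t | ‖w ξ t‖ ≤ N} ∩ ({t | ‖wxx ξ t‖ ≤ N} ∩ {t | ‖wt ξ t‖ ≤ N})) := by
    ext t; simp [HH]
  rw [this]
  exact isClosed_biInter fun ξ _ =>
    (isClosed_le (S.cwt ξ).norm continuous_const).inter
      ((isClosed_le (S.cxxt ξ).norm continuous_const).inter
        (isClosed_le (S.ct ξ).norm continuous_const))

theorem Setup.gap2 (U : Setup ι A h p p1 q1 q Nc X χ χ1 χ2 J w wx wxx wt) {a b N i0 i1 : ℝ}
    (hIJ : Icc i0 i1 ⊆ J) (hT : ∀ r ≤ i1 - i0, 2 * √r * (‖A‖ * (q - p) + |h| * AA A p q Nc N) ≤ 1 / 2)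
    (h1 : i1 - i0 ≤ 1) (ha : a ∈ HH p q w wxx wt N) (h0 : i0 ≤ a) (hab : a ≤ b) (hb : b ≤ i1)
    (hg : ∀ t ∈ Ioo a b, Good p q w wt t) :
    (∫ ξ in p..q, ‖w ξ b - w ξ a‖ ^ 2 ≤
      (Real.exp (CC A h p q Nc (2 * LL p q Nc X N) N / 2) * (b - a)) ^ 2) ∧
    ∀ ξ ∈ Icc p q, ‖w ξ b‖ ≤ max N (2 * LL p q Nc X N) := by
  rcases eq_or_lt_of_le hab with rfl | hab
  · exact ⟨by simp, fun ξ hξ => ((ha ξ hξ).1).trans (le_max_left _ _)⟩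
  have G := U.gl hab ((Icc_subset_Icc h0 hb).trans hIJ) hg
    (fun ξ hξ => ⟨(ha ξ hξ).1, (ha ξ hξ).2.1⟩) (by linarith) (hT _ (by linarith))
  refine ⟨?_, fun ξ hξ => (G.bd ξ hξ b (right_mem_Icc.2 hab.le)).trans (le_max_right _ _)⟩
  refine (U.l2lip G fun ξ hξ => (ha ξ hξ).2.1).trans (le_of_eq ?_)
  rw [mul_pow, ← Real.exp_nat_mul]
  congr 2
  push_cast; ring

theorem Setup.chain (U : Setup ι A h p p1 q1 q Nc X χ χ1 χ2 J w wx wxx wt) {N i0 i1 η : ℝ}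
    (hIJ : Icc i0 i1 ⊆ J) (hT : ∀ r ≤ i1 - i0, 2 * √r * (‖A‖ * (q - p) + |h| * AA A p q Nc N) ≤ 1 / 2)
    (h1 : i1 - i0 ≤ 1) (hη : 0 < η)
    (hHG : ∀ t ∈ Icc i0 i1, t ∈ HH p q w wxx wt N ∨ Good p q w wt t) (n : ℕ) :
    ∀ b σ, b ∈ HH p q w wxx wt N → i0 ≤ b → b ≤ σ → σ ≤ i1 → σ - b ≤ n * η →
    ∃ P : ℝ → E, Continuous P ∧ (∫ ξ in p..q, ‖P ξ‖ ^ 2 ≤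
      (Real.exp (CC A h p q Nc (2 * LL p q Nc X N) N / 2) * (σ - b)) ^ 2) ∧
      ∀ ξ ∈ Icc p q, ∀ ω ≥ 0, (∀ s ∈ Icc i0 i1, ∀ t ∈ Icc i0 i1, |s - t| ≤ η →
        ‖wt ξ s - wt ξ t‖ ≤ ω) → ‖w ξ σ - w ξ b - P ξ‖ ≤ (N + ω) * (σ - b) := by
  have Sl := U.sol
  have hpq := U.pq
  induction n with
  | zero =>
    intro b σ hb h0 hbσ hσ hn
    have : σ = b := by simp at hn; linarith
    subst this
    exact ⟨fun _ => 0, continuous_const, by simp, fun ξ _ ω _ _ => by simp⟩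
  | succ n ih =>
    intro b σ hb h0 hbσ hσ hn
    set C := Real.exp (CC A h p q Nc (2 * LL p q Nc X N) N / 2) with hC
    have hC0 : 0 ≤ C := (Real.exp_pos _).le
    set m := min (b + η) σ with hm
    have hbm : b ≤ m := le_min (by linarith) hbσ
    have hmσ : m ≤ σ := min_le_right _ _
    have hmη : m ≤ b + η := min_le_left _ _
    have hcl : IsClosed (HH p q w wxx wt N) := Sl.closed_HH N
    obtain ⟨b', ⟨hb'H, hb'I⟩, hb'max⟩ := (isCompact_Icc.inter_left hcl).exists_isGreatest
      (s := HH p q w wxx wt N ∩ Icc b m) ⟨b, hb, left_mem_Icc.2 hbm⟩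
    have hmv : ∀ ξ ∈ Icc p q, ∀ ω ≥ 0, (∀ s ∈ Icc i0 i1, ∀ t ∈ Icc i0 i1, |s - t| ≤ η →
        ‖wt ξ s - wt ξ t‖ ≤ ω) → ‖w ξ b' - w ξ b‖ ≤ (N + ω) * (b' - b) := by
      intro ξ hξ ω hω hmod
      refine norm_image_sub_le_of_norm_deriv_le_segment' (f := fun t => w ξ t)
        (f' := fun t => wt ξ t) (fun t _ => (Sl.ht ξ t).hasDerivWithinAt) ?_ b'
        (right_mem_Icc.2 hb'I.1)
      intro s hs
      have hs2 : s ≤ m := hs.2.le.trans hb'I.2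
      have e1 := hmod s ⟨h0.trans hs.1, hs2.trans (hmσ.trans hσ)⟩ b ⟨h0, hbσ.trans hσ⟩
        (by rw [abs_of_nonneg (by linarith [hs.1])]; linarith)
      have e2 := (hb ξ hξ).2.2
      calc ‖wt ξ s‖ = ‖wt ξ b + (wt ξ s - wt ξ b)‖ := by congr 1; abel
        _ ≤ ‖wt ξ b‖ + ‖wt ξ s - wt ξ b‖ := norm_add_le _ _
        _ ≤ N + ω := by linarith
    have hgood1 : ∀ t, b' < t → t ≤ m → Good p q w wt t := by
      intro t ht1 ht2
      rcases hHG t ⟨by linarith [hb'I.1], by linarith⟩ with hh | hh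
      · have := hb'max ⟨hh, by linarith [hb'I.1], ht2⟩
        linarith
      · exact hh
    by_cases hne : (HH p q w wxx wt N ∩ Icc m σ).Nonempty
    · obtain ⟨b2, ⟨hb2H, hb2I⟩, hb2min⟩ := (isCompact_Icc.inter_left hcl).exists_isLeast hne
      have hgood : ∀ t ∈ Ioo b' b2, Good p q w wt t := by
        intro t ht
        rcases le_total t m with htm | htm
        · exact hgood1 t ht.1 htm
        · rcases hHG t ⟨by linarith [hb'I.1, ht.1], by linarith [ht.2, hb2I.2]⟩ with hh | hh
          · have := hb2min ⟨hh, htm, by linarith [ht.2, hb2I.2]⟩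
            linarith [ht.2]
          · exact hh
      have hg2 := (U.gap2 hIJ hT h1 hb'H (h0.trans hb'I.1) (hb'I.2.trans hb2I.1)
        (hb2I.2.trans hσ) hgood).1
      rw [← hC] at hg2
      obtain ⟨P, hPc, hPi, hPp⟩ := ih b2 σ hb2H (by linarith [hb2I.1]) hb2I.2 hσ (by
        rcases le_total (b + η) σ with hh | hh
        · have : m = b + η := min_eq_left hh
          push_cast at hn
          linarith [hb2I.1]
        · have : m = σ := min_eq_right hh
          have : (0:ℝ) ≤ n * η := by positivity
          linarith [hb2I.1])
      have hb2b' : b' ≤ b2 := hb'I.2.trans hb2I.1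
      refine ⟨fun ξ => (w ξ b2 - w ξ b') + P ξ, ((Sl.cw b2).sub (Sl.cw b')).add hPc, ?_, ?_⟩
      · refine (L2_add hpq ((Sl.cw b2).sub (Sl.cw b')).continuousOn hPc.continuousOn
          (mul_nonneg hC0 (by linarith)) (mul_nonneg hC0 (by linarith [hb2I.2])) hg2 hPi).trans ?_
        have : C * (b2 - b') + C * (σ - b2) ≤ C * (σ - b) := by
          rw [← mul_add]; refine mul_le_mul_of_nonneg_left ?_ hC0; linarith [hb'I.1]
        have h0 : 0 ≤ C * (b2 - b') + C * (σ - b2) :=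
          add_nonneg (mul_nonneg hC0 (by linarith)) (mul_nonneg hC0 (by linarith [hb2I.2]))
        gcongr
      · intro ξ hξ ω hω hmod
        have e1 := hmv ξ hξ ω hω hmod
        have e2 := hPp ξ hξ ω hω hmod
        have hN0 : 0 ≤ N := (norm_nonneg _).trans (hb ξ hξ).1
        calc ‖w ξ σ - w ξ b - (w ξ b2 - w ξ b' + P ξ)‖
            = ‖(w ξ b' - w ξ b) + (w ξ σ - w ξ b2 - P ξ)‖ := by congr 1; abel
          _ ≤ (N + ω) * (b' - b) + (N + ω) * (σ - b2) := (norm_add_le _ _).trans (add_le_add e1 e2)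
          _ = (N + ω) * (b' - b + (σ - b2)) := by ring
          _ ≤ (N + ω) * (σ - b) := by gcongr; linarith
    · have hgood : ∀ t ∈ Ioo b' σ, Good p q w wt t := by
        intro t ht
        rcases le_total t m with htm | htm
        · exact hgood1 t ht.1 htm
        · rcases hHG t ⟨by linarith [hb'I.1, ht.1], by linarith [ht.2]⟩ with hh | hh
          · exact (hne ⟨t, hh, htm, ht.2.le⟩).elim
          · exact hh
      have hg2 := (U.gap2 hIJ hT h1 hb'H (h0.trans hb'I.1) (hb'I.2.trans hmσ) hσ hgood).1
      rw [← hC] at hg2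
      refine ⟨fun ξ => (w ξ σ - w ξ b'), (Sl.cw σ).sub (Sl.cw b'), hg2.trans ?_, ?_⟩
      · have : 0 ≤ σ - b' := by linarith [hb'I.2]
        have := hb'I.1
        gcongr
      · intro ξ hξ ω hω hmod
        have e1 := hmv ξ hξ ω hω hmod
        have hN0 : 0 ≤ N := (norm_nonneg _).trans (hb ξ hξ).1
        calc ‖w ξ σ - w ξ b - (w ξ σ - w ξ b')‖
            = ‖(w ξ b' - w ξ b)‖ := by congr 1; abel
          _ ≤ (N + ω) * (b' - b) := e1
          _ ≤ (N + ω) * (σ - b) := by gcongr; linarith [hb'I.2]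

theorem Setup.fwd (U : Setup ι A h p p1 q1 q Nc X χ χ1 χ2 J w wx wxx wt) {N i0 i1 : ℝ}
    (hIJ : Icc i0 i1 ⊆ J) (hT : ∀ r ≤ i1 - i0, 2 * √r * (‖A‖ * (q - p) + |h| * AA A p q Nc N) ≤ 1 / 2)
    (h1 : i1 - i0 ≤ 1)
    (hHG : ∀ t ∈ Icc i0 i1, t ∈ HH p q w wxx wt N ∨ Good p q w wt t) :
    ∃ K, ∀ b σ, b ∈ HH p q w wxx wt N → i0 ≤ b → b ≤ σ → σ ≤ i1 →
      (∫ ξ in p..q, ‖w ξ σ - w ξ b‖ ^ 2 ≤ K * (σ - b) ^ 2) ∧ ∀ ξ ∈ Icc p q, ‖w ξ σ‖ ≤ K := by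
  have Sl := U.sol
  have hpq := U.pq
  set C := Real.exp (CC A h p q Nc (2 * LL p q Nc X N) N / 2) with hC
  set K1 := 2 * C ^ 2 + 2 * (N + 1) ^ 2 * (q - p) with hK1
  refine ⟨max K1 (max N (2 * LL p q Nc X N)), fun b σ hb h0 hbσ hσ => ⟨?_, ?_⟩⟩
  · have hch : ∀ n : ℕ, ∃ P : ℝ → E, Continuous P ∧ (∫ ξ in p..q, ‖P ξ‖ ^ 2 ≤ (C * (σ - b)) ^ 2) ∧
      ∀ ξ ∈ Icc p q, ∀ ω ≥ 0, (∀ s ∈ Icc i0 i1, ∀ t ∈ Icc i0 i1, |s - t| ≤ 1 / ((n : ℝ) + 1) →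
        ‖wt ξ s - wt ξ t‖ ≤ ω) → ‖w ξ σ - w ξ b - P ξ‖ ≤ (N + ω) * (σ - b) := by
      intro n
      have hη : (0:ℝ) < 1 / ((n : ℝ) + 1) := by positivity
      obtain ⟨k, hk⟩ := exists_nat_ge ((σ - b) / (1 / ((n : ℝ) + 1)))
      exact U.chain hIJ hT h1 hη hHG k b σ hb h0 hbσ hσ (by rwa [div_le_iff₀ hη] at hk)
    choose P hPc hPi hPp using hch
    have hmain : ∫ ξ in p..q, ‖w ξ σ - w ξ b‖ ^ 2 ≤ K1 * (σ - b) ^ 2 := by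
      refine fatou_interval (g := fun n ξ => 2 * ‖P n ξ‖ ^ 2 + 2 * ((N + 1) * (σ - b)) ^ 2) hpq
        (((Sl.cw σ).sub (Sl.cw b)).norm.pow 2).continuousOn
        (fun n => by have := hPc n; exact Continuous.continuousOn (by fun_prop))
        (fun _ _ => by positivity) (fun _ _ _ => by positivity) ?_ ?_
      · intro ξ hξ ε hε
        have huc := (isCompact_Icc (a := i0) (b := i1)).uniformContinuousOn_of_continuous
          (Sl.ct ξ).continuousOn
        rw [Metric.uniformContinuousOn_iff] at huc
        obtain ⟨δ, hδ, hδ'⟩ := huc 1 one_pos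
        filter_upwards [(tendsto_one_div_add_atTop_nhds_zero_nat (𝕜 := ℝ)).eventually_lt_const hδ]
          with n hn
        have e := hPp n ξ hξ 1 zero_le_one (fun s hs t ht hst => by
          have := hδ' s hs t ht (by rw [Real.dist_eq]; linarith)
          rw [dist_eq_norm] at this; exact this.le)
        have e2 : ‖w ξ σ - w ξ b‖ ≤ ‖P n ξ‖ + (N + 1) * (σ - b) := by
          calc ‖w ξ σ - w ξ b‖ = ‖P n ξ + (w ξ σ - w ξ b - P n ξ)‖ := by congr 1; abel
            _ ≤ _ := (norm_add_le _ _).trans (by linarith)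
        have e3 : ‖w ξ σ - w ξ b‖ ^ 2 ≤ (‖P n ξ‖ + (N + 1) * (σ - b)) ^ 2 := by gcongr
        nlinarith [sq_nonneg (‖P n ξ‖ - (N + 1) * (σ - b))]
      · intro n
        have hc := hPc n
        rw [intervalIntegral.integral_add (Continuous.intervalIntegrable (by fun_prop) _ _) (by simp),
          intervalIntegral.integral_const_mul, intervalIntegral.integral_const, smul_eq_mul, hK1]
        nlinarith [hPi n]
    refine hmain.trans ?_
    gcongr
    exact le_max_left _ _
  · have hcl : IsClosed (HH p q w wxx wt N) := Sl.closed_HH N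
    obtain ⟨b', ⟨hb'H, hb'I⟩, hb'max⟩ := (isCompact_Icc.inter_left hcl).exists_isGreatest
      (s := HH p q w wxx wt N ∩ Icc b σ) ⟨b, hb, left_mem_Icc.2 hbσ⟩
    have hgood : ∀ t ∈ Ioo b' σ, Good p q w wt t := by
      intro t ht
      rcases hHG t ⟨by linarith [hb'I.1, ht.1], by linarith [ht.2]⟩ with hh | hh
      · have := hb'max ⟨hh, by linarith [hb'I.1, ht.1], ht.2.le⟩
        linarith [ht.1]
      · exact hh
    intro ξ hξ
    exact ((U.gap2 hIJ hT h1 hb'H (h0.trans hb'I.1) hb'I.2 hσ hgood).2 ξ hξ).trans (le_max_right _ _)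

theorem Setup.chain_good (U : Setup ι A h p p1 q1 q Nc X χ χ1 χ2 J w wx wxx wt) {N i0 i1 b0 : ℝ}
    (hIJ : Icc i0 i1 ⊆ J) (hT : ∀ r ≤ i1 - i0, 2 * √r * (‖A‖ * (q - p) + |h| * AA A p q Nc N) ≤ 1 / 2)
    (h1 : i1 - i0 ≤ 1)
    (hHG : ∀ t ∈ Icc i0 i1, t ∈ HH p q w wxx wt N ∨ Good p q w wt t)
    (hb0 : b0 ∈ HH p q w wxx wt N) (hbI : b0 ∈ Ioo i0 i1) : Good p q w wt b0 := by
  have Sl := U.sol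
  have hpq := U.pq
  obtain ⟨K, hK⟩ := U.fwd hIJ hT h1 hHG
  have hrevH : ∀ t, t ∈ HH p q (fun ξ t => w ξ (-t)) (fun ξ t => wxx ξ (-t))
      (fun ξ t => -wt ξ (-t)) N ↔ -t ∈ HH p q w wxx wt N := by
    intro t; simp [HH]
  obtain ⟨K', hK'⟩ := U.rev.fwd (N := N) (i0 := -i1) (i1 := -i0)
    (fun t ht => hIJ ⟨by linarith [ht.2], by linarith [ht.1]⟩)
    (fun r hr => by
      have := hT r (by linarith)
      simpa [AA] using this) (by linarith)
    (fun t ht => by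
      rw [hrevH]
      exact (hHG (-t) ⟨by linarith [ht.2], by linarith [ht.1]⟩).imp id Good.rev)
  have hboth : ∀ b σ, b ∈ HH p q w wxx wt N → b ∈ Icc i0 i1 → σ ∈ Icc i0 i1 →
      (∫ ξ in p..q, ‖w ξ σ - w ξ b‖ ^ 2 ≤ max K K' * (σ - b) ^ 2) ∧
        ∀ ξ ∈ Icc p q, ‖w ξ σ‖ ≤ max K K' := by
    intro b σ hb hbI hσI
    rcases le_total b σ with hbσ | hbσ
    · obtain ⟨e1, e2⟩ := hK b σ hb hbI.1 hbσ hσI.2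
      refine ⟨e1.trans ?_, fun ξ hξ => (e2 ξ hξ).trans (le_max_left _ _)⟩
      gcongr; exact le_max_left _ _
    · obtain ⟨e1, e2⟩ := hK' (-b) (-σ) (by rw [hrevH]; simpa using hb) (by linarith [hbI.2])
        (by linarith) (by linarith [hσI.1])
      simp only [neg_neg] at e1 e2
      refine ⟨e1.trans ?_, fun ξ hξ => (e2 ξ hξ).trans (le_max_right _ _)⟩
      rw [show (-σ - -b) ^ 2 = (σ - b) ^ 2 by ring]
      gcongr; exact le_max_right _ _
  refine ⟨max K K', ?_⟩
  filter_upwards [Ioo_mem_nhds hbI.1 hbI.2] with s hs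
  have hsI : s ∈ Icc i0 i1 := Ioo_subset_Icc_self hs
  refine ⟨?_, (hboth b0 s hb0 (Ioo_subset_Icc_self hbI) hsI).2⟩
  rcases hHG s hsI with hh | hh
  · refine L1D_of_L2 hpq (fun σ => (Sl.cw σ).continuousOn) (Sl.cts s).continuousOn
      (fun ξ _ => Sl.ht ξ s) (C := max K K') ?_
    filter_upwards [Ioo_mem_nhds hs.1 hs.2] with σ hσ
    exact (hboth s σ hh hsI (Ioo_subset_Icc_self hσ)).1
  · exact hh.l1d

end

open Set Filter Topology MeasureTheory Asymptotics
set_option linter.unusedSectionVars false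

theorem deriv_zero_of_const {f f1 : ℝ → ℝ} {c : ℝ} {s : Set ℝ} (hs : s ⊆ closure (interior s))
    (hd : ∀ ξ, HasDerivAt f (f1 ξ) ξ) (hc : Continuous f1) (h : ∀ ξ ∈ s, f ξ = c) :
    ∀ ξ ∈ s, f1 ξ = 0 := by
  have h1 : interior s ⊆ {ξ | f1 ξ = 0} := by
    intro ξ hξ
    have : f =ᶠ[𝓝 ξ] fun _ => c := by
      filter_upwards [mem_interior_iff_mem_nhds.1 hξ] with x hx using h x hx
    exact (hd ξ).unique ((hasDerivAt_const ξ c).congr_of_eventuallyEq this)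
  have h2 : closure (interior s) ⊆ {ξ | f1 ξ = 0} :=
    (isClosed_eq hc continuous_const).closure_subset_iff.2 h1
  exact fun ξ hξ => h2 (hs hξ)

theorem cutoff_exists {p p1 q1 q : ℝ} (hp : p < p1) (hpq : p1 < q1) (hq : q1 < q) :
    ∃ (χ χ1 χ2 : ℝ → ℝ) (X : ℝ), Cutoff p q χ χ1 χ2 ∧ 0 ≤ X ∧ (∀ ξ ∈ Icc p1 q1, χ ξ = 1) ∧
      (∀ ξ, |χ ξ| ≤ 1) ∧ (∀ ξ, |χ1 ξ| ≤ X) ∧ (∀ ξ, |χ2 ξ| ≤ X) ∧ (∀ ξ ∈ Icc p1 q1, χ1 ξ = 0) ∧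
      (∀ ξ ∈ Icc p1 q1, χ2 ξ = 0) := by
  set χ : ℝ → ℝ := fun ξ => Real.smoothTransition ((ξ - p) / (p1 - p)) *
    Real.smoothTransition ((q - ξ) / (q - q1)) with hχ
  have hC : ContDiff ℝ 2 χ := by
    have h1 : ContDiff ℝ 2 (fun ξ : ℝ => Real.smoothTransition ((ξ - p) / (p1 - p))) :=
      (Real.smoothTransition.contDiff (n := 2)).comp (by fun_prop)
    have h2 : ContDiff ℝ 2 (fun ξ : ℝ => Real.smoothTransition ((q - ξ) / (q - q1))) :=
      (Real.smoothTransition.contDiff (n := 2)).comp (by fun_prop)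
    exact h1.mul h2
  have hC1 : ContDiff ℝ 1 (deriv χ) := by
    have : ContDiff ℝ (1 + 1) χ := by simpa [one_add_one_eq_two] using hC
    exact (contDiff_succ_iff_deriv.1 this).2.2
  have hC2 : Continuous (deriv (deriv χ)) := hC1.continuous_deriv le_rfl
  have d1 : ∀ ξ, HasDerivAt χ (deriv χ ξ) ξ := fun ξ =>
    (hC.differentiable (by norm_num) ξ).hasDerivAt
  have d2 : ∀ ξ, HasDerivAt (deriv χ) (deriv (deriv χ) ξ) ξ := fun ξ =>
    (hC1.differentiable (by norm_num) ξ).hasDerivAt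
  have z0l : ∀ ξ ∈ Iic p, χ ξ = 0 := by
    intro ξ hξ
    have : (ξ - p) / (p1 - p) ≤ 0 := div_nonpos_of_nonpos_of_nonneg (by simpa using hξ) (by linarith)
    simp [hχ, Real.smoothTransition.zero_of_nonpos this]
  have z0r : ∀ ξ ∈ Ici q, χ ξ = 0 := by
    intro ξ hξ
    have : (q - ξ) / (q - q1) ≤ 0 := div_nonpos_of_nonpos_of_nonneg (by simpa using hξ) (by linarith)
    simp [hχ, Real.smoothTransition.zero_of_nonpos this]
  have one : ∀ ξ ∈ Icc p1 q1, χ ξ = 1 := by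
    intro ξ hξ
    have h1 : 1 ≤ (ξ - p) / (p1 - p) := by
      rw [one_le_div (by linarith)]; linarith [hξ.1]
    have h2 : 1 ≤ (q - ξ) / (q - q1) := by
      rw [one_le_div (by linarith)]; linarith [hξ.2]
    simp [hχ, Real.smoothTransition.one_of_one_le h1, Real.smoothTransition.one_of_one_le h2]
  have sl : Iic p ⊆ closure (interior (Iic p)) := by simp
  have sr : Ici q ⊆ closure (interior (Ici q)) := by simp
  have sm : Icc p1 q1 ⊆ closure (interior (Icc p1 q1)) := by
    rw [interior_Icc, closure_Ioo hpq.ne]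
  have z1l := deriv_zero_of_const sl d1 hC1.continuous z0l
  have z1r := deriv_zero_of_const sr d1 hC1.continuous z0r
  have v1 := deriv_zero_of_const sm d1 hC1.continuous one
  have z2l := deriv_zero_of_const sl d2 hC2 z1l
  have z2r := deriv_zero_of_const sr d2 hC2 z1r
  have v2 := deriv_zero_of_const sm d2 hC2 v1
  obtain ⟨X1, hX1⟩ := (isCompact_Icc (a := p) (b := q)).exists_bound_of_continuousOn
    hC1.continuous.continuousOn
  obtain ⟨X2, hX2⟩ := (isCompact_Icc (a := p) (b := q)).exists_bound_of_continuousOn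
    hC2.continuousOn
  refine ⟨χ, deriv χ, deriv (deriv χ), max 0 (max X1 X2), ⟨d1, d2, hC2, ?_, ?_⟩, le_max_left _ _,
    one, ?_, ?_, ?_, v1, v2⟩
  · intro ξ hξ
    rcases le_or_gt ξ p with h1 | h1
    · exact z0l ξ h1
    · rcases le_or_gt q ξ with h2 | h2
      · exact z0r ξ h2
      · exact (hξ ⟨h1, h2⟩).elim
  · intro ξ hξ
    rcases le_or_gt ξ p with h1 | h1
    · exact z1l ξ h1
    · rcases le_or_gt q ξ with h2 | h2
      · exact z1r ξ h2
      · exact (hξ ⟨h1, h2⟩).elim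
  · intro ξ
    rw [abs_of_nonneg (mul_nonneg (Real.smoothTransition.nonneg _) (Real.smoothTransition.nonneg _))]
    exact mul_le_one₀ (Real.smoothTransition.le_one _) (Real.smoothTransition.nonneg _)
      (Real.smoothTransition.le_one _)
  · intro ξ
    rcases le_or_gt ξ p with h1 | h1
    · rw [z1l ξ h1]; simp
    · rcases le_or_gt q ξ with h2 | h2
      · rw [z1r ξ h2]; simp
      · exact (hX1 ξ ⟨h1.le, h2.le⟩).trans ((le_max_left _ _).trans (le_max_right _ _))
  · intro ξ
    rcases le_or_gt ξ p with h1 | h1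
    · rw [z2l ξ h1]; simp
    · rcases le_or_gt q ξ with h2 | h2
      · rw [z2r ξ h2]; simp
      · exact (hX2 ξ ⟨h1.le, h2.le⟩).trans ((le_max_right _ _).trans (le_max_right _ _))

section
variable {E : Type*} [NormedAddCommGroup E] [InnerProductSpace ℂ E] [CompleteSpace E]
    {ι A : ℂ} {h : ℝ}
    {p p1 q1 q Nc X : ℝ} {χ χ1 χ2 : ℝ → ℝ}
    {w wx wxx wt : ℝ → ℝ → E}

theorem Setup.all_good {j0 j1 : ℝ}
    (U : Setup ι A h p p1 q1 q Nc X χ χ1 χ2 (Icc j0 j1) w wx wxx wt) :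
    ∀ t ∈ Ioo j0 j1, Good p q w wt t := by
  have Sl := U.sol
  have hpq := U.pq
  by_contra hcon
  push Not at hcon
  obtain ⟨t0, ht0, hb0⟩ := hcon
  set B : Set ℝ := Ioo j0 j1 ∩ {t | Good p q w wt t}ᶜ with hB
  have hlc : IsLocallyClosed B := ⟨_, _, isOpen_Ioo, isOpen_good.isClosed_compl, rfl⟩
  haveI := hlc.locallyCompactSpace
  haveI : Nonempty B := ⟨⟨t0, ht0, hb0⟩⟩
  obtain ⟨n, ⟨⟨b, hbB⟩, hbi⟩⟩ := nonempty_interior_of_iUnion_of_closed (X := B)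
    (f := fun n : ℕ => ((↑) : B → ℝ) ⁻¹' (HH p q w wxx wt (n : ℝ)))
    (fun n => (Sl.closed_HH _).preimage continuous_subtype_val) (by
      rw [eq_univ_iff_forall]
      rintro ⟨t, ht⟩
      obtain ⟨N1, hN1⟩ := (isCompact_Icc (a := p) (b := q)).exists_bound_of_continuousOn
        (Sl.cw t).continuousOn
      obtain ⟨N2, hN2⟩ := (isCompact_Icc (a := p) (b := q)).exists_bound_of_continuousOn
        (Sl.cxx t).continuousOn
      obtain ⟨N3, hN3⟩ := (isCompact_Icc (a := p) (b := q)).exists_bound_of_continuousOn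
        (Sl.cts t).continuousOn
      obtain ⟨n, hn⟩ := exists_nat_ge (max N1 (max N2 N3))
      refine mem_iUnion.2 ⟨n, fun ξ hξ => ⟨?_, ?_, ?_⟩⟩
      · exact (hN1 ξ hξ).trans ((le_max_left _ _).trans hn)
      · exact (hN2 ξ hξ).trans (((le_max_left _ _).trans (le_max_right _ _)).trans hn)
      · exact (hN3 ξ hξ).trans (((le_max_right _ _).trans (le_max_right _ _)).trans hn))
  have hbn := mem_interior_iff_mem_nhds.1 hbi
  rw [nhds_subtype_eq_comap, mem_comap] at hbn
  obtain ⟨V, hV, hVs⟩ := hbn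
  obtain ⟨ε, hε, hεV⟩ := Metric.mem_nhds_iff.1 (inter_mem hV (isOpen_Ioo.mem_nhds hbB.1))
  have hqp : 0 ≤ q - p := by linarith
  obtain ⟨T, hT0, hT1, hT⟩ := small_time (‖A‖ * (q - p) + |h| * AA A p q Nc n)
    (by unfold AA; positivity)
  set δ := min (ε / 2) (T / 2) with hδ
  have hδ0 : 0 < δ := lt_min (by linarith) (by linarith)
  have hδε : δ ≤ ε / 2 := min_le_left _ _
  have hδT : δ ≤ T / 2 := min_le_right _ _
  have hmem : ∀ t ∈ Icc (b - δ) (b + δ), t ∈ V ∩ Ioo j0 j1 := fun t ht => hεV (by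
    rw [Metric.mem_ball, Real.dist_eq, abs_lt]; constructor <;> linarith [ht.1, ht.2])
  refine hbB.2 (U.chain_good (N := n) (i0 := b - δ) (i1 := b + δ)
    (fun t ht => Ioo_subset_Icc_self (hmem t ht).2) (fun r hr => hT r (by linarith)) (by linarith)
    (fun t ht => ?_) ?_ ⟨by linarith, by linarith⟩)
  · by_cases hg : Good p q w wt t
    · exact Or.inr hg
    · exact Or.inl (hVs (a := ⟨t, (hmem t ht).2, hg⟩) (hmem t ht).1)
  · exact hVs (a := ⟨b, hbB⟩) (hmem b ⟨by linarith, by linarith⟩).1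

theorem Sol.collar (S : Sol ι A h w wx wxx wt) (j0 j1 : ℝ) {x0 x1 : ℝ} (hx : x0 < x1) :
    ∃ r0 r1 N, x0 < r0 ∧ r0 < r1 ∧ r1 < x1 ∧ 0 ≤ N ∧ ∀ ξ ∈ Icc r0 r1, ∀ t ∈ Icc j0 j1,
      ‖w ξ t‖ ≤ N ∧ ‖wx ξ t‖ ≤ N ∧ ‖wt ξ t‖ ≤ N ∧ ‖wxx ξ t‖ ≤ N := by
  set F : ℕ → Set ℝ := fun n => {ξ | ∀ t ∈ Icc j0 j1, ‖w ξ t‖ ≤ n ∧ ‖wt ξ t‖ ≤ n} with hF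
  have hcl : ∀ n, IsClosed (F n) := by
    intro n
    have : F n = ⋂ t ∈ Icc j0 j1, ({ξ | ‖w ξ t‖ ≤ n} ∩ {ξ | ‖wt ξ t‖ ≤ n}) := by
      ext ξ; simp [hF]
    rw [this]
    exact isClosed_biInter fun t _ => (isClosed_le (S.cw t).norm continuous_const).inter
      (isClosed_le (S.cts t).norm continuous_const)
  have hU : ⋃ n, F n = univ := by
    rw [eq_univ_iff_forall]
    intro ξ
    obtain ⟨N1, hN1⟩ := (isCompact_Icc (a := j0) (b := j1)).exists_bound_of_continuousOn
      (S.cwt ξ).continuousOn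
    obtain ⟨N2, hN2⟩ := (isCompact_Icc (a := j0) (b := j1)).exists_bound_of_continuousOn
      (S.ct ξ).continuousOn
    obtain ⟨n, hn⟩ := exists_nat_ge (max N1 N2)
    exact mem_iUnion.2 ⟨n, fun t ht => ⟨(hN1 t ht).trans ((le_max_left _ _).trans hn),
      (hN2 t ht).trans ((le_max_right _ _).trans hn)⟩⟩
  obtain ⟨z, hz, hzI⟩ := (dense_iUnion_interior_of_closed hcl hU).exists_mem_open isOpen_Ioo
    (nonempty_Ioo.2 hx)
  obtain ⟨n, hn⟩ := mem_iUnion.1 hz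
  obtain ⟨ε, hε, hεV⟩ := Metric.mem_nhds_iff.1
    (inter_mem (mem_interior_iff_mem_nhds.1 hn) (isOpen_Ioo.mem_nhds hzI))
  set r0 := z - ε / 2 with hr0
  set r1 := z + ε / 2 with hr1
  have hmem : ∀ ξ ∈ Icc r0 r1, ξ ∈ F n ∩ Ioo x0 x1 := fun ξ hξ => hεV (by
    rw [Metric.mem_ball, Real.dist_eq, abs_lt]; constructor <;> linarith [hξ.1, hξ.2])
  have hr : r0 < r1 := by linarith
  set N2 : ℝ := n + (‖A‖ + |h| * (n:ℝ) ^ 2) * n with hN2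
  have hxxb : ∀ ξ ∈ Icc r0 r1, ∀ t ∈ Icc j0 j1, ‖wxx ξ t‖ ≤ N2 := by
    intro ξ hξ t ht
    obtain ⟨h1, h2⟩ := (hmem ξ hξ).1 t ht
    have hi : ‖-ι‖ = 1 := by rcases S.hι with h | h <;> simp [h]
    rw [S.wxx_eq, norm_smul, hi, one_mul]
    refine (norm_add_le _ _).trans ?_
    rw [norm_smul]
    have h3 : ‖A + Complex.I * (h * ‖w ξ t‖ ^ 2 : ℝ)‖ ≤ ‖A‖ + |h| * (n:ℝ) ^ 2 := by
      refine (norm_add_le _ _).trans ?_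
      rw [norm_mul, Complex.norm_I, one_mul, Complex.norm_real, Real.norm_eq_abs, abs_mul,
        abs_of_nonneg (sq_nonneg ‖w ξ t‖)]
      gcongr
    rw [hN2]
    gcongr
  have hN20 : 0 ≤ N2 := by positivity
  set N1 := (2 * n + N2 * (r1 - r0) * (r1 - r0)) / (r1 - r0) with hN1
  have hN10 : 0 ≤ N1 := by
    have : 0 ≤ r1 - r0 := by linarith
    positivity
  have hxb : ∀ ξ ∈ Icc r0 r1, ∀ t ∈ Icc j0 j1, ‖wx ξ t‖ ≤ N1 := by
    intro ξ hξ t ht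
    have e1 : ∀ x ∈ Icc r0 r1, ‖wx x t - wx ξ t‖ ≤ N2 * (r1 - r0) := by
      intro x hx
      have := (convex_Icc r0 r1).norm_image_sub_le_of_norm_hasDerivWithin_le
        (f := fun ξ => wx ξ t) (f' := fun ξ => wxx ξ t)
        (fun y _ => (S.hxx y t).hasDerivWithinAt) (fun y hy => hxxb y hy t ht) hξ hx
      refine this.trans ?_
      gcongr
      rw [Real.norm_eq_abs, abs_le]; constructor <;> linarith [hx.1, hx.2, hξ.1, hξ.2]
    have e2 : ‖(w r1 t - (r1 - r0) • wx ξ t) - (w r0 t - (r0 - r0) • wx ξ t)‖ ≤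
        N2 * (r1 - r0) * (r1 - r0) := by
      refine norm_image_sub_le_of_norm_deriv_le_segment' (f := fun x => w x t - (x - r0) • wx ξ t)
        (f' := fun x => wx x t - wx ξ t) (fun x _ => ?_)
        (fun x hx => e1 x ⟨hx.1, hx.2.le⟩) r1 (right_mem_Icc.2 hr.le)
      have := (S.hx x t).sub (((hasDerivAt_id x).sub_const r0).smul_const (wx ξ t))
      exact (this.congr_deriv (by simp)).hasDerivWithinAt
    have e3 : ‖(r1 - r0) • wx ξ t‖ ≤ 2 * n + N2 * (r1 - r0) * (r1 - r0) := by
      have h1 := ((hmem r1 (right_mem_Icc.2 hr.le)).1 t ht).1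
      have h0 := ((hmem r0 (left_mem_Icc.2 hr.le)).1 t ht).1
      calc ‖(r1 - r0) • wx ξ t‖ = ‖(w r1 t - w r0 t) -
            ((w r1 t - (r1 - r0) • wx ξ t) - (w r0 t - (r0 - r0) • wx ξ t))‖ := by
              congr 1; module
        _ ≤ (‖w r1 t‖ + ‖w r0 t‖) + _ := (norm_sub_le _ _).trans (add_le_add (norm_sub_le _ _) e2)
        _ ≤ _ := by linarith
    rw [norm_smul, Real.norm_of_nonneg (by linarith)] at e3
    rw [hN1, le_div_iff₀ (by linarith)]
    linarith
  have hn0 : (0:ℝ) ≤ n := Nat.cast_nonneg n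
  refine ⟨r0, r1, n + N1 + N2, (hmem r0 (left_mem_Icc.2 hr.le)).2.1, hr,
    (hmem r1 (right_mem_Icc.2 hr.le)).2.2, by positivity, fun ξ hξ t ht => ⟨?_, ?_, ?_, ?_⟩⟩
  · linarith [((hmem ξ hξ).1 t ht).1]
  · linarith [hxb ξ hξ t ht]
  · linarith [((hmem ξ hξ).1 t ht).2]
  · linarith [hxxb ξ hξ t ht]

/-- Around each point of space and for each time window there is a good setup. -/
theorem Sol.setup_exists (S : Sol ι A h w wx wxx wt) (j0 j1 x : ℝ) :
    ∃ (p p1 q1 q Nc X : ℝ) (χ χ1 χ2 : ℝ → ℝ),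
      Setup ι A h p p1 q1 q Nc X χ χ1 χ2 (Icc j0 j1) w wx wxx wt ∧ x ∈ Ioo p1 q1 ∧
      ∀ t ∈ Icc j0 j1, ∀ ξ ∈ Icc p p1 ∪ Icc q1 q, ‖wxx ξ t‖ ≤ Nc := by
  obtain ⟨p, p1, N1, -, hp, hp1, hN1, b1⟩ := S.collar j0 j1 (x0 := x - 1) (x1 := x) (by linarith)
  obtain ⟨q1, q, N2, hq1, hq, -, hN2, b2⟩ := S.collar j0 j1 (x0 := x) (x1 := x + 1) (by linarith)
  obtain ⟨χ, χ1, χ2, X, hcut, hX, one, c0, c1, c2, v1, v2⟩ :=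
    cutoff_exists hp (hp1.trans hq1) hq
  have key : ∀ t ∈ Icc j0 j1, ∀ ξ ∈ Icc p p1 ∪ Icc q1 q, ‖w ξ t‖ ≤ N1 + N2 ∧
      ‖wx ξ t‖ ≤ N1 + N2 ∧ ‖wt ξ t‖ ≤ N1 + N2 ∧ ‖wxx ξ t‖ ≤ N1 + N2 := by
    intro t ht ξ hξ
    rcases hξ with hξ | hξ
    · obtain ⟨e1, e2, e3, e4⟩ := b1 ξ hξ t ht
      exact ⟨by linarith, by linarith, by linarith, by linarith⟩
    · obtain ⟨e1, e2, e3, e4⟩ := b2 ξ hξ t ht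
      exact ⟨by linarith, by linarith, by linarith, by linarith⟩
  refine ⟨p, p1, q1, q, N1 + N2, X, χ, χ1, χ2, ?_, ⟨hp1, hq1⟩,
    fun t ht ξ hξ => (key t ht ξ hξ).2.2.2⟩
  exact
    { sol := S, cut := hcut, hp := hp, hpq1 := hp1.trans hq1, hq := hq, hNc := by linarith, hX := hX
      one := one, b0 := c0, b1 := c1, b2 := c2, v1 := v1, v2 := v2
      cw := fun t ht ξ hξ => (key t ht ξ hξ).1
      cwx := fun t ht ξ hξ => (key t ht ξ hξ).2.1
      cwt := fun t ht ξ hξ => (key t ht ξ hξ).2.2.1 }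

end

open Set Filter Topology MeasureTheory Asymptotics
set_option linter.unusedSectionVars false

section
variable {E : Type*} [NormedAddCommGroup E] [InnerProductSpace ℂ E] [CompleteSpace E]
    {ι A : ℂ} {h : ℝ}
    {p p1 q1 q Nc X : ℝ} {χ χ1 χ2 : ℝ → ℝ}
    {w wx wxx wt : ℝ → ℝ → E}

theorem lipG {B : ℝ} {z1 z2 : E} (h1 : ‖z1‖ ≤ B) (h2 : ‖z2‖ ≤ B) :
    ‖(-(A + Complex.I * (h * ‖z1‖ ^ 2 : ℝ))) • z1 - (-(A + Complex.I * (h * ‖z2‖ ^ 2 : ℝ))) • z2‖ ≤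
      (‖A‖ + 3 * |h| * B ^ 2) * ‖z1 - z2‖ := by
  have hB : 0 ≤ B := (norm_nonneg _).trans h1
  have e : (-(A + Complex.I * (h * ‖z1‖ ^ 2 : ℝ))) • z1 - (-(A + Complex.I * (h * ‖z2‖ ^ 2 : ℝ))) • z2
      = (-(A + Complex.I * (h * ‖z1‖ ^ 2 : ℝ))) • (z1 - z2)
        + (-(Complex.I * (h * (‖z1‖ ^ 2 - ‖z2‖ ^ 2) : ℝ))) • z2 := by
    push_cast; module
  rw [e]
  have n1 : ‖(-(A + Complex.I * (h * ‖z1‖ ^ 2 : ℝ)))‖ ≤ ‖A‖ + |h| * B ^ 2 := by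
    rw [norm_neg]
    refine (norm_add_le _ _).trans ?_
    rw [norm_mul, Complex.norm_I, one_mul, Complex.norm_real, Real.norm_eq_abs, abs_mul,
      abs_of_nonneg (sq_nonneg ‖z1‖)]
    gcongr
  have n2 : ‖(-(Complex.I * (h * (‖z1‖ ^ 2 - ‖z2‖ ^ 2) : ℝ)))‖ ≤ |h| * (‖z1 - z2‖ * (2 * B)) := by
    rw [norm_neg, norm_mul, Complex.norm_I, one_mul, Complex.norm_real, Real.norm_eq_abs, abs_mul]
    gcongr
    have : ‖z1‖ ^ 2 - ‖z2‖ ^ 2 = (‖z1‖ - ‖z2‖) * (‖z1‖ + ‖z2‖) := by ring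
    rw [this, abs_mul, abs_of_nonneg (by positivity : 0 ≤ ‖z1‖ + ‖z2‖)]
    have := abs_norm_sub_norm_le z1 z2
    gcongr
    linarith
  calc _ ≤ ‖(-(A + Complex.I * (h * ‖z1‖ ^ 2 : ℝ)))‖ * ‖z1 - z2‖ +
        ‖(-(Complex.I * (h * (‖z1‖ ^ 2 - ‖z2‖ ^ 2) : ℝ)))‖ * ‖z2‖ := by
        refine (norm_add_le _ _).trans ?_
        rw [norm_smul, norm_smul]
    _ ≤ (‖A‖ + |h| * B ^ 2) * ‖z1 - z2‖ + |h| * (‖z1 - z2‖ * (2 * B)) * B := by gcongr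
    _ = _ := by ring

theorem L1D.shift {t k Q : ℝ} (hL : L1D p q w wt t) (hk : 0 ≤ k) (hpQ : p ≤ Q) (hQ : Q + k ≤ q)
    (hw : ∀ t, Continuous fun ξ => w ξ t) (hwt : Continuous fun ξ => wt ξ t) (c : ℂ) :
    L1D p Q (fun ξ t => c • (w (ξ + k) t - w ξ t)) (fun ξ t => c • (wt (ξ + k) t - wt ξ t)) t := by
  unfold L1D at *
  refine IsBigO.trans_isLittleO (IsBigO.of_bound (2 * ‖c‖) (Eventually.of_forall fun σ => ?_)) hL
  set R : ℝ → E := fun ξ => w ξ σ - w ξ t - (σ - t) • wt ξ t with hR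
  have cR : Continuous R := ((hw σ).sub (hw t)).sub (hwt.const_smul _)
  have hRn : ∀ a b, IntervalIntegrable (fun ξ => ‖R ξ‖) volume a b := fun a b =>
    cR.norm.intervalIntegrable _ _
  have cRk : Continuous fun ξ => R (ξ + k) := cR.comp (by fun_prop)
  have i1 : ∫ ξ in p..Q, ‖R ξ‖ ≤ ∫ ξ in p..q, ‖R ξ‖ :=
    intervalIntegral.integral_mono_interval le_rfl hpQ (by linarith)
      (ae_of_all _ fun ξ => norm_nonneg _) (hRn _ _)
  have i2 : ∫ ξ in p..Q, ‖R (ξ + k)‖ ≤ ∫ ξ in p..q, ‖R ξ‖ := by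
    rw [intervalIntegral.integral_comp_add_right (fun ξ => ‖R ξ‖)]
    exact intervalIntegral.integral_mono_interval (by linarith) (by linarith) hQ
      (ae_of_all _ fun ξ => norm_nonneg _) (hRn _ _)
  have e : ∀ ξ, c • (w (ξ + k) σ - w ξ σ) - c • (w (ξ + k) t - w ξ t)
      - (σ - t) • c • (wt (ξ + k) t - wt ξ t) = c • (R (ξ + k) - R ξ) := by
    intro ξ; rw [smul_comm (σ - t) c]; simp only [hR]; module
  simp only [e]
  have i3 : ∫ ξ in p..Q, ‖c • (R (ξ + k) - R ξ)‖ ≤ ∫ ξ in p..Q, ‖c‖ * (‖R (ξ + k)‖ + ‖R ξ‖) := by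
    refine intervalIntegral.integral_mono_on hpQ (Continuous.intervalIntegrable (by fun_prop) _ _)
      (Continuous.intervalIntegrable (by fun_prop) _ _) fun ξ _ => ?_
    rw [norm_smul]
    gcongr
    exact norm_sub_le _ _
  rw [intervalIntegral.integral_const_mul, intervalIntegral.integral_add
    (cRk.norm.intervalIntegrable _ _) (hRn _ _)] at i3
  rw [Real.norm_of_nonneg (intervalIntegral.integral_nonneg hpQ fun _ _ => norm_nonneg _),
    Real.norm_of_nonneg (intervalIntegral.integral_nonneg (by linarith) fun _ _ => norm_nonneg _)]
  nlinarith [norm_nonneg c]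

theorem Sol.linDiff (S : Sol ι A h w wx wxx wt) (k : ℝ) (c : ℂ) :
    LinSol ι (fun ξ t => c • (w (ξ + k) t - w ξ t)) (fun ξ t => c • (wx (ξ + k) t - wx ξ t))
      (fun ξ t => c • (wxx (ξ + k) t - wxx ξ t)) (fun ξ t => c • (wt (ξ + k) t - wt ξ t))
      (fun ξ t => c • ((-(A + Complex.I * (h * ‖w (ξ + k) t‖ ^ 2 : ℝ))) • w (ξ + k) t
        - (-(A + Complex.I * (h * ‖w ξ t‖ ^ 2 : ℝ))) • w ξ t)) where
  hι := S.hι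
  hy ξ t := by
    have := (((S.hx (ξ + k) t).comp_add_const ξ k).sub (S.hx ξ t)).const_smul c
    exact this
  hyx ξ t := by
    have := (((S.hxx (ξ + k) t).comp_add_const ξ k).sub (S.hxx ξ t)).const_smul c
    exact this
  cxx t := (((S.cxx t).comp (continuous_add_const k)).sub (S.cxx t)).const_smul c
  ct t := (((S.cts t).comp (continuous_add_const k)).sub (S.cts t)).const_smul c
  eq ξ t := by
    simp only [S.eq]
    module

/-- difference quotients are bounded by the derivative -/
theorem dq_le {f f' : ℝ → E} {k ξ M : ℝ} (hk : 0 < k) (hd : ∀ ξ, HasDerivAt f (f' ξ) ξ)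
    (hM : ∀ x ∈ Icc ξ (ξ + k), ‖f' x‖ ≤ M) : ‖((k⁻¹ : ℝ) : ℂ) • (f (ξ + k) - f ξ)‖ ≤ M := by
  have := norm_image_sub_le_of_norm_deriv_le_segment' (f := f) (f' := f') (C := M)
    (a := ξ) (b := ξ + k) (fun x _ => (hd x).hasDerivWithinAt)
    (fun x hx => hM x (Ico_subset_Icc_self hx)) (ξ + k) (right_mem_Icc.2 (by linarith))
  rw [norm_smul, Complex.norm_real, norm_inv, Real.norm_of_nonneg hk.le, inv_mul_le_iff₀ hk]
  calc _ ≤ _ := this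
    _ = _ := by ring

end

open Set Filter Topology MeasureTheory Asymptotics
set_option linter.unusedSectionVars false

section
variable {E : Type*} [NormedAddCommGroup E] [InnerProductSpace ℂ E] [CompleteSpace E]
    {ι A : ℂ} {h : ℝ}
    {p p1 q1 q Nc X : ℝ} {χ χ1 χ2 : ℝ → ℝ}
    {w wx wxx wt : ℝ → ℝ → E}

set_option maxHeartbeats 2000000 in
theorem Setup.kl_dq {j0 j1 i0 i1 : ℝ}
    (U : Setup ι A h p p1 q1 q Nc X χ χ1 χ2 (Icc j0 j1) w wx wxx wt)
    (hxx : ∀ t ∈ Icc j0 j1, ∀ ξ ∈ Icc p p1 ∪ Icc q1 q, ‖wxx ξ t‖ ≤ Nc)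
    (h0 : j0 < i0) (h01 : i0 < i1) (h1 : i1 < j1) :
    ∃ (Q C k0 : ℝ) (θ : ℝ → ℝ), p ≤ Q ∧ Q + k0 ≤ q ∧ 0 < k0 ∧ Continuous θ ∧
      (∀ ξ ∈ Icc p1 q1, θ ξ = 1) ∧
      ∀ k ∈ Ioc 0 k0, ∀ a τ, i0 ≤ a → a < τ → τ ≤ i1 → ∀ ξ0,
      ‖((√(4 * Real.pi) : ℝ) : ℂ) • (θ ξ0 : ℂ) • ((k⁻¹ : ℝ) : ℂ) • (w (ξ0 + k) τ - w ξ0 τ)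
      - ∫ ξ in p..Q, ((θ ξ : ℂ) * kap (ι * (τ - a : ℝ)) (ξ - ξ0)) •
          ((k⁻¹ : ℝ) : ℂ) • (w (ξ + k) a - w ξ a)‖ ≤ 2 * C * √(τ - a) := by
  have Sl := U.sol
  have hNc := U.hNc
  have hp := U.hp
  have hpq1 := U.hpq1
  have hq := U.hq
  have hgood := U.all_good
  have hIJ : Icc i0 i1 ⊆ Icc j0 j1 := Icc_subset_Icc h0.le h1.le
  obtain ⟨B, G⟩ := good_seg (J := Icc j0 j1) h01.le hIJ
    (fun t ht => hgood t ⟨by linarith [ht.1], by linarith [ht.2]⟩)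
  set P := (p + p1) / 2 with hP
  set Q := (q1 + q) / 2 with hQ
  set k0 := min ((p1 - p) / 2) ((q - q1) / 2) with hk0
  have hk0p : 0 < k0 := lt_min (by linarith) (by linarith)
  have hk01 : k0 ≤ (p1 - p) / 2 := min_le_left _ _
  have hk02 : k0 ≤ (q - q1) / 2 := min_le_right _ _
  have hpP : p < P := by linarith
  have hPp : P < p1 := by linarith
  have hqQ : q1 < Q := by linarith
  have hpQ : p ≤ Q := by linarith
  have hB0 : 0 ≤ B := (norm_nonneg _).trans (G.bd p ⟨le_rfl, by linarith⟩ i0 ⟨le_rfl, h01.le⟩)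
  obtain ⟨θ, θ1, θ2, Y, hcut, hY, one, c0, c1, c2, v1, v2⟩ :=
    cutoff_exists hpP (hPp.trans hpq1) hqQ
  obtain ⟨M0, hM0⟩ := (isCompact_Icc (a := p) (b := q)).exists_bound_of_continuousOn
    (Sl.lin.cyx i0).continuousOn
  set Λ := ‖A‖ + 3 * |h| * B ^ 2 with hΛ
  have hΛ0 : 0 ≤ Λ := by positivity
  set M := Real.exp ((4 * Nc ^ 2 + 2 * Λ) * (i1 - i0)) * (1 + (Q - p) * M0 ^ 2) with hM
  set C := Λ * ((Q - p) + M) + 3 * Y * Nc * (Q - p) with hC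
  refine ⟨Q, C, k0, θ, hpQ, by linarith, hk0p, hcut.c0, fun ξ hξ => one ξ ⟨by linarith [hξ.1], hξ.2⟩,
    ?_⟩
  intro k hk a τ ha haτ hτ ξ0
  obtain ⟨hkp, hkk⟩ := hk
  set c : ℂ := ((k⁻¹ : ℝ) : ℂ) with hc
  have L := Sl.linDiff k c
  have hin : ∀ ξ ∈ Icc p Q, ξ ∈ Icc p q ∧ ξ + k ∈ Icc p q := fun ξ hξ =>
    ⟨⟨hξ.1, by linarith [hξ.2]⟩, by linarith [hξ.1], by linarith [hξ.2]⟩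
  have hcol : ∀ ξ ∈ Icc p P ∪ Icc q1 Q, ∀ x ∈ Icc ξ (ξ + k), x ∈ Icc p p1 ∪ Icc q1 q := by
    intro ξ hξ x hx
    rcases hξ with hξ | hξ
    · exact Or.inl ⟨hξ.1.trans hx.1, by linarith [hx.2, hξ.2]⟩
    · exact Or.inr ⟨hξ.1.trans hx.1, by linarith [hx.2, hξ.2]⟩
  have yb : ∀ t ∈ Icc i0 i1, ∀ ξ ∈ Icc p P ∪ Icc q1 Q, ‖c • (w (ξ + k) t - w ξ t)‖ ≤ Nc :=
    fun t ht ξ hξ => dq_le (f := fun ξ => w ξ t) hkp (fun ξ => Sl.hx ξ t)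
      (fun x hx => U.cwx t (hIJ ht) x (hcol ξ hξ x hx))
  have yxb : ∀ t ∈ Icc i0 i1, ∀ ξ ∈ Icc p P ∪ Icc q1 Q, ‖c • (wx (ξ + k) t - wx ξ t)‖ ≤ Nc :=
    fun t ht ξ hξ => dq_le (f := fun ξ => wx ξ t) hkp (fun ξ => Sl.hxx ξ t)
      (fun x hx => hxx t (hIJ ht) x (hcol ξ hξ x hx))
  have Fb : ∀ t ∈ Icc i0 i1, ∀ ξ ∈ Icc p Q,
      ‖c • ((-(A + Complex.I * (h * ‖w (ξ + k) t‖ ^ 2 : ℝ))) • w (ξ + k) t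
        - (-(A + Complex.I * (h * ‖w ξ t‖ ^ 2 : ℝ))) • w ξ t)‖ ≤ Λ * ‖c • (w (ξ + k) t - w ξ t)‖ := by
    intro t ht ξ hξ
    rw [norm_smul, norm_smul]
    have := lipG (A := A) (h := h) (G.bd _ (hin ξ hξ).2 t ht) (G.bd _ (hin ξ hξ).1 t ht)
    calc _ ≤ ‖c‖ * (Λ * ‖w (ξ + k) t - w ξ t‖) := by gcongr
      _ = _ := by ring
  have hLy : ∀ t ∈ Icc i0 i1, L1D p Q (fun ξ t => c • (w (ξ + k) t - w ξ t))
      (fun ξ t => c • (wt (ξ + k) t - wt ξ t)) t := fun t ht =>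
    (hgood t ⟨by linarith [ht.1], by linarith [ht.2]⟩).l1d.shift hkp.le hpQ (by linarith)
      Sl.cw (Sl.cts t) c
  have yB : ∀ ξ ∈ Icc p Q, ∀ t ∈ Icc i0 i1, ‖c • (w (ξ + k) t - w ξ t)‖ ≤ ‖c‖ * (B + B) := by
    intro ξ hξ t ht
    rw [norm_smul]
    gcongr
    exact (norm_sub_le _ _).trans
      (add_le_add (G.bd _ (hin ξ hξ).2 t ht) (G.bd _ (hin ξ hξ).1 t ht))
  have hpm : p ∈ Icc p P ∪ Icc q1 Q := Or.inl ⟨le_rfl, hpP.le⟩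
  have hQm : Q ∈ Icc p P ∪ Icc q1 Q := Or.inr ⟨hqQ.le, le_rfl⟩
  -- uniform energy bound
  have hE : ∀ t ∈ Icc i0 i1, ∫ ξ in p..Q, ‖c • (w (ξ + k) t - w ξ t)‖ ^ 2 ≤ M := by
    intro t ht
    have hsub : Icc i0 t ⊆ Icc i0 i1 := Icc_subset_Icc_right ht.2
    have key := (energy_ineq (C := 4 * Nc ^ 2 + 2 * Λ) (δ := 1) hpQ ht.1 one_pos
      (iota_re Sl.hι) L.hy L.hyx L.cxx L.ct L.eq
      (fun s hs => hLy s (hsub (Ioo_subset_Icc_self hs)))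
      (mass_cont hpQ L.cy (fun ξ => ((Sl.cwt (ξ + k)).sub (Sl.cwt ξ)).const_smul c)
        (fun ξ hξ s hs => yB ξ hξ s (hsub hs)))
      (fun s hs => by
        have hsI := hsub (Ioo_subset_Icc_self hs)
        have b1 := yb s hsI p hpm
        have b2 := yb s hsI Q hQm
        have b3 := yxb s hsI p hpm
        have b4 := yxb s hsI Q hQm
        have cy := L.cy s
        have cF := L.cF s
        have hQ0 : 0 ≤ ∫ ξ in p..Q, ‖c • (w (ξ + k) s - w ξ s)‖ ^ 2 :=
          intervalIntegral.integral_nonneg hpQ (fun _ _ => by positivity)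
        have hI : |∫ ξ in p..Q, (inner ℂ (c • (w (ξ + k) s - w ξ s))
            (c • ((-(A + Complex.I * (h * ‖w (ξ + k) s‖ ^ 2 : ℝ))) • w (ξ + k) s
              - (-(A + Complex.I * (h * ‖w ξ s‖ ^ 2 : ℝ))) • w ξ s)) : ℂ).re| ≤
            ∫ ξ in p..Q, Λ * ‖c • (w (ξ + k) s - w ξ s)‖ ^ 2 := by
          rw [← Real.norm_eq_abs]
          refine intervalIntegral.norm_integral_le_of_norm_le hpQ (ae_of_all _ fun ξ hξ => ?_)
            (Continuous.intervalIntegrable (by fun_prop) _ _)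
          rw [Real.norm_eq_abs]
          refine (abs_rin_le _ _).trans ?_
          have := Fb s hsI ξ (Ioc_subset_Icc_self hξ)
          calc _ ≤ ‖c • (w (ξ + k) s - w ξ s)‖ * (Λ * ‖c • (w (ξ + k) s - w ξ s)‖) := by gcongr
            _ = _ := by ring
        rw [intervalIntegral.integral_const_mul] at hI
        rw [iota_norm Sl.hι, one_mul, one_mul]
        have h6 : ‖c • (w (Q + k) s - w Q s)‖ * ‖c • (wx (Q + k) s - wx Q s)‖ ≤ Nc ^ 2 := by
          rw [sq]; exact mul_le_mul b2 b4 (norm_nonneg _) hNc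
        have h7 : ‖c • (w (p + k) s - w p s)‖ * ‖c • (wx (p + k) s - wx p s)‖ ≤ Nc ^ 2 := by
          rw [sq]; exact mul_le_mul b1 b3 (norm_nonneg _) hNc
        nlinarith [sq_nonneg Nc, mul_nonneg (sq_nonneg Nc) hQ0])).1
    have hstart : ∫ ξ in p..Q, ‖c • (w (ξ + k) i0 - w ξ i0)‖ ^ 2 ≤ (Q - p) * M0 ^ 2 := by
      have cy := L.cy i0
      have : ∫ ξ in p..Q, ‖c • (w (ξ + k) i0 - w ξ i0)‖ ^ 2 ≤ ∫ ξ in p..Q, M0 ^ 2 := by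
        refine intervalIntegral.integral_mono_on hpQ
          (Continuous.intervalIntegrable (by fun_prop) _ _) (by simp) fun ξ hξ => ?_
        have : ‖c • (w (ξ + k) i0 - w ξ i0)‖ ≤ M0 :=
          dq_le (f := fun ξ => w ξ i0) hkp (fun ξ => Sl.hx ξ i0)
            (fun x hx => hM0 x ⟨hξ.1.trans hx.1, by linarith [hx.2, (hin ξ hξ).2.2]⟩)
        gcongr
      simpa using this
    have hexp : Real.exp ((4 * Nc ^ 2 + 2 * Λ) * (t - i0)) ≤
        Real.exp ((4 * Nc ^ 2 + 2 * Λ) * (i1 - i0)) := by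
      have := ht.2
      gcongr
    have hQ0 : 0 ≤ ∫ ξ in p..Q, ‖c • (w (ξ + k) i0 - w ξ i0)‖ ^ 2 :=
          intervalIntegral.integral_nonneg hpQ (fun _ _ => by positivity)
    have : Real.exp ((4 * Nc ^ 2 + 2 * Λ) * (t - i0)) *
        (1 + ∫ ξ in p..Q, ‖c • (w (ξ + k) i0 - w ξ i0)‖ ^ 2) ≤ M := by
      rw [hM]; gcongr
    linarith
  refine KL L hcut hpQ haτ (B := ‖c‖ * (B + B)) ?_ ?_ ?_ ?_ ξ0
  · exact fun t ht => hLy t ⟨by linarith [ht.1], by linarith [ht.2]⟩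
  · exact fun ξ hξ t ht => yB ξ hξ t ⟨by linarith [ht.1], by linarith [ht.2]⟩
  · exact fun ξ _ => (((Sl.cwt (ξ + k)).sub (Sl.cwt ξ)).const_smul c).continuousOn
  · intro t ht
    have htI : t ∈ Icc i0 i1 := ⟨by linarith [ht.1], by linarith [ht.2]⟩
    have cy := L.cy t
    have cyx := L.cyx t
    have cF := L.cF t
    have k0' := hcut.c0
    have k1' := hcut.c1
    have k2' := hcut.c2
    have hle : ∫ ξ in p..Q, ‖(θ ξ : ℂ) • (c • ((-(A + Complex.I * (h * ‖w (ξ + k) t‖ ^ 2 : ℝ))) •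
            w (ξ + k) t - (-(A + Complex.I * (h * ‖w ξ t‖ ^ 2 : ℝ))) • w ξ t))
          - ι • ((θ2 ξ : ℂ) • (c • (w (ξ + k) t - w ξ t))
            + (2 * (θ1 ξ : ℂ)) • (c • (wx (ξ + k) t - wx ξ t)))‖ ≤
        ∫ ξ in p..Q, (Λ * (1 + ‖c • (w (ξ + k) t - w ξ t)‖ ^ 2) + 3 * Y * Nc) := by
      refine intervalIntegral.integral_mono_on hpQ (Continuous.intervalIntegrable (by fun_prop) _ _)
        (Continuous.intervalIntegrable (by fun_prop) _ _) fun ξ hξ => ?_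
      have f1 := Fb t htI ξ hξ
      set y := c • (w (ξ + k) t - w ξ t) with hy
      set z := c • (wx (ξ + k) t - wx ξ t) with hz
      set F := c • ((-(A + Complex.I * (h * ‖w (ξ + k) t‖ ^ 2 : ℝ))) •
            w (ξ + k) t - (-(A + Complex.I * (h * ‖w ξ t‖ ^ 2 : ℝ))) • w ξ t) with hF
      have g1 : ‖(θ ξ : ℂ) • F‖ ≤ Λ * (1 + ‖y‖ ^ 2) := by
        rw [norm_smul, Complex.norm_real, Real.norm_eq_abs]
        have e1 := c0 ξ
        have e2 : ‖y‖ ≤ 1 + ‖y‖ ^ 2 := by nlinarith [sq_nonneg (‖y‖ - 1)]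
        calc |θ ξ| * ‖F‖ ≤ 1 * (Λ * ‖y‖) := by gcongr
          _ ≤ _ := by rw [one_mul]; gcongr
      have g2 : ‖ι • ((θ2 ξ : ℂ) • y + (2 * (θ1 ξ : ℂ)) • z)‖ ≤ 3 * Y * Nc := by
        rw [norm_smul, iota_norm Sl.hι, one_mul]
        by_cases hm : ξ ∈ Icc P q1
        · rw [v1 ξ hm, v2 ξ hm]
          simp only [Complex.ofReal_zero, zero_smul, mul_zero, add_zero, norm_zero]
          positivity
        · have hm' : ξ ∈ Icc p P ∪ Icc q1 Q := by
            rcases le_total ξ P with hh | hh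
            · exact Or.inl ⟨hξ.1, hh⟩
            · refine Or.inr ⟨?_, hξ.2⟩
              by_contra hcon
              exact hm ⟨hh, by linarith⟩
          have m1 : ‖y‖ ≤ Nc := yb t htI ξ hm'
          have m2 : ‖z‖ ≤ Nc := yxb t htI ξ hm'
          have e1 := c1 ξ
          have e2 := c2 ξ
          refine (norm_add_le _ _).trans ?_
          rw [norm_smul _ y, norm_smul _ z, norm_mul, Complex.norm_real, Complex.norm_real,
            Real.norm_eq_abs, Real.norm_eq_abs, Complex.norm_two]
          calc |θ2 ξ| * ‖y‖ + 2 * |θ1 ξ| * ‖z‖ ≤ Y * Nc + 2 * Y * Nc := by gcongr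
            _ = _ := by ring
      exact (norm_sub_le _ _).trans (add_le_add g1 g2)
    have hE' := hE t htI
    have hfin : ∫ ξ in p..Q, (Λ * (1 + ‖c • (w (ξ + k) t - w ξ t)‖ ^ 2) + 3 * Y * Nc) ≤ C := by
      have c3 : Continuous fun ξ => ‖c • (w (ξ + k) t - w ξ t)‖ ^ 2 := by fun_prop
      have hm := mul_le_mul_of_nonneg_left hE' hΛ0
      generalize hgf : (fun ξ => ‖c • (w (ξ + k) t - w ξ t)‖ ^ 2) = f at c3 hm
      have e : ∫ ξ in p..Q, (Λ * (1 + f ξ) + 3 * Y * Nc) =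
          Λ * ((Q - p) + ∫ ξ in p..Q, f ξ) + 3 * Y * Nc * (Q - p) := by
        rw [intervalIntegral.integral_add (Continuous.intervalIntegrable (by fun_prop) _ _) (by simp),
          intervalIntegral.integral_const_mul,
          intervalIntegral.integral_add (by simp) (Continuous.intervalIntegrable (by fun_prop) _ _),
          intervalIntegral.integral_const, intervalIntegral.integral_const, smul_eq_mul, smul_eq_mul]
        ring
      have e2 : ∫ ξ in p..Q, (Λ * (1 + ‖c • (w (ξ + k) t - w ξ t)‖ ^ 2) + 3 * Y * Nc) =
          ∫ ξ in p..Q, (Λ * (1 + f ξ) + 3 * Y * Nc) := by rw [← hgf]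
      rw [e2, e, hC]
      linarith
    exact hle.trans hfin

end

open Set Filter Topology MeasureTheory Asymptotics
set_option linter.unusedSectionVars false

section
variable {E : Type*} [NormedAddCommGroup E] [InnerProductSpace ℂ E] [CompleteSpace E]
    {ι A : ℂ} {h : ℝ}
    {p p1 q1 q Nc X : ℝ} {χ χ1 χ2 : ℝ → ℝ}
    {w wx wxx wt : ℝ → ℝ → E}

theorem kap_cont2 {ι : ℂ} (hι : ι = Complex.I ∨ ι = -Complex.I) {Y : Type*} [TopologicalSpace Y]
    {r x : Y → ℝ} (hr : Continuous r) (hx : Continuous x) (h0 : ∀ y, r y ≠ 0) :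
    Continuous fun y => kap (ι * (r y : ℂ)) (x y) :=
  kap_cont.comp_continuous (f := fun y => (ι * (r y : ℂ), x y)) (by fun_prop)
    (fun y => iota_slit hι (h0 y))

theorem dq_tendsto {f : ℝ → E} {f' : E} {ξ : ℝ} (hd : HasDerivAt f f' ξ) :
    Tendsto (fun k : ℝ => ((k⁻¹ : ℝ) : ℂ) • (f (ξ + k) - f ξ)) (𝓝[>] 0) (𝓝 f') := by
  have := hd.tendsto_slope_zero_right
  refine this.congr fun k => ?_
  rw [Complex.coe_smul]

theorem Setup.kl_wx {j0 j1 i0 i1 : ℝ}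
    (U : Setup ι A h p p1 q1 q Nc X χ χ1 χ2 (Icc j0 j1) w wx wxx wt)
    (hxx : ∀ t ∈ Icc j0 j1, ∀ ξ ∈ Icc p p1 ∪ Icc q1 q, ‖wxx ξ t‖ ≤ Nc)
    (h0 : j0 < i0) (h01 : i0 < i1) (h1 : i1 < j1) :
    ∃ (Q C : ℝ) (θ : ℝ → ℝ), Continuous θ ∧
      (∀ ξ ∈ Icc p1 q1, θ ξ = 1) ∧
      ∀ a τ, i0 ≤ a → a < τ → τ ≤ i1 → ∀ ξ0,
      ‖((√(4 * Real.pi) : ℝ) : ℂ) • (θ ξ0 : ℂ) • wx ξ0 τ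
      - ∫ ξ in p..Q, ((θ ξ : ℂ) * kap (ι * (τ - a : ℝ)) (ξ - ξ0)) • wx ξ a‖ ≤ 2 * C * √(τ - a) := by
  have Sl := U.sol
  obtain ⟨Q, C, k0, θ, hpQ, hQq, hk0, cθ, one, H⟩ := U.kl_dq hxx h0 h01 h1
  refine ⟨Q, C, θ, cθ, one, fun a τ ha haτ hτ ξ0 => ?_⟩
  have ck : Continuous fun ξ => kap (ι * ((τ - a : ℝ) : ℂ)) (ξ - ξ0) :=
    kap_cont2 Sl.hι (r := fun _ => τ - a) (x := fun ξ => ξ - ξ0) (by fun_prop) (by fun_prop)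
      (fun _ => by linarith)
  have ckθ : Continuous fun ξ => (θ ξ : ℂ) * kap (ι * ((τ - a : ℝ) : ℂ)) (ξ - ξ0) :=
    (Complex.continuous_ofReal.comp cθ).mul ck
  obtain ⟨M0, hM0⟩ := (isCompact_Icc (a := p) (b := q)).exists_bound_of_continuousOn
    (Sl.lin.cyx a).continuousOn
  have l1 : Tendsto (fun k : ℝ => ∫ ξ in p..Q, ((θ ξ : ℂ) * kap (ι * (τ - a : ℝ)) (ξ - ξ0)) •
          ((k⁻¹ : ℝ) : ℂ) • (w (ξ + k) a - w ξ a)) (𝓝[>] 0)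
      (𝓝 (∫ ξ in p..Q, ((θ ξ : ℂ) * kap (ι * (τ - a : ℝ)) (ξ - ξ0)) • wx ξ a)) := by
    refine intervalIntegral.tendsto_integral_filter_of_dominated_convergence
      (fun ξ => ‖(θ ξ : ℂ) * kap (ι * ((τ - a : ℝ) : ℂ)) (ξ - ξ0)‖ * M0) ?_ ?_ ?_ ?_
    · refine Eventually.of_forall fun k => Continuous.aestronglyMeasurable ?_
      exact ckθ.smul ((((Sl.cw a).comp (continuous_add_const k)).sub (Sl.cw a)).const_smul _)
    · filter_upwards [Ioc_mem_nhdsGT hk0] with k hk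
      refine ae_of_all _ fun ξ hξ => ?_
      rw [uIoc_of_le hpQ] at hξ
      rw [norm_smul]
      gcongr
      exact dq_le (f := fun ξ => w ξ a) hk.1 (fun ξ => Sl.hx ξ a)
            (fun x hx => hM0 x ⟨hξ.1.le.trans hx.1, by linarith [hx.2, hξ.2, hk.2]⟩)
    · exact Continuous.intervalIntegrable (ckθ.norm.mul continuous_const) _ _
    · exact ae_of_all _ fun ξ _ => (dq_tendsto (Sl.hx ξ a)).const_smul _
  have l2 := (((dq_tendsto (Sl.hx ξ0 τ)).const_smul (θ ξ0 : ℂ)).const_smul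
    ((√(4 * Real.pi) : ℝ) : ℂ)).sub l1
  refine le_of_tendsto l2.norm ?_
  filter_upwards [Ioc_mem_nhdsGT hk0] with k hk
  exact H k hk a τ ha haτ hτ ξ0

/-- The main regularity theorem: the space derivative is jointly continuous. -/
theorem Sol.wx_cont (S : Sol ι A h w wx wxx wt) : Continuous fun z : ℝ × ℝ => wx z.1 z.2 := by
  rw [continuous_iff_continuousAt]
  rintro ⟨x, t⟩
  obtain ⟨p, p1, q1, q, Nc, X, χ, χ1, χ2, U, hx, hxx⟩ := S.setup_exists (t - 2) (t + 2) x
  obtain ⟨Q, C, θ, cθ, one, H⟩ := U.kl_wx (i0 := t - 1) (i1 := t + 1) hxx (by linarith)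
    (by linarith) (by linarith)
  set s : ℂ := ((√(4 * Real.pi) : ℝ) : ℂ) with hs
  have hs0 : s ≠ 0 := by
    rw [hs]; norm_cast
    have : 0 < 4 * Real.pi := by positivity
    exact (Real.sqrt_pos.2 this).ne'
  have key : ContinuousAt (fun z : ℝ × ℝ => s • (θ z.1 : ℂ) • wx z.1 z.2) (x, t) := by
    rw [Metric.continuousAt_iff']
    intro ε hε
    -- choose the starting time
    have hlim : Tendsto (fun r : ℝ => 2 * C * √(2 * r)) (𝓝[>] 0) (𝓝 (2 * C * √(2 * 0))) :=
      (Continuous.tendsto (by fun_prop) 0).mono_left nhdsWithin_le_nhds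
    simp only [mul_zero, Real.sqrt_zero] at hlim
    obtain ⟨r, hr1, hr2, hr3⟩ := ((hlim.eventually_lt_const (show 0 < ε / 3 by linarith)).and
      (Ioc_mem_nhdsGT (show (0:ℝ) < 1/2 by norm_num))).exists
    set D : ℝ × ℝ → E := fun z => ∫ ξ in p..Q, ((θ ξ : ℂ) *
      kap (ι * (max (z.2 - (t - r)) (r / 2) : ℝ)) (ξ - z.1)) • wx ξ (t - r) with hD
    have cD : Continuous D := by
      refine intervalIntegral.continuous_parametric_intervalIntegral_of_continuous' ?_ p Q
      have h1 : Continuous fun y : (ℝ × ℝ) × ℝ =>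
          kap (ι * ((max (y.1.2 - (t - r)) (r / 2) : ℝ) : ℂ)) (y.2 - y.1.1) :=
        kap_cont2 S.hι (r := fun y : (ℝ × ℝ) × ℝ => max (y.1.2 - (t - r)) (r / 2))
          (x := fun y : (ℝ × ℝ) × ℝ => y.2 - y.1.1) (by fun_prop) (by fun_prop)
          (fun y => (lt_of_lt_of_le (by linarith) (le_max_right _ _)).ne')
      exact ((Complex.continuous_ofReal.comp (cθ.comp continuous_snd)).mul h1).smul
        ((S.lin.cyx (t - r)).comp continuous_snd)
    have hDb : ∀ z : ℝ × ℝ, z.2 ∈ Ioo (t - r / 2) (t + r) →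
        ‖s • (θ z.1 : ℂ) • wx z.1 z.2 - D z‖ < ε / 3 := by
      rintro ⟨ξ0, τ⟩ hτ
      simp only at hτ
      have e := H (t - r) τ (by linarith) (by linarith [hτ.1]) (by linarith [hτ.2]) ξ0
      have hm : max (τ - (t - r)) (r / 2) = τ - (t - r) := max_eq_left (by linarith [hτ.1])
      have hC : 2 * C * √(τ - (t - r)) ≤ max 0 (2 * C * √(2 * r)) := by
        rcases le_total 0 C with hC | hC
        · refine le_trans ?_ (le_max_right _ _)
          gcongr
          linarith [hτ.2]
        · refine le_trans ?_ (le_max_left _ _)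
          exact mul_nonpos_of_nonpos_of_nonneg (by linarith) (Real.sqrt_nonneg _)
      simp only [hD, hm]
      exact e.trans_lt (hC.trans_lt (max_lt (by linarith) hr1))
    have n1 : ∀ᶠ z : ℝ × ℝ in 𝓝 (x, t), z.2 ∈ Ioo (t - r / 2) (t + r) :=
      continuous_snd.continuousAt.eventually_mem (Ioo_mem_nhds (by simp; linarith) (by simp; linarith))
    have n2 := Metric.continuousAt_iff'.1 (cD.continuousAt (x := (x, t))) (ε / 3) (by linarith)
    filter_upwards [n1, n2] with z hz1 hz2
    have b1 := hDb z hz1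
    have b2 := hDb (x, t) ⟨by simp; linarith, by simp; linarith⟩
    rw [dist_eq_norm] at hz2 ⊢
    calc ‖s • (θ z.1 : ℂ) • wx z.1 z.2 - s • (θ x : ℂ) • wx x t‖
        = ‖(s • (θ z.1 : ℂ) • wx z.1 z.2 - D z) + (D z - D (x, t)) -
            (s • (θ x : ℂ) • wx x t - D (x, t))‖ := by congr 1; abel
      _ ≤ ‖s • (θ z.1 : ℂ) • wx z.1 z.2 - D z‖ + ‖D z - D (x, t)‖ +
            ‖s • (θ x : ℂ) • wx x t - D (x, t)‖ :=
          (norm_sub_le _ _).trans (add_le_add (norm_add_le _ _) le_rfl)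
      _ < ε := by
          simp only at b2
          linarith
  have k2 := key.const_smul s⁻¹
  refine k2.congr ?_
  have n1 : ∀ᶠ z : ℝ × ℝ in 𝓝 (x, t), z.1 ∈ Ioo p1 q1 :=
    continuous_fst.continuousAt.eventually_mem (Ioo_mem_nhds hx.1 hx.2)
  filter_upwards [n1] with z hz
  simp only [Pi.smul_apply]
  rw [one z.1 (Ioo_subset_Icc_self hz), Complex.ofReal_one, one_smul, smul_smul, inv_mul_cancel₀ hs0,
    one_smul]

end

open Set Filter Topology MeasureTheory Asymptotics
set_option linter.unusedSectionVars false

theorem chain_rule {f fx : ℝ → ℝ → ℂ} {p q : ℝ → ℝ} {t p' q' : ℝ} {ft : ℂ}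
    (hfx : ∀ ξ τ, HasDerivAt (fun ξ => f ξ τ) (fx ξ τ) ξ)
    (cfx : Continuous fun z : ℝ × ℝ => fx z.1 z.2)
    (hft : HasDerivAt (fun τ => f (p t) τ) ft (q t))
    (hp : HasDerivAt p p' t) (hq : HasDerivAt q q' t)
    (cp : Continuous p) (cq : Continuous q) :
    HasDerivAt (fun s => f (p s) (q s)) ((p' : ℂ) * fx (p t) (q t) + (q' : ℂ) * ft) t := by
  set K : ℝ → ℂ := fun s => ∫ θ in (0:ℝ)..1, fx (p t + θ * (p s - p t)) (q s) with hK
  have cK : Continuous K := by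
    refine intervalIntegral.continuous_parametric_intervalIntegral_of_continuous' ?_ 0 1
    exact cfx.comp (f := fun y : ℝ × ℝ => (p t + y.2 * (p y.1 - p t), q y.1)) (by fun_prop)
  have hKt : K t = fx (p t) (q t) := by simp [hK]
  have hrep : ∀ s, f (p s) (q s) = f (p t) (q s) + ((p s - p t : ℝ) : ℂ) * K s := by
    intro s
    have hd : ∀ θ ∈ uIcc (0:ℝ) 1, HasDerivAt (fun θ : ℝ => f (p t + θ * (p s - p t)) (q s))
        (((p s - p t : ℝ) : ℂ) * fx (p t + θ * (p s - p t)) (q s)) θ := by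
      intro θ _
      have h1 : HasDerivAt (fun θ : ℝ => p t + θ * (p s - p t)) (p s - p t) θ := by
        simpa using ((hasDerivAt_id θ).mul_const (p s - p t)).const_add (p t)
      have := (hfx (p t + θ * (p s - p t)) (q s)).scomp θ h1
      refine this.congr_deriv ?_
      rw [Complex.real_smul]
    have hc : Continuous fun θ : ℝ => ((p s - p t : ℝ) : ℂ) * fx (p t + θ * (p s - p t)) (q s) :=
      continuous_const.mul (cfx.comp (f := fun θ : ℝ => (p t + θ * (p s - p t), q s)) (by fun_prop))
    have := intervalIntegral.integral_eq_sub_of_hasDerivAt hd (hc.intervalIntegrable _ _)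
    rw [intervalIntegral.integral_const_mul] at this
    simp only [zero_mul, one_mul, add_zero, add_sub_cancel] at this
    rw [hK]; simp only
    rw [this]; ring
  have h2 : HasDerivAt (fun s => ((p s - p t : ℝ) : ℂ) * K s) ((p' : ℂ) * fx (p t) (q t)) t := by
    rw [hasDerivAt_iff_tendsto_slope]
    have hs := (hasDerivAt_iff_tendsto_slope.1 hp.ofReal_comp)
    have hk : Tendsto K (𝓝[≠] t) (𝓝 (fx (p t) (q t))) := by
      rw [← hKt]; exact (cK.tendsto t).mono_left nhdsWithin_le_nhds
    refine (hs.mul hk).congr fun s => ?_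
    simp [slope_def_module]
    ring
  have h3 := (hft.scomp t hq).add h2
  refine (h3.congr_of_eventuallyEq (Eventually.of_forall fun s => ?_)).congr_deriv ?_
  · exact hrep s
  · rw [Complex.real_smul]; ring

theorem contDiff_two_data {f : ℝ → ℂ} (hf : ContDiff ℝ 2 f) :
    (∀ x, HasDerivAt f (deriv f x) x) ∧ (∀ x, HasDerivAt (deriv f) (iteratedDeriv 2 f x) x) ∧
      Continuous (iteratedDeriv 2 f) := by
  have e : iteratedDeriv 2 f = deriv (deriv f) := by
    rw [iteratedDeriv_succ, iteratedDeriv_one]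
  refine ⟨fun x => (hf.differentiable (by norm_num) x).hasDerivAt, fun x => ?_,
    hf.continuous_iteratedDeriv 2 le_rfl⟩
  rw [e]
  have h1 : ContDiff ℝ 1 (deriv f) := by
    have : ContDiff ℝ (1 + 1) f := by
      have h11 : (1 + 1 : WithTop ℕ∞) = 2 := by norm_num
      rw [h11]; exact hf
    exact (contDiff_succ_iff_deriv.1 this).2.2
  exact (h1.differentiable (by norm_num) x).hasDerivAt

theorem hasDerivAt_two {f g : ℝ → ℂ} {f' g' : ℂ} {x : ℝ} (hf : HasDerivAt f f' x)
    (hg : HasDerivAt g g' x) :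
    HasDerivAt (fun x => (!₂[f x, g x] : EuclideanSpace ℂ (Fin 2))) !₂[f', g'] x := by
  have h1 : HasDerivAt (fun x => (![f x, g x] : Fin 2 → ℂ)) ![f', g'] x := by
    rw [hasDerivAt_pi]
    intro i
    fin_cases i
    · simpa using hf
    · simpa using hg
  exact ((PiLp.continuousLinearEquiv 2 ℝ (fun _ : Fin 2 => ℂ)).symm.toContinuousLinearMap
    |>.hasFDerivAt.comp_hasDerivAt x h1)

theorem continuous_two {f g : ℝ → ℂ} (hf : Continuous f) (hg : Continuous g) :
    Continuous (fun x => (!₂[f x, g x] : EuclideanSpace ℂ (Fin 2))) := by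
  refine (PiLp.continuous_toLp 2 _).comp (continuous_pi fun i => ?_)
  fin_cases i
  · simpa using hf
  · simpa using hg

theorem conj_hasDerivAt {f : ℝ → ℂ} {f' : ℂ} {x : ℝ} (hf : HasDerivAt f f' x) :
    HasDerivAt (fun x => (starRingEnd ℂ) (f x)) ((starRingEnd ℂ) f') x :=
  hf.star

theorem cnls_sol (d0 g0 h0 : ℝ) (u v : ℝ → ℝ → ℂ)
    (huξ : ∀ τ, ContDiff ℝ 2 (fun ξ => u ξ τ))
    (huτ : ∀ ξ, ContDiff ℝ 1 (fun τ => u ξ τ))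
    (hvξ : ∀ τ, ContDiff ℝ 2 (fun ξ => v ξ τ))
    (hvτ : ∀ ξ, ContDiff ℝ 1 (fun τ => v ξ τ))
    (hu : ∀ ξ τ : ℝ,
      Complex.I * pderivT u ξ τ + pderivXX u ξ τ + Complex.I * (d0 : ℂ) * u ξ τ
        - (g0 : ℂ) * u ξ τ
        - (h0 : ℂ) * ((‖u ξ τ‖ ^ 2 + ‖v ξ τ‖ ^ 2 : ℝ) : ℂ) * u ξ τ = 0)
    (hv : ∀ ξ τ : ℝ,
      Complex.I * pderivT v ξ τ - pderivXX v ξ τ + Complex.I * (d0 : ℂ) * v ξ τ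
        + (g0 : ℂ) * v ξ τ
        + (h0 : ℂ) * ((‖u ξ τ‖ ^ 2 + ‖v ξ τ‖ ^ 2 : ℝ) : ℂ) * v ξ τ = 0) :
    Sol (E := EuclideanSpace ℂ (Fin 2)) Complex.I (d0 + Complex.I * g0) h0
      (fun ξ t => !₂[u ξ t, (starRingEnd ℂ) (v ξ t)])
      (fun ξ t => !₂[pderivX u ξ t, (starRingEnd ℂ) (pderivX v ξ t)])
      (fun ξ t => !₂[pderivXX u ξ t, (starRingEnd ℂ) (pderivXX v ξ t)])
      (fun ξ t => !₂[pderivT u ξ t, (starRingEnd ℂ) (pderivT v ξ t)]) where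
  hι := Or.inl rfl
  hx ξ t := hasDerivAt_two ((contDiff_two_data (huξ t)).1 ξ)
    (conj_hasDerivAt ((contDiff_two_data (hvξ t)).1 ξ))
  hxx ξ t := hasDerivAt_two ((contDiff_two_data (huξ t)).2.1 ξ)
    (conj_hasDerivAt ((contDiff_two_data (hvξ t)).2.1 ξ))
  ht ξ t := hasDerivAt_two (((huτ ξ).differentiable (by norm_num) t).hasDerivAt)
    (conj_hasDerivAt (((hvτ ξ).differentiable (by norm_num) t).hasDerivAt))
  cxx t := continuous_two (contDiff_two_data (huξ t)).2.2
    (Complex.continuous_conj.comp (contDiff_two_data (hvξ t)).2.2)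
  ct ξ := continuous_two ((huτ ξ).continuous_deriv (by norm_num))
    (Complex.continuous_conj.comp ((hvτ ξ).continuous_deriv (by norm_num)))
  eq ξ t := by
    have hn : ‖(!₂[u ξ t, (starRingEnd ℂ) (v ξ t)] : EuclideanSpace ℂ (Fin 2))‖ ^ 2
        = ‖u ξ t‖ ^ 2 + ‖v ξ t‖ ^ 2 := by
      rw [EuclideanSpace.norm_sq_eq]
      simp [Fin.sum_univ_two]
    rw [hn]
    have e1 := hu ξ t
    have e2 := congrArg (starRingEnd ℂ) (hv ξ t)
    simp only [map_add, map_sub, map_mul, Complex.conj_I, Complex.conj_ofReal, map_zero] at e2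
    generalize ‖u ξ t‖ ^ 2 + ‖v ξ t‖ ^ 2 = N at e1 e2 ⊢
    ext i
    fin_cases i
    · simp
      linear_combination (-Complex.I) * e1 + (pderivT u ξ t + d0 * u ξ t) * Complex.I_sq
    · simp
      linear_combination (Complex.I) * e2 + ((starRingEnd ℂ) (pderivT v ξ t)
        + d0 * (starRingEnd ℂ) (v ξ t)) * Complex.I_sq

theorem cnls_joint (d0 g0 h0 : ℝ) (u v : ℝ → ℝ → ℂ)
    (S : Sol (E := EuclideanSpace ℂ (Fin 2)) Complex.I (d0 + Complex.I * g0) h0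
      (fun ξ t => !₂[u ξ t, (starRingEnd ℂ) (v ξ t)])
      (fun ξ t => !₂[pderivX u ξ t, (starRingEnd ℂ) (pderivX v ξ t)])
      (fun ξ t => !₂[pderivXX u ξ t, (starRingEnd ℂ) (pderivXX v ξ t)])
      (fun ξ t => !₂[pderivT u ξ t, (starRingEnd ℂ) (pderivT v ξ t)])) :
    (Continuous fun z : ℝ × ℝ => pderivX u z.1 z.2) ∧
      (Continuous fun z : ℝ × ℝ => pderivX v z.1 z.2) := by
  have H := (PiLp.continuous_ofLp 2 (fun _ : Fin 2 => ℂ)).comp S.wx_cont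
  have h0 := (continuous_apply (0 : Fin 2)).comp H
  have h1 := Complex.continuous_conj.comp ((continuous_apply (1 : Fin 2)).comp H)
  refine ⟨h0.congr fun z => ?_, h1.congr fun z => ?_⟩
  · simp
  · simp

/-- Derivatives of the transformed function. -/
theorem transform_derivs {u : ℝ → ℝ → ℂ} {α β γ m : ℝ → ℝ} (κ : ℂ)
    (huξ : ∀ τ, ContDiff ℝ 2 (fun ξ => u ξ τ))
    (huτ : ∀ ξ, ContDiff ℝ 1 (fun τ => u ξ τ))
    (cu : Continuous fun z : ℝ × ℝ => pderivX u z.1 z.2)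
    (hα : Differentiable ℝ α) (hβ : Differentiable ℝ β) (hγ : Differentiable ℝ γ)
    {x t m' : ℝ} (hm : HasDerivAt m m' t) (ψ : ℝ → ℝ → ℂ)
    (hψ : ψ = fun (x t : ℝ) => (m t : ℂ) * Complex.exp (κ * (α t : ℂ) * (x : ℂ) ^ 2)
      * u (β t * x) (γ t)) :
    pderivX ψ x t = (m t : ℂ) * Complex.exp (κ * (α t : ℂ) * (x : ℂ) ^ 2) *
      (2 * κ * α t * x * u (β t * x) (γ t) + β t * pderivX u (β t * x) (γ t)) ∧
    pderivXX ψ x t = (m t : ℂ) * Complex.exp (κ * (α t : ℂ) * (x : ℂ) ^ 2) *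
      ((2 * κ * α t * x) ^ 2 * u (β t * x) (γ t) + 2 * κ * α t * u (β t * x) (γ t)
        + 2 * (2 * κ * α t * x) * β t * pderivX u (β t * x) (γ t)
        + (β t) ^ 2 * pderivXX u (β t * x) (γ t)) ∧
    pderivT ψ x t = Complex.exp (κ * (α t : ℂ) * (x : ℂ) ^ 2) *
      (m' * u (β t * x) (γ t) + m t * (κ * (deriv α t : ℝ) * x ^ 2) * u (β t * x) (γ t)
        + m t * ((deriv β t : ℝ) * x * pderivX u (β t * x) (γ t)
          + (deriv γ t : ℝ) * pderivT u (β t * x) (γ t))) := by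
  have hlin : ∀ x : ℝ, HasDerivAt (fun x : ℝ => β t * x) (β t) x := fun x => by
    simpa using (hasDerivAt_id x).const_mul (β t)
  have hid : ∀ x : ℝ, HasDerivAt (fun x : ℝ => (x : ℂ)) 1 x := fun x => by
    simpa using (hasDerivAt_id x).ofReal_comp
  have hexp : ∀ x : ℝ, HasDerivAt (fun x : ℝ => (m t : ℂ) *
      Complex.exp (κ * (α t : ℂ) * (x : ℂ) ^ 2))
      ((m t : ℂ) * Complex.exp (κ * (α t : ℂ) * (x : ℂ) ^ 2) * (2 * κ * α t * x)) x := fun x => by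
    have := ((((hid x).pow 2).const_mul (κ * (α t : ℂ))).cexp).const_mul (m t : ℂ)
    refine this.congr_deriv ?_
    simp; ring
  have hu0 : ∀ x : ℝ, HasDerivAt (fun x : ℝ => u (β t * x) (γ t))
      (β t * pderivX u (β t * x) (γ t)) x := fun x => by
    have := ((contDiff_two_data (huξ (γ t))).1 (β t * x)).scomp x (hlin x)
    refine this.congr_deriv ?_
    rw [Complex.real_smul]; rfl
  have hu1 : ∀ x : ℝ, HasDerivAt (fun x : ℝ => pderivX u (β t * x) (γ t))
      (β t * pderivXX u (β t * x) (γ t)) x := fun x => by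
    have := ((contDiff_two_data (huξ (γ t))).2.1 (β t * x)).scomp x (hlin x)
    refine this.congr_deriv ?_
    rw [Complex.real_smul]; rfl
  have hd1 : ∀ x : ℝ, HasDerivAt (fun x => ψ x t) ((m t : ℂ) *
      Complex.exp (κ * (α t : ℂ) * (x : ℂ) ^ 2) *
      (2 * κ * α t * x * u (β t * x) (γ t) + β t * pderivX u (β t * x) (γ t))) x := fun x => by
    rw [hψ]
    refine ((hexp x).mul (hu0 x)).congr_deriv ?_
    ring
  have hdf : deriv (fun x => ψ x t) = fun x : ℝ => (m t : ℂ) *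
      Complex.exp (κ * (α t : ℂ) * (x : ℂ) ^ 2) *
      (2 * κ * α t * x * u (β t * x) (γ t) + β t * pderivX u (β t * x) (γ t)) :=
    funext fun x => (hd1 x).deriv
  refine ⟨(hd1 x).deriv, ?_, ?_⟩
  · rw [pderivXX, iteratedDeriv_succ, iteratedDeriv_one, hdf]
    refine HasDerivAt.deriv ?_
    have h3 := (((hid x).const_mul (2 * κ * α t)).mul (hu0 x)).add ((hu1 x).const_mul (β t : ℂ))
    refine ((hexp x).mul h3).congr_deriv ?_
    simp
    ring
  · rw [pderivT]
    refine HasDerivAt.deriv ?_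
    have hc := chain_rule (f := u) (fx := pderivX u) (p := fun t => β t * x) (q := γ) (t := t)
      (p' := deriv β t * x) (q' := deriv γ t) (ft := pderivT u (β t * x) (γ t))
      (fun ξ τ => (contDiff_two_data (huξ τ)).1 ξ) cu
      (((huτ (β t * x)).differentiable (by norm_num) (γ t)).hasDerivAt)
      ((hβ t).hasDerivAt.mul_const x) (hγ t).hasDerivAt (hβ.continuous.mul continuous_const)
      hγ.continuous
    have hα' := (((hα t).hasDerivAt.ofReal_comp.const_mul κ).mul_const ((x : ℂ) ^ 2)).cexp
    rw [hψ]
    refine ((hm.ofReal_comp.mul hα').mul hc).congr_deriv ?_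
    simp only [Pi.mul_apply]
    push_cast
    ring

/-- Theorem 1 of the paper: the transformation
`ψ(x,t) = μ(t)^(-1/2) exp(i α(t) x²) u(β(t)x, γ(t))`,
`φ(x,t) = μ(t)^(-1/2) exp(-i α(t) x²) v(β(t)x, γ(t))`
maps solutions `(u,v)` of the constant-coefficient coupled NLS system to solutions
`(ψ,φ)` of the variable-coefficient coupled NLS system, provided the Riccati system holds. -/
theorem cnls_transformation_to_constant_coefficients
    (a b c d g h : ℝ → ℝ) (d0 g0 h0 : ℝ)
    (μ α β γ : ℝ → ℝ)
    (hμdiff : Differentiable ℝ μ) (hαdiff : Differentiable ℝ α)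
    (hβdiff : Differentiable ℝ β) (hγdiff : Differentiable ℝ γ)
    (hRic1 : ∀ t, deriv α t + b t + 2 * c t * α t + 4 * a t * (α t) ^ 2 = 0)
    (hRic2 : ∀ t, deriv β t + (c t + 4 * a t * α t) * β t = 0)
    (hRic3 : ∀ t, deriv γ t - a t * (β t) ^ 2 = 0)
    (hRic4 : ∀ t, deriv μ t - 4 * a t * α t * μ t = 0)
    (hμpos : ∀ t, 0 < μ t)
    (hd : ∀ t, d t = d0 * a t * (β t) ^ 2)
    (hg : ∀ t, g t = g0 * a t * (β t) ^ 2)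
    (hh : ∀ t, h t = h0 * a t * (β t) ^ 2 * μ t)
    (u v : ℝ → ℝ → ℂ)
    (huξ : ∀ τ, ContDiff ℝ 2 (fun ξ => u ξ τ))
    (huτ : ∀ ξ, ContDiff ℝ 1 (fun τ => u ξ τ))
    (hvξ : ∀ τ, ContDiff ℝ 2 (fun ξ => v ξ τ))
    (hvτ : ∀ ξ, ContDiff ℝ 1 (fun τ => v ξ τ))
    (hu : ∀ ξ τ : ℝ,
      Complex.I * pderivT u ξ τ + pderivXX u ξ τ + Complex.I * (d0 : ℂ) * u ξ τ
        - (g0 : ℂ) * u ξ τ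
        - (h0 : ℂ) * ((‖u ξ τ‖ ^ 2 + ‖v ξ τ‖ ^ 2 : ℝ) : ℂ) * u ξ τ = 0)
    (hv : ∀ ξ τ : ℝ,
      Complex.I * pderivT v ξ τ - pderivXX v ξ τ + Complex.I * (d0 : ℂ) * v ξ τ
        + (g0 : ℂ) * v ξ τ
        + (h0 : ℂ) * ((‖u ξ τ‖ ^ 2 + ‖v ξ τ‖ ^ 2 : ℝ) : ℂ) * v ξ τ = 0) :
    CNLS a b c d g h
      (fun x t => ((μ t ^ (-(1 : ℝ) / 2) : ℝ) : ℂ)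
        * Complex.exp (Complex.I * (α t : ℂ) * (x : ℂ) ^ 2) * u (β t * x) (γ t))
      (fun x t => ((μ t ^ (-(1 : ℝ) / 2) : ℝ) : ℂ)
        * Complex.exp (-(Complex.I * (α t : ℂ) * (x : ℂ) ^ 2)) * v (β t * x) (γ t)) := by
  have S := cnls_sol d0 g0 h0 u v huξ huτ hvξ hvτ hu hv
  obtain ⟨cu, cv⟩ := cnls_joint d0 g0 h0 u v S
  intro x t
  set m : ℝ → ℝ := fun t => μ t ^ (-(1 : ℝ) / 2) with hm
  have hμ' : deriv μ t = 4 * a t * α t * μ t := by linarith [hRic4 t]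
  have hmd : HasDerivAt m (-2 * a t * α t * m t) t := by
    have := (hμdiff t).hasDerivAt.rpow_const (p := -(1 : ℝ) / 2) (Or.inl (hμpos t).ne')
    refine this.congr_deriv ?_
    rw [Real.rpow_sub_one (hμpos t).ne', hμ', hm]
    have := (hμpos t).ne'
    field_simp
    ring
  have hm2 : μ t * m t ^ 2 = 1 := by
    rw [hm]
    simp only
    rw [← Real.rpow_natCast, ← Real.rpow_mul (hμpos t).le]
    norm_num
    rw [Real.rpow_neg_one, mul_inv_cancel₀ (hμpos t).ne']
  have hm2c : (μ t : ℂ) * (m t : ℂ) ^ 2 = 1 := by exact_mod_cast hm2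
  have e1 : ‖Complex.exp (Complex.I * (α t : ℂ) * (x : ℂ) ^ 2)‖ = 1 := by
    rw [Complex.norm_exp]
    simp [← Complex.ofReal_pow]
  have e2 : ‖Complex.exp (-(Complex.I * (α t : ℂ) * (x : ℂ) ^ 2))‖ = 1 := by
    rw [Complex.norm_exp]
    simp [← Complex.ofReal_pow]
  obtain ⟨p1, p2, p3⟩ := transform_derivs (x := x) (t := t) Complex.I huξ huτ cu hαdiff hβdiff hγdiff
    hmd (fun x t => ((μ t ^ (-(1 : ℝ) / 2) : ℝ) : ℂ)
        * Complex.exp (Complex.I * (α t : ℂ) * (x : ℂ) ^ 2) * u (β t * x) (γ t)) rfl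
  obtain ⟨q1, q2, q3⟩ := transform_derivs (x := x) (t := t) (-Complex.I) hvξ hvτ cv hαdiff hβdiff
    hγdiff hmd (fun x t => ((μ t ^ (-(1 : ℝ) / 2) : ℝ) : ℂ)
        * Complex.exp (-(Complex.I * (α t : ℂ) * (x : ℂ) ^ 2)) * v (β t * x) (γ t))
      (by simp only [hm, neg_mul])
  have hα' : deriv α t = -(b t + 2 * c t * α t + 4 * a t * (α t) ^ 2) := by linarith [hRic1 t]
  have hβ' : deriv β t = -((c t + 4 * a t * α t) * β t) := by linarith [hRic2 t]
  have hγ' : deriv γ t = a t * (β t) ^ 2 := by linarith [hRic3 t]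
  rw [p1, p2, p3, q1, q2, q3, hd, hg, hh, hα', hβ', hγ']
  have hmt : μ t ^ (-(1 : ℝ) / 2) = m t := rfl
  simp only [norm_mul, e1, e2, hmt, mul_one, neg_mul, Complex.norm_real, Real.norm_eq_abs, mul_pow,
    sq_abs]
  have hu' := hu (β t * x) (γ t)
  have hv' := hv (β t * x) (γ t)
  have I2 := Complex.I_sq
  push_cast at hu' hv' ⊢
  generalize Complex.exp (Complex.I * (α t : ℂ) * (x : ℂ) ^ 2) = e
  generalize Complex.exp (-(Complex.I * (α t : ℂ) * (x : ℂ) ^ 2)) = e'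
  generalize (‖u (β t * x) (γ t)‖ : ℂ) = nu at *
  generalize (‖v (β t * x) (γ t)‖ : ℂ) = nv at *
  generalize u (β t * x) (γ t) = U at *
  generalize v (β t * x) (γ t) = V at *
  generalize pderivX u (β t * x) (γ t) = UX at *
  generalize pderivX v (β t * x) (γ t) = VX at *
  generalize pderivXX u (β t * x) (γ t) = UXX at *
  generalize pderivXX v (β t * x) (γ t) = VXX at *
  generalize pderivT u (β t * x) (γ t) = UT at *
  generalize pderivT v (β t * x) (γ t) = VT at *
  generalize (m t : ℂ) = M at *
  clear_value m
  constructor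
  · linear_combination (M * e * a t * β t ^ 2) * hu'
      - (h0 * a t * β t ^ 2 * (nu ^ 2 + nv ^ 2) * M * e * U) * hm2c
      - (M * e * U * x ^ 2 * b t) * I2
  · linear_combination (M * e' * a t * β t ^ 2) * hv'
      + (h0 * a t * β t ^ 2 * (nu ^ 2 + nv ^ 2) * M * e' * V) * hm2c
      + (M * e' * V * x ^ 2 * b t) * I2
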